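/- Let p, q be positive integers and m ≥ 2 an integer. The number of multichains π_1 ≤ π_2 ≤ … ≤ π_{m-1} in NC^B(p,q) in which at least one π_i has positive connectivity equals Σ_{c ≥ 1} 2c · C(mp, p-c) · C(mq, q+c). -/

import Mathlib

/-!  Common setup: annular non-crossing partitions of type B, following
Goulden–Nica–Oancea, "Enumerative properties of NC^(B)(p,q)". -/

/-- The underlying set `{±1, …, ±n}`, realized inside `ℤ`. -/
def signedSet (n : ℕ) : Set ℤ := {x : ℤ | x ≠ 0 ∧ |x| ≤ (n : ℤ)}

/-- Membership in the hyperoctahedral group `B_n`, realized as the permutations of `ℤ`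
that commute with negation and fix every point outside `{±1, …, ±n}`. -/
def inB (n : ℕ) (π : Equiv.Perm ℤ) : Prop :=
  (∀ x : ℤ, π (-x) = -(π x)) ∧ ∀ x : ℤ, x ∉ signedSet n → π x = x

/-- The set of generators of `B_n`:
`(i,j)(-i,-j)`, `(i,-j)(-i,j)` for `1 ≤ i ≠ j ≤ n`, and `(i,-i)` for `1 ≤ i ≤ n`. -/
def genB (n : ℕ) : Set (Equiv.Perm ℤ) :=
  {π | (∃ i j : ℤ, 1 ≤ i ∧ i ≤ (n : ℤ) ∧ 1 ≤ j ∧ j ≤ (n : ℤ) ∧ i ≠ j ∧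
          π = Equiv.swap i j * Equiv.swap (-i) (-j)) ∨
       (∃ i j : ℤ, 1 ≤ i ∧ i ≤ (n : ℤ) ∧ 1 ≤ j ∧ j ≤ (n : ℤ) ∧ i ≠ j ∧
          π = Equiv.swap i (-j) * Equiv.swap (-i) j) ∨
       (∃ i : ℤ, 1 ≤ i ∧ i ≤ (n : ℤ) ∧ π = Equiv.swap i (-i))}

/-- The length function `ℓ_B` on `B_n`: the least `k` such that `τ` is a product of `k`
generators from `genB n` (the empty product being the identity). -/
noncomputable def lenB (n : ℕ) (τ : Equiv.Perm ℤ) : ℕ :=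
  sInf {k : ℕ | ∃ l : List (Equiv.Perm ℤ),
    l.length = k ∧ (∀ g ∈ l, g ∈ genB n) ∧ l.prod = τ}

/-- The partial order on `B_n`:  `τ ≤ σ` iff `ℓ_B(σ) = ℓ_B(τ) + ℓ_B(τ⁻¹σ)`. -/
def leB (n : ℕ) (τ σ : Equiv.Perm ℤ) : Prop :=
  lenB n σ = lenB n τ + lenB n (τ⁻¹ * σ)

/-- The permutation `γ_{p,q} = (1,…,p,-1,…,-p)(p+1,…,p+q,-(p+1),…,-(p+q))`. -/
def gammaPQ (p q : ℕ) : Equiv.Perm ℤ :=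
  (((List.range p).map fun i => ((i : ℤ) + 1)) ++
      ((List.range p).map fun i => -((i : ℤ) + 1))).formPerm *
    (((List.range q).map fun i => ((p : ℤ) + (i : ℤ) + 1)) ++
      ((List.range q).map fun i => -((p : ℤ) + (i : ℤ) + 1))).formPerm

/-- The long cycle `γ_n = (1,…,n,-1,…,-n)` of `B_n` (disc case). -/
def gammaDisc (n : ℕ) : Equiv.Perm ℤ :=
  (((List.range n).map fun i => ((i : ℤ) + 1)) ++
    ((List.range n).map fun i => -((i : ℤ) + 1))).formPerm

/-- The annular non-crossing permutations of type B: `S^B_nc(p,q) = [ε, γ_{p,q}] ⊆ B_{p+q}`. -/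
def SncB (p q : ℕ) : Set (Equiv.Perm ℤ) :=
  {τ | inB (p + q) τ ∧ leB (p + q) τ (gammaPQ p q)}

/-- The orbit of `x` under the permutation `τ`. -/
def permOrbit (τ : Equiv.Perm ℤ) (x : ℤ) : Set ℤ := {y | ∃ m : ℤ, (τ ^ m) x = y}

/-- The partition `Ω(τ)` of `{±1,…,±n}` into orbits of `τ`. -/
def orbitsOn (n : ℕ) (τ : Equiv.Perm ℤ) : Set (Set ℤ) :=
  {A | ∃ x ∈ signedSet n, A = permOrbit τ x}

/-- The negation `-A` of a set `A ⊆ ℤ`. -/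
def negSet (A : Set ℤ) : Set ℤ := {x | -x ∈ A}

/-- The partition `Ω̃(τ)`, obtained from `Ω(τ)` by merging all inversion-invariant orbits
(orbits `A` with `A = -A`) into a single block. -/
def omegaTilde (n : ℕ) (τ : Equiv.Perm ℤ) : Set (Set ℤ) :=
  {A | A ∈ orbitsOn n τ ∧ negSet A ≠ A} ∪
    {B | B = ⋃₀ {A | A ∈ orbitsOn n τ ∧ negSet A = A} ∧ B.Nonempty}

/-- The annular non-crossing partitions of type B: `NC^B(p,q) = {Ω̃(τ) : τ ∈ S^B_nc(p,q)}`. -/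
def NCB (p q : ℕ) : Set (Set (Set ℤ)) :=
  {π | ∃ τ ∈ SncB p q, π = omegaTilde (p + q) τ}

/-- The type B non-crossing partitions of the disc: `NC^B(n) = {Ω̃(τ) : τ ∈ B_n, τ ≤ γ_n}`. -/
def NCBdisc (n : ℕ) : Set (Set (Set ℤ)) :=
  {π | ∃ τ, inB n τ ∧ leB n τ (gammaDisc n) ∧ π = omegaTilde n τ}

/-- Reverse refinement order on partitions: every block of `π` is contained in a block of `ρ`. -/
def refines (π ρ : Set (Set ℤ)) : Prop := ∀ A ∈ π, ∃ B ∈ ρ, A ⊆ B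

/-- The rank of a partition of `{±1,…,±n}`:
`n` minus half the number of blocks `A` with `A ≠ -A`. -/
noncomputable def rankNCB (n : ℕ) (π : Set (Set ℤ)) : ℕ :=
  n - {A | A ∈ π ∧ negSet A ≠ A}.ncard / 2

/-- The inner point set `{±(p+1), …, ±(p+q)}`. -/
def innerSet (p q : ℕ) : Set ℤ := {x : ℤ | (p : ℤ) < |x| ∧ |x| ≤ (p : ℤ) + (q : ℤ)}

/-- The connectivity of `π ∈ NC^B(p,q)`: half the number of blocks `A` with `A ≠ -A`
meeting both `{±1,…,±p}` and `{±(p+1),…,±(p+q)}`. -/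
noncomputable def connectivity (p q : ℕ) (π : Set (Set ℤ)) : ℕ :=
  {A | A ∈ π ∧ negSet A ≠ A ∧ (A ∩ signedSet p).Nonempty ∧
    (A ∩ innerSet p q).Nonempty}.ncard / 2

/-- The number of exterior pairs of blocks `{A, -A}` (with `A ≠ -A`, `A ⊆ {±1,…,±p}`). -/
noncomputable def extPairs (p : ℕ) (π : Set (Set ℤ)) : ℕ :=
  {A | A ∈ π ∧ negSet A ≠ A ∧ A ⊆ signedSet p}.ncard / 2

/-- The number of interior pairs of blocks `{A, -A}`
(with `A ≠ -A`, `A ⊆ {±(p+1),…,±(p+q)}`). -/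
noncomputable def intPairs (p q : ℕ) (π : Set (Set ℤ)) : ℕ :=
  {A | A ∈ π ∧ negSet A ≠ A ∧ A ⊆ innerSet p q}.ncard / 2

/-- The minimum `0̂` of `NC^B(p,q)` (with `n = p+q`): the partition into singletons. -/
def botNCB (n : ℕ) : Set (Set ℤ) := {A | ∃ x ∈ signedSet n, A = {x}}

/-- The maximum `1̂` of `NC^B(p,q)` (with `n = p+q`): the partition with a single block. -/
def topNCB (n : ℕ) : Set (Set ℤ) := {signedSet n}

/-- The orbit of `x` under the subgroup generated by `{τ, γ}`. -/
def jointOrbit (τ γ : Equiv.Perm ℤ) (x : ℤ) : Set ℤ :=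
  {y | ∃ g ∈ Subgroup.closure ({τ, γ} : Set (Equiv.Perm ℤ)), g x = y}

/-- The orbits on `{±1,…,±n}` of the subgroup generated by `{τ, γ}`. -/
def jointOrbitsOn (n : ℕ) (τ γ : Equiv.Perm ℤ) : Set (Set ℤ) :=
  {Y | ∃ x ∈ signedSet n, Y = jointOrbit τ γ x}


section
open Equiv Equiv.Perm
set_option linter.unusedSectionVars false
set_option linter.unusedVariables false
set_option linter.unusedDecidableInType false
section Core
variable {α : Type*} [DecidableEq α]

/-- delete a point from a permutation -/
def pdel (a : α) (f : Perm α) : Perm α := f * swap (f⁻¹ a) a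

theorem pdel_self (a : α) (f : Perm α) : pdel a f a = a := by simp [pdel]

theorem pdel_of_eq {a x : α} {f : Perm α} (h : f x = a) : pdel a f x = f a := by
  have : f⁻¹ a = x := by rw [← h]; simp
  simp [pdel, this]

theorem pdel_of_ne {a x : α} {f : Perm α} (h : f x ≠ a) (hx : x ≠ a) : pdel a f x = f x := by
  have : x ≠ f⁻¹ a := by rintro rfl; simp at h
  show f (swap (f⁻¹ a) a x) = f x
  rw [swap_apply_of_ne_of_ne this hx]

theorem pdel_fix {a : α} {f : Perm α} (h : f a = a) : pdel a f = f := by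
  have : f⁻¹ a = a := by rw [Perm.inv_eq_iff_eq]; exact h.symm
  rw [pdel, this, swap_self]; rfl

theorem sc_of_step {f g : Perm α} (h : ∀ x, f.SameCycle x (g x)) {x y : α}
    (hxy : g.SameCycle x y) : f.SameCycle x y := by
  obtain ⟨k, rfl⟩ := hxy
  have hinv : ∀ x, f.SameCycle x (g⁻¹ x) := fun x => by
    have := h (g⁻¹ x); rw [show g (g⁻¹ x) = x from g.apply_symm_apply x] at this; exact this.symm
  induction k using Int.induction_on with
  | zero => exact SameCycle.refl _ _
  | succ k ih => rw [add_comm, zpow_add, Perm.mul_apply, zpow_one]; exact ih.trans (h _)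
  | pred k ih =>
    rw [sub_eq_add_neg, add_comm, zpow_add, Perm.mul_apply, zpow_neg_one]; exact ih.trans (hinv _)

theorem sc_inv {f : Perm α} {P : α → Prop} (h : ∀ x, P (f x) ↔ P x) {x y : α}
    (hxy : f.SameCycle x y) : P x ↔ P y := by
  obtain ⟨k, rfl⟩ := hxy
  have hinv : ∀ x, P (f⁻¹ x) ↔ P x := fun x => by
    have := h (f⁻¹ x); rw [show f (f⁻¹ x) = x from f.apply_symm_apply x] at this; exact this.symm
  induction k using Int.induction_on with
  | zero => simp
  | succ k ih => rw [add_comm, zpow_add, Perm.mul_apply, zpow_one, h]; exact ih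
  | pred k ih =>
    rw [sub_eq_add_neg, add_comm, zpow_add, Perm.mul_apply, zpow_neg_one, hinv]; exact ih

theorem sc_inv' {β : Type*} {f : Perm α} {F : α → β} (h : ∀ x, F (f x) = F x) {x y : α}
    (hxy : f.SameCycle x y) : F x = F y := by
  have := sc_inv (f := f) (P := fun z => F z = F x) (fun z => by rw [h]) hxy
  exact (this.1 rfl).symm

theorem sc_step (f : Perm α) (x : α) : f.SameCycle x (f x) := ⟨1, by simp⟩

theorem sc_fix {f : Perm α} {x y : α} (hx : f x = x) (h : f.SameCycle x y) : y = x := by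
  obtain ⟨k, rfl⟩ := h
  exact Perm.zpow_apply_eq_self_of_apply_eq_self hx k

theorem sc_pdel_le {a : α} {f : Perm α} {x y : α} (h : (pdel a f).SameCycle x y) :
    f.SameCycle x y := by
  refine sc_of_step (fun x => ?_) h
  by_cases hx : x = a
  · subst hx; rw [pdel_self]
  by_cases h2 : f x = a
  · rw [pdel_of_eq h2, ← h2]; exact (sc_step f x).trans (sc_step f _)
  · rw [pdel_of_ne h2 hx]; exact sc_step f x

theorem sc_pdel {a : α} {f : Perm α} {x y : α} (hx : x ≠ a) (hy : y ≠ a) :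
    (pdel a f).SameCycle x y ↔ f.SameCycle x y := by
  refine ⟨sc_pdel_le, fun h => ?_⟩
  have key : ∀ k : ℕ, ∀ x y : α, x ≠ a → y ≠ a → (f ^ k) x = y → (pdel a f).SameCycle x y := by
    intro k
    induction k using Nat.strong_induction_on with
    | _ k ih =>
      intro x y hx hy hk
      rcases k with _ | k
      · simp at hk; subst hk; exact SameCycle.refl _ _
      rw [pow_succ, Perm.mul_apply] at hk
      by_cases h2 : f x = a
      · rcases k with _ | k
        · simp at hk; exact absurd (hk ▸ h2) hy
        rw [pow_succ, Perm.mul_apply, h2] at hk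
        have : f a ≠ a := fun h3 => hx (f.injective (h2.trans h3.symm))
        have h4 := ih k (by omega) (f a) y this hy hk
        have h5 := sc_step (pdel a f) x
        rw [pdel_of_eq h2] at h5
        exact h5.trans h4
      · have h4 := ih k (by omega) (f x) y h2 hy hk
        have h5 := sc_step (pdel a f) x
        rw [pdel_of_ne h2 hx] at h5
        exact h5.trans h4
  obtain ⟨k, hk⟩ := h
  rcases Int.eq_nat_or_neg k with ⟨n, rfl | rfl⟩
  · exact key n x y hx hy (by simpa using hk)
  · refine (key n y x hy hx ?_).symm
    rw [← hk]; simp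

/-- transversal -/
def Tr (C : Finset α) (f : Perm α) (R : Finset α) : Prop :=
  R ⊆ C ∧ ∀ x ∈ C, ∃! y, y ∈ R ∧ f.SameCycle x y

theorem Tr.eq {C R : Finset α} {f : Perm α} (h : Tr C f R) {x y : α} (hx : x ∈ R) (hy : y ∈ R)
    (hxy : f.SameCycle x y) : x = y := by
  obtain ⟨z, _, hz⟩ := h.2 x (h.1 hx)
  rw [hz x ⟨hx, SameCycle.refl _ _⟩, hz y ⟨hy, hxy⟩]

theorem Tr.del {C R : Finset α} {f : Perm α} {a : α} (haR : a ∉ R) (h : Tr C f R) :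
    Tr (C.erase a) (pdel a f) R := by
  refine ⟨fun x hx => Finset.mem_erase.2 ⟨fun h' => haR (h' ▸ hx), h.1 hx⟩, fun x hx => ?_⟩
  rw [Finset.mem_erase] at hx
  obtain ⟨y, ⟨hy, hxy⟩, hu⟩ := h.2 x hx.2
  refine ⟨y, ⟨hy, (sc_pdel hx.1 (fun h' => haR (h' ▸ hy))).2 hxy⟩, fun z hz => hu z ⟨hz.1, sc_pdel_le hz.2⟩⟩

theorem Tr.undel {C R : Finset α} {f : Perm α} {a : α} (hfa : f a ≠ a) (hfC : f a ∈ C)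
    (h : Tr (C.erase a) (pdel a f) R) : Tr C f R := by
  have hR : ∀ y ∈ R, y ≠ a := fun y hy => (Finset.mem_erase.1 (h.1 hy)).1
  refine ⟨fun x hx => (Finset.mem_erase.1 (h.1 hx)).2, fun x hx => ?_⟩
  have main : ∀ x ∈ C, x ≠ a → ∃! y, y ∈ R ∧ f.SameCycle x y := by
    intro x hx hxa
    obtain ⟨y, ⟨hy, hxy⟩, hu⟩ := h.2 x (Finset.mem_erase.2 ⟨hxa, hx⟩)
    exact ⟨y, ⟨hy, sc_pdel_le hxy⟩, fun z hz => hu z ⟨hz.1, (sc_pdel hxa (hR z hz.1)).2 hz.2⟩⟩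
  by_cases hxa : x = a
  · subst hxa
    obtain ⟨y, ⟨hy, hxy⟩, hu⟩ := main (f x) hfC hfa
    exact ⟨y, ⟨hy, (sc_step f x).trans hxy⟩, fun z hz => hu z ⟨hz.1, (sc_step f x).symm.trans hz.2⟩⟩
  · exact main x hx hxa

theorem Tr.fix_mem {C R : Finset α} {f : Perm α} {a : α} (h : Tr C f R) (ha : a ∈ C) (hf : f a = a) :
    a ∈ R := by
  obtain ⟨y, ⟨hy, hxy⟩, _⟩ := h.2 a ha
  rwa [sc_fix hf hxy] at hy

theorem Tr.erase_fix {C R : Finset α} {f : Perm α} {a : α} (h : Tr C f R) (hf : f a = a) :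
    Tr (C.erase a) f (R.erase a) := by
  refine ⟨Finset.erase_subset_erase _ h.1, fun x hx => ?_⟩
  rw [Finset.mem_erase] at hx
  obtain ⟨y, ⟨hy, hxy⟩, hu⟩ := h.2 x hx.2
  refine ⟨y, ⟨Finset.mem_erase.2 ⟨?_, hy⟩, hxy⟩, fun z hz => hu z ⟨(Finset.mem_erase.1 hz.1).2, hz.2⟩⟩
  rintro rfl
  exact hx.1 (sc_fix hf hxy.symm)

theorem Tr.insert_fix {C R : Finset α} {f : Perm α} {a : α} (ha : a ∈ C) (hf : f a = a)
    (h : Tr (C.erase a) f R) : Tr C f (insert a R) := by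
  refine ⟨fun x hx => ?_, fun x hx => ?_⟩
  · rcases Finset.mem_insert.1 hx with rfl | hx
    · exact ha
    · exact (Finset.mem_erase.1 (h.1 hx)).2
  · by_cases hxa : x = a
    · subst hxa
      exact ⟨x, ⟨Finset.mem_insert_self _ _, SameCycle.refl _ _⟩, fun z hz => sc_fix hf hz.2⟩
    · obtain ⟨y, ⟨hy, hxy⟩, hu⟩ := h.2 x (Finset.mem_erase.2 ⟨hxa, hx⟩)
      refine ⟨y, ⟨Finset.mem_insert_of_mem hy, hxy⟩, fun z hz => ?_⟩
      rcases Finset.mem_insert.1 hz.1 with rfl | hz'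
      · exact absurd (sc_fix hf hz.2.symm) hxa
      · exact hu z ⟨hz', hz.2⟩

open Classical in
/-- size of a cycle inside C -/
noncomputable def sz (C : Finset α) (f : Perm α) (x : α) : ℕ := (C.filter fun y => f.SameCycle x y).card

theorem sz_del_of_sc {C : Finset α} {f : Perm α} {a x : α} (ha : a ∈ C) (hx : x ≠ a)
    (h : f.SameCycle x a) : sz (C.erase a) (pdel a f) x + 1 = sz C f x := by
  classical
  unfold sz
  have : (C.filter fun y => f.SameCycle x y) =
      insert a ((C.erase a).filter fun y => (pdel a f).SameCycle x y) := by
    ext y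
    simp only [Finset.mem_filter, Finset.mem_insert, Finset.mem_erase]
    by_cases hy : y = a
    · subst hy; simp [ha, h]
    · simp [hy, sc_pdel hx hy]
  rw [this, Finset.card_insert_of_notMem (by simp)]

theorem sz_del_of_not_sc {C : Finset α} {f : Perm α} {a x : α} (hx : x ≠ a)
    (h : ¬ f.SameCycle x a) : sz (C.erase a) (pdel a f) x = sz C f x := by
  classical
  unfold sz
  congr 1
  ext y
  simp only [Finset.mem_filter, Finset.mem_erase]
  by_cases hy : y = a
  · subst hy; simp [h]
  · simp [hy, sc_pdel hx hy]

theorem sz_erase_fix {C : Finset α} {f : Perm α} {a x : α} (hx : x ≠ a)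
    (h : f a = a) : sz (C.erase a) f x = sz C f x := by
  have := sz_del_of_not_sc (C := C) (f := f) hx (fun h' => hx (sc_fix h h'.symm))
  rwa [pdel_fix h] at this

theorem sz_fix {C : Finset α} {f : Perm α} {x : α} (hx : x ∈ C) (h : f x = x) : sz C f x = 1 := by
  classical
  unfold sz
  rw [Finset.card_eq_one]
  refine ⟨x, ?_⟩
  ext y
  simp only [Finset.mem_filter, Finset.mem_singleton]
  exact ⟨fun h' => sc_fix h h'.2, fun h' => by subst h'; exact ⟨hx, SameCycle.refl _ _⟩⟩

theorem fix_of_sz {C : Finset α} {f : Perm α} {x : α} (hx : x ∈ C) (hfx : f x ∈ C)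
    (h : sz C f x = 1) : f x = x := by
  classical
  unfold sz at h
  rw [Finset.card_eq_one] at h
  obtain ⟨z, hz⟩ := h
  have h1 : x ∈ (C.filter fun y => f.SameCycle x y) := Finset.mem_filter.2 ⟨hx, SameCycle.refl _ _⟩
  have h2 : f x ∈ (C.filter fun y => f.SameCycle x y) := Finset.mem_filter.2 ⟨hfx, sc_step _ _⟩
  rw [hz, Finset.mem_singleton] at h1 h2
  rw [h2, h1]

theorem sz_pos {C : Finset α} {f : Perm α} {x : α} (hx : x ∈ C) : 1 ≤ sz C f x := by
  classical
  exact Finset.card_pos.2 ⟨x, Finset.mem_filter.2 ⟨hx, SameCycle.refl _ _⟩⟩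

/-- annulus data -/
structure Ann (C : Finset α) (o : α → Bool) (S : Perm α) : Prop where
  fix : ∀ x, x ∉ C → S x = x
  inv : ∀ x, o (S x) = o x
  tr : ∀ x ∈ C, ∀ y ∈ C, o x = o y → S.SameCycle x y

theorem mem_of_fix {C : Finset α} {f : Perm α} (h : ∀ x, x ∉ C → f x = x) {x : α} :
    f x ∈ C ↔ x ∈ C := by
  constructor
  · intro hx; by_contra h'; rw [h x h'] at hx; exact h' hx
  · intro hx; by_contra h'; have := f.injective (h _ h'); rw [this] at h'; exact h' hx

theorem fix_inv {C : Finset α} {f : Perm α} (h : ∀ x, x ∉ C → f x = x) : ∀ x, x ∉ C → f⁻¹ x = x := by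
  intro x hx; rw [Perm.inv_eq_iff_eq]; exact (h x hx).symm

theorem pdel_fixes {C : Finset α} {f : Perm α} {a : α} (h : ∀ x, x ∉ C → f x = x) :
    ∀ x, x ∉ C.erase a → pdel a f x = x := by
  intro x hx
  by_cases hxa : x = a
  · subst hxa; exact pdel_self _ _
  have hxC : x ∉ C := fun h' => hx (Finset.mem_erase.2 ⟨hxa, h'⟩)
  rw [pdel_of_ne _ hxa, h x hxC]
  rw [h x hxC]; exact hxa

theorem Ann.del {C : Finset α} {o : α → Bool} {S : Perm α} (h : Ann C o S) (a : α) :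
    Ann (C.erase a) o (pdel a S) := by
  refine ⟨pdel_fixes h.fix, fun x => ?_, fun x hx y hy hxy => ?_⟩
  · by_cases hx : x = a
    · subst hx; rw [pdel_self]
    by_cases h2 : S x = a
    · rw [pdel_of_eq h2, h.inv, ← h2, h.inv]
    · rw [pdel_of_ne h2 hx, h.inv]
  · rw [Finset.mem_erase] at hx hy
    exact (sc_pdel hx.1 hy.1).2 (h.tr x hx.2 y hy.2 hxy)

theorem Ann.inv' {C : Finset α} {o : α → Bool} {S : Perm α} (h : Ann C o S) (x : α) :
    o (S⁻¹ x) = o x := by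
  have := h.inv (S⁻¹ x); simpa using this.symm

/-- good orientation -/
structure Good (C D : Finset α) (o : α → Bool) (S ν : Perm α) : Prop where
  DC : D ⊆ C
  fix : ∀ x, x ∉ C → ν x = x
  trν : Tr C ν (C \ D)
  trψ : Tr C (S * ν⁻¹) D
  star : ∀ u ∈ D, o u = true → ∀ x ∈ C, (S * ν⁻¹).SameCycle u x → o x = true

theorem psi_del {S ν : Perm α} {a : α} (h : ν a = a) : pdel a S * ν⁻¹ = pdel a (S * ν⁻¹) := by
  have h1 : swap (S⁻¹ a) a * ν⁻¹ = ν⁻¹ * swap (ν (S⁻¹ a)) a := by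
    have h2 : swap (S⁻¹ a) a * ν⁻¹ = ν⁻¹ * swap (ν (S⁻¹ a)) (ν a) := by
      rw [Equiv.swap_apply_apply]
      group
    rwa [h] at h2
  simp only [pdel, mul_assoc, h1, mul_inv_rev, inv_inv, Perm.mul_apply]

theorem psi_fixes {C : Finset α} {S ν : Perm α} (hS : ∀ x, x ∉ C → S x = x)
    (hν : ∀ x, x ∉ C → ν x = x) : ∀ x, x ∉ C → (S * ν⁻¹) x = x := by
  intro x hx; rw [Perm.mul_apply, fix_inv hν x hx, hS x hx]

theorem Good.redA {C D : Finset α} {o : α → Bool} {S ν : Perm α} (hA : Ann C o S)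
    (h : Good C D o S ν) {a : α} (ha : a ∈ C) (hνa : ν a = a) (hSa : S a ≠ a) :
    a ∉ D ∧ Good (C.erase a) D o (pdel a S) ν := by
  have haD : a ∉ D := by
    have := h.trν.fix_mem ha hνa
    exact (Finset.mem_sdiff.1 this).2
  refine ⟨haD, fun x hx => Finset.mem_erase.2 ⟨fun h' => haD (h' ▸ hx), h.DC hx⟩, ?_, ?_, ?_, ?_⟩
  · intro x hx
    by_cases hxa : x = a
    · rw [hxa, hνa]
    · exact h.fix x (fun h' => hx (Finset.mem_erase.2 ⟨hxa, h'⟩))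
  · rw [show C.erase a \ D = (C \ D).erase a by rw [Finset.erase_sdiff_comm]]
    exact h.trν.erase_fix hνa
  · rw [psi_del hνa]; exact h.trψ.del haD
  · intro u hu hou x hx hux
    rw [psi_del hνa] at hux
    exact h.star u hu hou x (Finset.mem_erase.1 hx).2 (sc_pdel_le hux)

theorem Good.insA {C D : Finset α} {o : α → Bool} {S ν : Perm α} (hA : Ann C o S)
    {a : α} (ha : a ∈ C) (hSa : S a ≠ a) (h : Good (C.erase a) D o (pdel a S) ν) :
    ν a = a ∧ Good C D o S ν := by
  have hνa : ν a = a := h.fix a (by simp)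
  have haD : a ∉ D := fun h' => by simpa using h.DC h'
  have hψa : (S * ν⁻¹) a = S a := by
    rw [Perm.mul_apply, Perm.inv_eq_iff_eq.2 hνa.symm]
  have hSaC : S a ∈ C := (mem_of_fix hA.fix).2 ha
  refine ⟨hνa, fun x hx => (Finset.mem_erase.1 (h.DC hx)).2, ?_, ?_, ?_, ?_⟩
  · exact fun x hx => h.fix x (fun h' => hx (Finset.mem_erase.1 h').2)
  · have := h.trν
    rw [show C.erase a \ D = (C \ D).erase a by rw [Finset.erase_sdiff_comm]] at this
    have h2 := Tr.insert_fix ha hνa this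
    rwa [Finset.insert_erase (Finset.mem_sdiff.2 ⟨ha, haD⟩)] at h2
  · have := h.trψ
    rw [psi_del hνa] at this
    exact Tr.undel (by rwa [hψa]) (by rwa [hψa]) this
  · intro u hu hou x hx hux
    have hua : u ≠ a := fun h' => haD (h' ▸ hu)
    have key : ∀ x ∈ C, x ≠ a → (S * ν⁻¹).SameCycle u x → o x = true := by
      intro x hx hxa hux
      refine h.star u hu hou x (Finset.mem_erase.2 ⟨hxa, hx⟩) ?_
      rw [psi_del hνa]; exact (sc_pdel hua hxa).2 hux
    by_cases hxa : x = a
    · subst hxa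
      have := key (S x) hSaC hSa (hux.trans (by rw [← hψa]; exact sc_step _ _))
      rwa [hA.inv] at this
    · exact key x hx hxa hux

theorem psi_delB {S ν : Perm α} {u : α} (h : ν (S⁻¹ u) = u) :
    pdel u S * (pdel u ν)⁻¹ = S * ν⁻¹ := by
  have : ν⁻¹ u = S⁻¹ u := by rw [Perm.inv_eq_iff_eq]; exact h.symm
  simp only [pdel, this, mul_inv_rev, swap_inv]
  rw [mul_assoc, ← mul_assoc (swap _ _) (swap _ _), swap_mul_self, one_mul]

theorem Good.redB {C D : Finset α} {o : α → Bool} {S ν : Perm α} (hA : Ann C o S)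
    (h : Good C D o S ν) {u : α} (hu : u ∈ C) (hψu : (S * ν⁻¹) u = u) :
    u ∈ D ∧ ν (S⁻¹ u) = u ∧ Good (C.erase u) (D.erase u) o (pdel u S) (pdel u ν) := by
  have huD : u ∈ D := h.trψ.fix_mem hu hψu
  have hνu : ν (S⁻¹ u) = u := by
    rw [Perm.mul_apply] at hψu
    conv_lhs => rw [← hψu]
    simp
  have e1 := psi_delB hνu
  refine ⟨huD, hνu, Finset.erase_subset_erase _ h.DC, pdel_fixes h.fix, ?_, ?_, ?_⟩
  · rw [show C.erase u \ D.erase u = C \ D by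
      ext x; simp only [Finset.mem_sdiff, Finset.mem_erase]
      by_cases hx : x = u
      · subst hx; simp [huD]
      · simp [hx]]
    exact h.trν.del (by simp [huD])
  · rw [e1]; exact h.trψ.erase_fix hψu
  · intro v hv hov x hx hvx
    rw [e1] at hvx
    exact h.star v (Finset.mem_erase.1 hv).2 hov x (Finset.mem_erase.1 hx).2 hvx

theorem Good.insB {C D : Finset α} {o : α → Bool} {S ν : Perm α} (hA : Ann C o S)
    {u : α} (hu : u ∈ C) (hSu : S u ≠ u) (h : Good (C.erase u) D o (pdel u S) (pdel u ν))
    (hνu : ν (S⁻¹ u) = u) :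
    (S * ν⁻¹) u = u ∧ Good C (insert u D) o S ν := by
  have huD : u ∉ D := fun h' => by simpa using h.DC h'
  have e1 := psi_delB hνu
  have hψu : (S * ν⁻¹) u = u := by
    rw [Perm.mul_apply, Perm.inv_eq_iff_eq.2 hνu.symm]; simp
  have hSu' : S⁻¹ u ≠ u := fun h' => hSu (by rw [Perm.inv_eq_iff_eq] at h'; exact h'.symm)
  have hνu' : ν u ≠ u := fun h' => hSu' (ν.injective (hνu.trans h'.symm))
  have hfix : ∀ x, x ∉ C → ν x = x := by
    intro x hx
    have h1 := h.fix x (fun h' => hx (Finset.mem_erase.1 h').2)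
    have hxu : x ≠ u := fun h' => hx (h' ▸ hu)
    by_cases h2 : ν x = u
    · exfalso
      have : x = S⁻¹ u := ν.injective (h2.trans hνu.symm)
      rw [this] at hx
      exact hx ((mem_of_fix (fix_inv hA.fix)).2 hu)
    · rwa [pdel_of_ne h2 hxu] at h1
  refine ⟨hψu, ?_, hfix, ?_, ?_, ?_⟩
  · intro x hx
    rcases Finset.mem_insert.1 hx with rfl | hx
    · exact hu
    · exact (Finset.mem_erase.1 (h.DC hx)).2
  · have := h.trν
    rw [show C.erase u \ D = C \ insert u D by
      ext x; simp only [Finset.mem_sdiff, Finset.mem_erase, Finset.mem_insert]; tauto] at this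
    exact Tr.undel hνu' ((mem_of_fix hfix).2 hu) this
  · have := h.trψ
    rw [e1] at this
    exact Tr.insert_fix hu hψu this
  · intro v hv hov x hx hvx
    rcases Finset.mem_insert.1 hv with rfl | hv
    · rw [sc_fix hψu hvx]; exact hov
    · have hvu : v ≠ u := fun h' => huD (h' ▸ hv)
      have hxu : x ≠ u := by rintro rfl; exact hvu (sc_fix hψu hvx.symm)
      refine h.star v hv hov x (Finset.mem_erase.2 ⟨hxu, hx⟩) (by rwa [e1])

end Core

end

section
open Equiv Equiv.Perm
set_option linter.unusedSectionVars false
set_option linter.unusedVariables false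
section Core2
variable {α : Type*} [DecidableEq α]

theorem papply_inv (f : Perm α) (x : α) : f (f⁻¹ x) = x := f.apply_symm_apply x
theorem pinv_apply (f : Perm α) (x : α) : f⁻¹ (f x) = x := f.symm_apply_apply x

structure Wt (C D : Finset α) (o : α → Bool) (S : Perm α) (w : α → ℕ) (δ : ℕ) (l : α → ZMod δ) :
    Prop where
  DC : D ⊆ C
  pos : ∀ u ∈ D, 1 ≤ w u
  dpos : 1 ≤ δ
  outer : (C.filter fun x => o x = true).card = δ + ∑ u ∈ D.filter (fun x => o x = true), w u
  inner : (C.filter fun x => o x = false).card + δ = ∑ u ∈ D.filter (fun x => o x = false), w u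
  lam : ∀ x ∈ C, l (S x) = l x + (if S x ∈ D then 1 - (w (S x) : ZMod δ) else 1)

theorem card_filter_erase {C : Finset α} {a : α} (ha : a ∈ C) (o : α → Bool) (b : Bool) :
    (C.filter fun x => o x = b).card =
      ((C.erase a).filter fun x => o x = b).card + if o a = b then 1 else 0 := by
  rw [Finset.filter_erase]
  split_ifs with h
  · rw [Finset.card_erase_add_one]; simp [ha, h]
  · rw [Finset.erase_eq_of_notMem (by simp [h])]; simp

theorem sum_filter_update {D : Finset α} {u : α} (hu : u ∈ D) (o : α → Bool) (b : Bool)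
    (w : α → ℕ) (h1 : 1 ≤ w u) :
    ∑ v ∈ D.filter (fun x => o x = b), w v =
      (∑ v ∈ D.filter (fun x => o x = b), Function.update w u (w u - 1) v) +
        if o u = b then 1 else 0 := by
  split_ifs with h
  · have hm : u ∈ D.filter (fun x => o x = b) := by simp [hu, h]
    rw [← Finset.add_sum_erase _ _ hm, ← Finset.add_sum_erase _ _ hm]
    rw [Finset.sum_congr rfl (g := fun x => Function.update w u (w u - 1) x)]
    · simp; omega
    · intro x hx; rw [Function.update_of_ne (Finset.mem_erase.1 hx).1]
  · rw [add_zero]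
    refine Finset.sum_congr rfl fun x hx => ?_
    rw [Function.update_of_ne]; rintro rfl; simp [h] at hx

theorem Wt.redA {C D : Finset α} {o : α → Bool} {S : Perm α} {w : α → ℕ} {δ : ℕ} {l : α → ZMod δ}
    (hA : Ann C o S) (h : Wt C D o S w δ l) {u : α} (hu : u ∈ D) (hw : 2 ≤ w u) (ha : S⁻¹ u ∉ D) :
    Wt (C.erase (S⁻¹ u)) D o (pdel (S⁻¹ u) S) (Function.update w u (w u - 1)) δ l := by
  have huC := h.DC hu
  have haC : S⁻¹ u ∈ C := (mem_of_fix (fix_inv hA.fix)).2 huC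
  have hou := hA.inv' u
  have hSa := papply_inv S u
  refine ⟨fun x hx => Finset.mem_erase.2 ⟨fun h' => ha (h' ▸ hx), h.DC hx⟩, ?_, h.dpos, ?_, ?_, ?_⟩
  · intro v hv
    by_cases hvu : v = u
    · subst hvu; simp; omega
    · rw [Function.update_of_ne hvu]; exact h.pos v hv
  · have := h.outer
    rw [card_filter_erase haC, sum_filter_update hu _ _ _ (by omega), hou] at this
    omega
  · have := h.inner
    rw [card_filter_erase haC, sum_filter_update hu _ _ _ (by omega), hou] at this
    omega
  · intro x hx
    rw [Finset.mem_erase] at hx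
    by_cases hxa : S x = S⁻¹ u
    · rw [pdel_of_eq hxa, hSa]
      have h1 := h.lam x hx.2
      have h2 := h.lam _ haC
      rw [hxa, if_neg ha] at h1
      rw [hSa, if_pos hu, h1] at h2
      rw [h2, if_pos hu, Function.update_self, Nat.cast_sub (by omega)]
      push_cast; ring
    · rw [pdel_of_ne hxa hx.1, h.lam x hx.2, Function.update_of_ne]
      intro h'
      exact hx.1 (by rw [← h', pinv_apply])

theorem Wt.redB {C D : Finset α} {o : α → Bool} {S : Perm α} {w : α → ℕ} {δ : ℕ} {l : α → ZMod δ}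
    (hA : Ann C o S) (h : Wt C D o S w δ l) {u : α} (hu : u ∈ D) (hw : w u = 1) :
    S u ≠ u ∧ Wt (C.erase u) (D.erase u) o (pdel u S) w δ l := by
  have huC := h.DC hu
  have hs : ∀ b, ∑ v ∈ D.filter (fun x => o x = b), w v =
      (∑ v ∈ (D.erase u).filter (fun x => o x = b), w v) + if o u = b then 1 else 0 := by
    intro b
    rw [Finset.filter_erase]
    split_ifs with hb
    · rw [← Finset.sum_erase_add _ w (show u ∈ D.filter (fun x => o x = b) by simp [hu, hb]), hw]
    · rw [Finset.erase_eq_of_notMem (by simp [hb])]; simp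
  have houter := h.outer
  have hinner := h.inner
  have hd := h.dpos
  rw [card_filter_erase huC, hs] at houter hinner
  refine ⟨fun hSu => ?_, Finset.erase_subset_erase _ h.DC,
    fun v hv => h.pos v (Finset.mem_erase.1 hv).2, h.dpos, by omega, by omega, ?_⟩
  · have hz : ∀ b, o u = b → (C.erase u).filter (fun x => o x = b) = ∅ := by
      intro b hb
      ext x
      simp only [Finset.mem_filter, Finset.mem_erase, Finset.notMem_empty, iff_false]
      rintro ⟨⟨h1, h2⟩, h3⟩
      exact h1 (sc_fix hSu (hA.tr u huC x h2 (by rw [hb, h3])))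
    have hz' : ∀ b, o u = b → (D.erase u).filter (fun x => o x = b) = ∅ := by
      intro b hb
      refine Finset.subset_empty.1 ?_
      rw [← hz b hb]
      exact Finset.filter_subset_filter _ (Finset.erase_subset_erase _ h.DC)
    cases hb : o u
    · rw [hz _ hb, hz' _ hb] at hinner; simp at hinner; omega
    · rw [hz _ hb, hz' _ hb] at houter; simp at houter; omega
  · intro x hx
    rw [Finset.mem_erase] at hx
    by_cases hxa : S x = u
    · rw [pdel_of_eq hxa]
      have hne : S u ≠ u := fun h' => hx.1 (S.injective (hxa.trans h'.symm))
      have h1 := h.lam x hx.2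
      have h2 := h.lam _ huC
      rw [hxa, if_pos hu, hw] at h1
      rw [h2, h1]
      simp [hne]
    · rw [pdel_of_ne hxa hx.1, h.lam x hx.2]
      simp [hxa]

theorem closed_of_inv {D : Finset α} {S : Perm α} (h : ∀ u ∈ D, S⁻¹ u ∈ D) {x y : α}
    (hx : x ∈ D) (hxy : S.SameCycle x y) : y ∈ D := by
  have h1 : D.map (S⁻¹ : Perm α).toEmbedding = D := by
    refine Finset.eq_of_subset_of_card_le ?_ (by simp)
    intro z hz
    obtain ⟨y, hy, rfl⟩ := Finset.mem_map.1 hz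
    exact h y hy
  refine (sc_inv (f := S) (P := fun z => z ∈ D) (fun z => ⟨fun hz => ?_, fun hz => ?_⟩) hxy).1 hx
  · have := h _ hz; rwa [pinv_apply] at this
  · rw [← h1] at hz
    obtain ⟨y, hy, hyz⟩ := Finset.mem_map.1 hz
    have : y = S z := by rw [← hyz]; exact (papply_inv S y).symm
    rwa [← this]

theorem Wt.term {C D : Finset α} {o : α → Bool} {S : Perm α} {w : α → ℕ} {δ : ℕ} {l : α → ZMod δ}
    (hA : Ann C o S) (h : Wt C D o S w δ l) (ht : ∀ u ∈ D, 2 ≤ w u ∧ S⁻¹ u ∈ D) :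
    (∀ x ∈ C, x ∈ D ↔ o x = false) ∧ (C.filter fun x => o x = true).card = δ ∧
      (∃ u ∈ D, o u = false) := by
  have hcl : ∀ x ∈ D, ∀ y ∈ C, o x = o y → y ∈ D := fun x hx y hy hxy =>
    closed_of_inv (fun u hu => (ht u hu).2) hx (hA.tr x (h.DC hx) y hy hxy)
  have h1 : ∀ u ∈ D, o u ≠ true := by
    intro u hu hou
    have hsub : C.filter (fun x => o x = true) ⊆ D.filter (fun x => o x = true) := by
      intro x hx
      rw [Finset.mem_filter] at hx ⊢
      exact ⟨hcl u hu x hx.1 (by rw [hou, hx.2]), hx.2⟩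
    have h2 := Finset.card_le_card hsub
    have h3 : (D.filter (fun x => o x = true)).card ≤ ∑ u ∈ D.filter (fun x => o x = true), w u := by
      rw [Finset.card_eq_sum_ones]
      exact Finset.sum_le_sum fun v hv => h.pos v (Finset.mem_filter.1 hv).1
    have := h.outer; have := h.dpos; omega
  have h4 : ∃ u ∈ D, o u = false := by
    by_contra hne
    push Not at hne
    have : D.filter (fun x => o x = false) = ∅ := by
      ext x; simp only [Finset.mem_filter, Finset.notMem_empty, iff_false]
      rintro ⟨h1, h2⟩; exact hne x h1 h2
    have h2 := h.inner
    rw [this] at h2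
    have := h.dpos
    simp at h2; omega
  obtain ⟨u, hu, hou⟩ := h4
  refine ⟨fun x hx => ⟨fun hxD => ?_, fun hox => hcl u hu x hx (by rw [hou, hox])⟩, ?_, u, hu, hou⟩
  · have := h1 x hxD; simpa using this
  · have h2 := h.outer
    rw [h2, Finset.filter_eq_empty_iff.2 (fun x hx => h1 x hx)]; simp

/-- outer level is bijective at the terminal stage -/
theorem lev_bij {C : Finset α} {o : α → Bool} {S : Perm α} {δ : ℕ} {l : α → ZMod δ}
    (hA : Ann C o S) (hd : 1 ≤ δ) (hcard : (C.filter fun x => o x = true).card = δ)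
    (hl : ∀ x ∈ C, o x = true → l (S x) = l x + 1) :
    (∀ z, ∃ x ∈ C, o x = true ∧ l x = z) ∧
    (∀ x ∈ C, ∀ y ∈ C, o x = true → o y = true → l x = l y → x = y) := by
  have : NeZero δ := ⟨by omega⟩
  have hne : (C.filter fun x => o x = true).Nonempty := Finset.card_pos.1 (by omega)
  obtain ⟨x0, hx0⟩ := hne
  rw [Finset.mem_filter] at hx0
  have hk : ∀ k : ℕ, ∃ x ∈ C, o x = true ∧ l x = l x0 + k := by
    intro k
    induction k with
    | zero => exact ⟨x0, hx0.1, hx0.2, by simp⟩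
    | succ k ih =>
      obtain ⟨x, hx, hox, hlx⟩ := ih
      exact ⟨S x, (mem_of_fix hA.fix).2 hx, by rw [hA.inv, hox], by rw [hl x hx hox, hlx]; push_cast; ring⟩
  have hs : ∀ z, ∃ x ∈ C, o x = true ∧ l x = z := by
    intro z
    obtain ⟨x, hx, hox, hlx⟩ := hk (z - l x0).val
    exact ⟨x, hx, hox, by rw [hlx]; simp⟩
  refine ⟨hs, ?_⟩
  have him : (C.filter fun x => o x = true).image l = Finset.univ := by
    ext z; simp only [Finset.mem_image, Finset.mem_filter, Finset.mem_univ, iff_true]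
    obtain ⟨x, h1, h2, h3⟩ := hs z
    exact ⟨x, ⟨h1, h2⟩, h3⟩
  have hinj : Set.InjOn l (C.filter fun x => o x = true) := by
    rw [← Finset.card_image_iff, him, Finset.card_univ, ZMod.card, hcard]
  intro x hx y hy hox hoy hxy
  exact hinj (by simp [hx, hox]) (by simp [hy, hoy]) hxy

theorem Good.fixA {C D : Finset α} {o : α → Bool} {S ν : Perm α} (hA : Ann C o S)
    (h : Good C D o S ν) {u : α} (hu : u ∈ D) (hψ : (S * ν⁻¹) u ≠ u) (ha : S⁻¹ u ∉ D) :
    ν (S⁻¹ u) = S⁻¹ u := by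
  have haC : S⁻¹ u ∈ C := (mem_of_fix (fix_inv hA.fix)).2 (h.DC hu)
  have hνC : ν (S⁻¹ u) ∈ C := (mem_of_fix h.fix).2 haC
  have e : (S * ν⁻¹) (ν (S⁻¹ u)) = u := by rw [Perm.mul_apply, pinv_apply, papply_inv]
  have hnD : ν (S⁻¹ u) ∉ D := by
    intro hD
    have := h.trψ.eq hD hu ((sc_step _ _).trans (by rw [e]))
    rw [this] at e; exact hψ e
  exact (h.trν.eq (Finset.mem_sdiff.2 ⟨haC, ha⟩) (Finset.mem_sdiff.2 ⟨hνC, hnD⟩) (sc_step _ _)).symm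

theorem inv_pdel {β : Type*} {F : α → β} {f : Perm α} (h : ∀ x, F (f x) = F x) (a x : α) :
    F (pdel a f x) = F x := by
  by_cases hx : x = a
  · subst hx; rw [pdel_self]
  by_cases h2 : f x = a
  · rw [pdel_of_eq h2, h, ← h2, h]
  · rw [pdel_of_ne h2 hx, h]

theorem pdel_recover {f : Perm α} {b u : α} (h : f b = u) : f = pdel u f * swap b u := by
  have : f⁻¹ u = b := by rw [← h, pinv_apply]
  rw [pdel, this, mul_assoc, swap_mul_self, mul_one]

theorem psi_a {S ν : Perm α} {a : α} (h : ν a = a) : (S * ν⁻¹) a = S a := by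
  rw [Perm.mul_apply, Perm.inv_eq_iff_eq.2 h.symm]

theorem szA {C D : Finset α} {o : α → Bool} {S ν : Perm α} (hA : Ann C o S)
    (h : Good C D o S ν) {u : α} (hu : u ∈ D) (ha : S⁻¹ u ∉ D) (hν : ν (S⁻¹ u) = S⁻¹ u) :
    (sz (C.erase (S⁻¹ u)) (pdel (S⁻¹ u) S * ν⁻¹) u + 1 = sz C (S * ν⁻¹) u) ∧
    ∀ v ∈ D, v ≠ u → sz (C.erase (S⁻¹ u)) (pdel (S⁻¹ u) S * ν⁻¹) v = sz C (S * ν⁻¹) v := by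
  have haC : S⁻¹ u ∈ C := (mem_of_fix (fix_inv hA.fix)).2 (h.DC hu)
  have e := psi_a (S := S) hν
  rw [papply_inv] at e
  have hsc : (S * ν⁻¹).SameCycle u (S⁻¹ u) := by
    have := sc_step (S * ν⁻¹) (S⁻¹ u)
    rw [e] at this; exact this.symm
  rw [psi_del hν]
  refine ⟨sz_del_of_sc haC (fun h' => ha (h' ▸ hu)) hsc, fun v hv hvu => ?_⟩
  refine sz_del_of_not_sc (fun h' => ha (h' ▸ hv)) fun h' => hvu ?_
  exact h.trψ.eq hv hu (h'.trans hsc.symm)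

theorem T1u (n : ℕ) : ∀ {C D : Finset α} {o : α → Bool} {S : Perm α} {w : α → ℕ} {δ : ℕ}
    {l : α → ZMod δ} {ν ν' : Perm α}, C.card = n → Ann C o S → Wt C D o S w δ l →
    Good C D o S ν → (∀ u ∈ D, sz C (S * ν⁻¹) u = w u) → (∀ x, l (ν x) = l x) →
    Good C D o S ν' → (∀ u ∈ D, sz C (S * ν'⁻¹) u = w u) → (∀ x, l (ν' x) = l x) → ν = ν' := by
  induction n using Nat.strong_induction_on with
  | _ n ih =>
  intro C D o S w δ l ν ν' hn hA hW hG hz hl hG' hz' hl'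
  by_cases hb : ∃ u ∈ D, w u = 1
  · obtain ⟨u, hu, hw⟩ := hb
    have huC := hW.DC hu
    obtain ⟨hSu, hW'⟩ := hW.redB hA hu hw
    have f1 : ∀ {ν : Perm α}, Good C D o S ν → (∀ u ∈ D, sz C (S * ν⁻¹) u = w u) → (S * ν⁻¹) u = u := by
      intro ν hG hz
      exact fix_of_sz huC ((mem_of_fix (psi_fixes hA.fix hG.fix)).2 huC) ((hz u hu).trans hw)
    obtain ⟨_, e1, G1⟩ := hG.redB hA huC (f1 hG hz)
    obtain ⟨_, e2, G2⟩ := hG'.redB hA huC (f1 hG' hz')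
    have hz2 : ∀ {ν : Perm α}, Good C D o S ν → (∀ u ∈ D, sz C (S * ν⁻¹) u = w u) → ν (S⁻¹ u) = u →
        ∀ v ∈ D.erase u, sz (C.erase u) (pdel u S * (pdel u ν)⁻¹) v = w v := by
      intro ν hG hz e v hv
      rw [psi_delB e, sz_erase_fix (Finset.mem_erase.1 hv).1 (f1 hG hz), hz v (Finset.mem_erase.1 hv).2]
    have := ih _ (by rw [← hn]; exact Finset.card_erase_lt_of_mem huC) rfl (hA.del u) hW' G1
      (hz2 hG hz e1) (inv_pdel hl u) G2 (hz2 hG' hz' e2) (inv_pdel hl' u)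
    rw [pdel_recover e1, pdel_recover e2, this]
  have hw2 : ∀ u ∈ D, 2 ≤ w u := fun u hu => by
    have := hW.pos u hu
    have : w u ≠ 1 := fun h => hb ⟨u, hu, h⟩
    omega
  have hψ : ∀ {ν : Perm α}, (∀ u ∈ D, sz C (S * ν⁻¹) u = w u) → ∀ u ∈ D, (S * ν⁻¹) u ≠ u := by
    intro ν hz u hu h
    have := sz_fix (hW.DC hu) h
    rw [hz u hu] at this
    have := hw2 u hu; omega
  by_cases ha : ∃ u ∈ D, S⁻¹ u ∉ D
  · obtain ⟨u, hu, ha⟩ := ha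
    have haC : S⁻¹ u ∈ C := (mem_of_fix (fix_inv hA.fix)).2 (hW.DC hu)
    have hSa : S (S⁻¹ u) ≠ S⁻¹ u := by
      rw [papply_inv]; intro h; rw [← h] at ha; exact ha hu
    have hz2 : ∀ {ν : Perm α}, Good C D o S ν → (∀ u ∈ D, sz C (S * ν⁻¹) u = w u) → ν (S⁻¹ u) = S⁻¹ u →
        ∀ v ∈ D, sz (C.erase (S⁻¹ u)) (pdel (S⁻¹ u) S * ν⁻¹) v = Function.update w u (w u - 1) v := by
      intro ν hG hz e v hv
      have h3 := szA hA hG hu ha e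
      by_cases hvu : v = u
      · subst hvu; rw [Function.update_self, ← hz v hu, ← h3.1]; simp
      · rw [Function.update_of_ne hvu, h3.2 v hv hvu, hz v hv]
    have e1 := hG.fixA hA hu (hψ hz u hu) ha
    have e2 := hG'.fixA hA hu (hψ hz' u hu) ha
    exact ih _ (by rw [← hn]; exact Finset.card_erase_lt_of_mem haC) rfl (hA.del _)
      (hW.redA hA hu (hw2 u hu) ha) (hG.redA hA haC e1 hSa).2 (hz2 hG hz e1) hl
      (hG'.redA hA haC e2 hSa).2 (hz2 hG' hz' e2) hl'
  push Not at ha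
  obtain ⟨hD, hcard, _⟩ := hW.term hA (fun u hu => ⟨hw2 u hu, ha u hu⟩)
  have hlev := lev_bij hA hW.dpos hcard (l := l) (fun x hx hox => by
    rw [hW.lam x hx, if_neg]
    rw [hD _ ((mem_of_fix hA.fix).2 hx), hA.inv, hox]; simp)
  have in1 : ∀ {ν : Perm α}, Good C D o S ν → (∀ u ∈ D, sz C (S * ν⁻¹) u = w u) →
      ∀ x ∈ C, o x = false → o (ν x) = true := by
    intro ν hG hz x hx hox
    by_contra hy
    have hνC : ν x ∈ C := (mem_of_fix hG.fix).2 hx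
    have hyD : ν x ∈ D := by rw [hD _ hνC]; simpa using hy
    have hSx : S x ∈ C := (mem_of_fix hA.fix).2 hx
    have hSD : S x ∈ D := by rw [hD _ hSx, hA.inv, hox]
    have e : (S * ν⁻¹) (ν x) = S x := by rw [Perm.mul_apply, pinv_apply]
    have := hG.trψ.eq hyD hSD ((sc_step _ _).trans (by rw [e]))
    rw [this] at e
    exact hψ hz _ hSD e
  have out1 : ∀ {ν : Perm α}, Good C D o S ν → (∀ u ∈ D, sz C (S * ν⁻¹) u = w u) →
      ∀ x ∈ C, o x = true → ν x = x ∨ (o (ν x) = false ∧ ν (ν x) = x) := by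
    intro ν hG hz x hx hox
    have hνC : ν x ∈ C := (mem_of_fix hG.fix).2 hx
    have hννC : ν (ν x) ∈ C := (mem_of_fix hG.fix).2 hνC
    have hxD : x ∈ C \ D := by rw [Finset.mem_sdiff, hD _ hx, hox]; simp [hx]
    cases hy : o (ν x)
    · right
      refine ⟨rfl, ?_⟩
      have h1 := in1 hG hz _ hνC hy
      have : ν (ν x) ∈ C \ D := by rw [Finset.mem_sdiff, hD _ hννC, h1]; simp [hννC]
      exact (hG.trν.eq hxD this ((sc_step _ _).trans (sc_step _ _))).symm
    · left
      have : ν x ∈ C \ D := by rw [Finset.mem_sdiff, hD _ hνC, hy]; simp [hνC]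
      exact (hG.trν.eq hxD this (sc_step _ _)).symm
  have inn : ∀ x ∈ C, o x = false → ν x = ν' x := by
    intro x hx hox
    refine hlev.2 _ ((mem_of_fix hG.fix).2 hx) _ ((mem_of_fix hG'.fix).2 hx) (in1 hG hz x hx hox)
      (in1 hG' hz' x hx hox) (by rw [hl, hl'])
  ext x
  by_cases hx : x ∈ C
  · cases hox : o x
    · exact inn x hx hox
    · have hνC : ν x ∈ C := (mem_of_fix hG.fix).2 hx
      have hνC' : ν' x ∈ C := (mem_of_fix hG'.fix).2 hx
      rcases out1 hG hz x hx hox with h1 | ⟨h1, h2⟩ <;> rcases out1 hG' hz' x hx hox with h3 | ⟨h3, h4⟩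
      · rw [h1, h3]
      · exfalso
        have h5 := inn _ hνC' h3
        rw [h4] at h5
        have := ν.injective (h5.trans h1.symm)
        rw [this, hox] at h3; simp at h3
      · exfalso
        have h5 := inn _ hνC h1
        rw [h2] at h5
        have := ν'.injective (h5.symm.trans h3.symm)
        rw [this, hox] at h1; simp at h1
      · have h5 := inn _ hνC h1
        rw [h2] at h5
        exact ν'.injective (h5.symm.trans h4.symm)
  · rw [hG.fix x hx, hG'.fix x hx]

end Core2

end

section
open Equiv Equiv.Perm
set_option linter.unusedSectionVars false
set_option linter.unusedVariables false
section Core3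
variable {α : Type*} [DecidableEq α]

theorem sc_invol {f : Perm α} (hf : ∀ x, f (f x) = x) {x y : α} (h : f.SameCycle x y) :
    y = x ∨ y = f x := by
  have := sc_inv (f := f) (P := fun z => z = x ∨ z = f x) (fun z => ?_) h
  · exact this.1 (Or.inl rfl)
  · constructor
    · rintro (h | h)
      · right; rw [← h, hf]
      · left; exact f.injective h
    · rintro (h | h)
      · right; rw [h]
      · left; rw [h, hf]

theorem sc_period {f : Perm α} {u : α} {k : ℕ} (hk : 1 ≤ k) (h : (f ^ k) u = u) {y : α}
    (hy : f.SameCycle u y) : ∃ j < k, (f ^ j) u = y := by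
  refine (sc_inv (f := f⁻¹) (P := fun z => ∃ j < k, (f ^ j) u = z) (fun z => ?_)
    (sameCycle_inv.2 hy)).1 ⟨0, by omega, rfl⟩
  constructor
  · rintro ⟨j, hj, h1⟩
    have h1 : (f ^ (j + 1)) u = z := by rw [add_comm, pow_add, pow_one, Perm.mul_apply, h1, papply_inv]
    by_cases hjk : j + 1 = k
    · exact ⟨0, by omega, by rw [← h1, hjk, h]; rfl⟩
    · exact ⟨j + 1, by omega, h1⟩
  · rintro ⟨j, hj, h1⟩
    rcases j with _ | j
    · refine ⟨k - 1, by omega, ?_⟩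
      have : (f ^ (k - 1 + 1)) u = u := by rw [Nat.sub_add_cancel hk, h]
      rw [add_comm, pow_add, pow_one, Perm.mul_apply] at this
      simp only [pow_zero, Perm.one_apply] at h1
      rw [← h1]; conv_rhs => rw [← this]
      rw [pinv_apply]
    · refine ⟨j, by omega, ?_⟩
      rw [← h1, add_comm, pow_add, pow_one, Perm.mul_apply, pinv_apply]

theorem T1e_base {C D : Finset α} {o : α → Bool} {S : Perm α} {w : α → ℕ} {δ : ℕ}
    {l : α → ZMod δ} (hA : Ann C o S) (hW : Wt C D o S w δ l) (hw2 : ∀ u ∈ D, 2 ≤ w u)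
    (ha : ∀ u ∈ D, S⁻¹ u ∈ D) :
    ∃ ν : Perm α, Good C D o S ν ∧ (∀ u ∈ D, sz C (S * ν⁻¹) u = w u) ∧ (∀ x, l (ν x) = l x) ∧
      ∃ x, o (ν x) ≠ o x := by
  classical
  obtain ⟨hD, hcard, u0, hu0, hou0⟩ := hW.term hA (fun u hu => ⟨hw2 u hu, ha u hu⟩)
  have hDo : ∀ u ∈ D, o u = false := fun u hu => (hD u (hW.DC hu)).1 hu
  have hlo : ∀ x ∈ C, o x = true → l (S x) = l x + 1 := fun x hx hox => by
    rw [hW.lam x hx, if_neg]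
    rw [hD _ ((mem_of_fix hA.fix).2 hx), hA.inv, hox]; simp
  have hlev := lev_bij hA hW.dpos hcard (l := l) hlo
  obtain ⟨hg, hinj⟩ := hlev
  choose g hgC hgo hgl using hg
  have hNZ : NeZero δ := ⟨by have := hW.dpos; omega⟩
  have hSD : ∀ u ∈ D, S u ∈ D := fun u hu =>
    (hD _ ((mem_of_fix hA.fix).2 (hW.DC hu))).2 (by rw [hA.inv, hDo u hu])
  have hSg : ∀ z, S (g z) = g (z + 1) := fun z =>
    hinj _ ((mem_of_fix hA.fix).2 (hgC z)) _ (hgC _) (by rw [hA.inv, hgo]) (hgo _)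
      (by rw [hlo _ (hgC z) (hgo z), hgl, hgl])
  have hgx : ∀ x ∈ C, o x = true → g (l x) = x := fun x hx hox =>
    hinj _ (hgC _) _ hx (hgo _) hox (hgl _)
  -- beta
  let T := D.sigma (fun u => Finset.range (w u - 1))
  let β : (Σ _ : α, ℕ) → ZMod δ := fun t => l t.1 + 1 + (t.2 : ZMod δ)
  have hTcard : T.card = δ := by
    rw [Finset.card_sigma]
    simp only [Finset.card_range]
    have h1 := hW.inner
    have h2 : D.filter (fun x => o x = false) = D := Finset.filter_true_of_mem hDo
    have h3 : C.filter (fun x => o x = false) = D := by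
      ext x; rw [Finset.mem_filter]
      exact ⟨fun h => (hD x h.1).2 h.2, fun h => ⟨hW.DC h, hDo x h⟩⟩
    rw [h2, h3] at h1
    have h4 : ∑ u ∈ D, (w u - 1) + ∑ u ∈ D, 1 = ∑ u ∈ D, w u := by
      rw [← Finset.sum_add_distrib]
      exact Finset.sum_congr rfl fun u hu => by have := hw2 u hu; omega
    rw [← Finset.card_eq_sum_ones] at h4
    omega
  have hmem : ∀ u j, (⟨u, j⟩ : Σ _ : α, ℕ) ∈ T ↔ u ∈ D ∧ j < w u - 1 := by
    intro u j; simp [T]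
  have hpred : ∀ k : ℕ, ∃ t ∈ T, β t = β ⟨u0, 0⟩ - k := by
    intro k
    induction k with
    | zero => exact ⟨⟨u0, 0⟩, (hmem _ _).2 ⟨hu0, by have := hw2 u0 hu0; omega⟩, by simp⟩
    | succ k ih =>
      obtain ⟨⟨u, j⟩, ht, hβ⟩ := ih
      rw [hmem] at ht
      rcases j with _ | j
      · refine ⟨⟨S u, w (S u) - 2⟩, (hmem _ _).2 ⟨hSD u ht.1, ?_⟩, ?_⟩
        · have := hw2 _ (hSD u ht.1); omega
        · have h1 := hW.lam u (hW.DC ht.1)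
          rw [if_pos (hSD u ht.1)] at h1
          have h2 : β ⟨u, 0⟩ = l u + 1 + ((0:ℕ) : ZMod δ) := rfl
          rw [h2] at hβ
          show l (S u) + 1 + ((w (S u) - 2 : ℕ) : ZMod δ) = _
          rw [Nat.cast_sub (hw2 _ (hSD u ht.1)), h1]
          push_cast at hβ ⊢
          linear_combination hβ
      · refine ⟨⟨u, j⟩, (hmem _ _).2 ⟨ht.1, by omega⟩, ?_⟩
        have h2 : β ⟨u, j+1⟩ = l u + 1 + ((j+1:ℕ) : ZMod δ) := rfl
        rw [h2] at hβ
        show l u + 1 + (j : ZMod δ) = _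
        push_cast at hβ ⊢
        linear_combination hβ
  have hsurj : ∀ z, ∃ t ∈ T, β t = z := by
    intro z
    obtain ⟨t, ht, h⟩ := hpred (β ⟨u0, 0⟩ - z).val
    exact ⟨t, ht, by rw [h]; simp⟩
  have hβinj : Set.InjOn β T := by
    have him : T.image β = Finset.univ := by
      ext z; simp only [Finset.mem_image, Finset.mem_univ, iff_true]; exact hsurj z
    rw [← Finset.card_image_iff, him, Finset.card_univ, ZMod.card, hTcard]
  have hβinj' : ∀ u ∈ D, ∀ j < w u - 1, ∀ u' ∈ D, ∀ j' < w u' - 1,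
      l u + (j : ZMod δ) = l u' + (j' : ZMod δ) → u = u' ∧ j = j' := by
    intro u hu j hj u' hu' j' hj' h
    have := hβinj (x₁ := ⟨u, j⟩) (x₂ := ⟨u', j'⟩) ((hmem _ _).2 ⟨hu, hj⟩) ((hmem _ _).2 ⟨hu', hj'⟩)
      (by show l u + 1 + (j : ZMod δ) = l u' + 1 + (j' : ZMod δ); linear_combination h)
    simpa using this
  have hlD : ∀ u ∈ D, ∀ u' ∈ D, l u = l u' → u = u' := fun u hu u' hu' h =>
    (hβinj' u hu 0 (by have := hw2 u hu; omega) u' hu' 0 (by have := hw2 u' hu'; omega) (by simpa using h)).1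
  -- the involution
  let hh : ZMod δ → α := fun z => if h : ∃ u ∈ D, l u = z then h.choose else g z
  have hh1 : ∀ u ∈ D, hh (l u) = u := by
    intro u hu
    have h : ∃ u' ∈ D, l u' = l u := ⟨u, hu, rfl⟩
    have : hh (l u) = h.choose := dif_pos h
    rw [this]
    exact hlD _ h.choose_spec.1 _ hu h.choose_spec.2
  have hh2 : ∀ z, (¬ ∃ u ∈ D, l u = z) → hh z = g z := fun z h => dif_neg h
  let F : α → α := fun x => if x ∈ D then g (l x) else if x ∈ C then hh (l x) else x
  have F1 : ∀ x ∈ D, F x = g (l x) := fun x hx => if_pos hx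
  have F2 : ∀ x ∈ C, x ∉ D → F x = hh (l x) := fun x hx hxD => by simp [F, hx, hxD]
  have F3 : ∀ x, x ∉ C → F x = x := fun x hx => by
    have : x ∉ D := fun h => hx (hW.DC h)
    simp [F, hx, this]
  have hgD : ∀ z, g z ∉ D := fun z h => by have := hDo _ h; rw [hgo] at this; simp at this
  have hox : ∀ x ∈ C, x ∉ D → o x = true := fun x hx hxD => by
    rw [hD x hx] at hxD; simpa using hxD
  have Finv : Function.Involutive F := by
    intro x
    by_cases hx : x ∈ C
    · by_cases hxD : x ∈ D
      · rw [F1 x hxD, F2 _ (hgC _) (hgD _), hgl, hh1 x hxD]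
      · rw [F2 x hx hxD]
        by_cases he : ∃ u ∈ D, l u = l x
        · obtain ⟨u, hu, hux⟩ := he
          rw [← hux, hh1 u hu, F1 u hu, hux, hgx x hx (hox x hx hxD)]
        · rw [hh2 _ he, hgx x hx (hox x hx hxD), F2 x hx hxD, hh2 _ he, hgx x hx (hox x hx hxD)]
    · rw [F3 x hx, F3 x hx]
  let ν : Perm α := Finv.toPerm F
  have hν : ∀ x, ν x = F x := fun x => rfl
  have hνν : ∀ x, ν (ν x) = x := Finv
  have hνi : ν⁻¹ = ν := by ext x; rw [Perm.inv_eq_iff_eq, hνν]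
  have hψg1 : ∀ u ∈ D, (S * ν⁻¹) (g (l u)) = S u := by
    intro u hu; rw [hνi, Perm.mul_apply, hν, F2 _ (hgC _) (hgD _), hgl, hh1 u hu]
  have hψg2 : ∀ z, (¬ ∃ u ∈ D, l u = z) → (S * ν⁻¹) (g z) = g (z + 1) := by
    intro z hz; rw [hνi, Perm.mul_apply, hν, F2 _ (hgC _) (hgD _), hgl, hh2 z hz, hSg]
  have hψu : ∀ u ∈ D, (S * ν⁻¹) u = g (l u + 1) := by
    intro u hu; rw [hνi, Perm.mul_apply, hν, F1 u hu, hSg]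
  have hpow : ∀ u ∈ D, ∀ j, j < w u - 1 → ((S * ν⁻¹) ^ (j + 1)) u = g (l u + (j + 1 : ℕ)) := by
    intro u hu j
    induction j with
    | zero => intro _; rw [zero_add, pow_one, hψu u hu]; simp
    | succ j ih =>
      intro hj
      rw [add_comm (j+1) 1, pow_add, pow_one, Perm.mul_apply, ih (by omega), hψg2]
      · congr 1; push_cast; ring
      · rintro ⟨u', hu', h⟩
        have := hβinj' u hu (j+1) hj u' hu' 0 (by have := hw2 u' hu'; omega) (by rw [h]; simp)
        omega
  have hpw : ∀ u ∈ D, ((S * ν⁻¹) ^ (w u)) u = u := by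
    intro u hu
    have h2 := hw2 u hu
    have h1 : w u = 1 + (w u - 2 + 1) := by omega
    have h3 : l u + ((w u - 2 + 1 : ℕ) : ZMod δ) = l (S⁻¹ u) := by
      have := hW.lam _ (hW.DC (ha u hu))
      rw [papply_inv, if_pos hu] at this
      rw [this, show w u - 2 + 1 = w u - 1 by omega, Nat.cast_sub (by omega)]; push_cast; ring
    rw [h1, pow_add, pow_one, Perm.mul_apply, hpow u hu _ (by omega), h3, hψg1 _ (ha u hu), papply_inv]
  refine ⟨ν, ⟨hW.DC, fun x hx => F3 x hx, ?_, ?_, ?_⟩, ?_, ?_, ?_⟩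
  · refine ⟨Finset.sdiff_subset, fun x hx => ?_⟩
    have huniq : ∀ x ∈ C, x ∉ D → ∀ y ∈ C, y ∉ D → ν.SameCycle x y → y = x := by
      intro x hx hxD y hy hyD h
      rcases sc_invol hνν h with h | h
      · exact h
      · rw [hν, F2 x hx hxD] at h
        by_cases he : ∃ u ∈ D, l u = l x
        · obtain ⟨u, hu, hux⟩ := he
          rw [← hux, hh1 u hu] at h
          exact absurd (h ▸ hu) hyD
        · rw [h, hh2 _ he, hgx x hx (hox x hx hxD)]
    by_cases hxD : x ∈ D
    · refine ⟨ν x, ⟨?_, sc_step _ _⟩, fun y hy => ?_⟩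
      · rw [hν, F1 x hxD, Finset.mem_sdiff]; exact ⟨hgC _, hgD _⟩
      · have hy : y ∈ C \ D ∧ ν.SameCycle x y := hy; rw [Finset.mem_sdiff] at hy
        refine huniq _ ?_ ?_ y hy.1.1 hy.1.2 ((sc_step ν x).symm.trans hy.2)
        · rw [hν, F1 x hxD]; exact hgC _
        · rw [hν, F1 x hxD]; exact hgD _
    · refine ⟨x, ⟨Finset.mem_sdiff.2 ⟨hx, hxD⟩, SameCycle.refl _ _⟩, fun y hy => ?_⟩
      have hy : y ∈ C \ D ∧ ν.SameCycle x y := hy; rw [Finset.mem_sdiff] at hy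
      exact huniq x hx hxD y hy.1.1 hy.1.2 hy.2
  · refine ⟨hW.DC, fun x hx => ?_⟩
    have huniq : ∀ u ∈ D, ∀ y ∈ D, (S * ν⁻¹).SameCycle u y → y = u := by
      intro u hu y hy h
      obtain ⟨j, hj, h⟩ := sc_period (hW.pos u hu) (hpw u hu) h
      rcases j with _ | j
      · exact h.symm
      · rw [hpow u hu j (by omega)] at h
        exact absurd (h ▸ hy) (hgD _)
    have hex : ∃ u ∈ D, (S * ν⁻¹).SameCycle x u := by
      by_cases hxD : x ∈ D
      · exact ⟨x, hxD, SameCycle.refl _ _⟩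
      · obtain ⟨⟨u, j⟩, ht, h⟩ := hsurj (l x)
        rw [hmem] at ht
        refine ⟨u, ht.1, SameCycle.symm ⟨((j + 1 : ℕ) : ℤ), ?_⟩⟩
        rw [zpow_natCast, hpow u ht.1 j ht.2]
        have : l u + ((j + 1 : ℕ) : ZMod δ) = l x := by
          rw [← h]; show _ = l u + 1 + (j : ZMod δ); push_cast; ring
        rw [this, hgx x hx (hox x hx hxD)]
    obtain ⟨u, hu, hxu⟩ := hex
    exact ⟨u, ⟨hu, hxu⟩, fun y hy => huniq u hu y hy.1 (hxu.symm.trans hy.2)⟩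
  · intro u hu hou
    rw [hDo u hu] at hou; simp at hou
  · intro u hu
    unfold sz
    have : (C.filter fun y => (S * ν⁻¹).SameCycle u y) =
        (Finset.range (w u)).image (fun j => ((S * ν⁻¹) ^ j) u) := by
      ext y
      simp only [Finset.mem_filter, Finset.mem_image, Finset.mem_range]
      constructor
      · rintro ⟨_, h⟩; exact sc_period (hW.pos u hu) (hpw u hu) h
      · rintro ⟨j, hj, rfl⟩
        refine ⟨?_, ⟨j, by simp⟩⟩
        rcases j with _ | j
        · exact hW.DC hu
        · rw [hpow u hu j (by omega)]; exact hgC _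
    rw [this, Finset.card_image_iff.2, Finset.card_range]
    intro j hj j' hj' h
    simp only [Finset.coe_range, Set.mem_Iio] at hj hj'
    simp only at h
    rcases j with _ | j <;> rcases j' with _ | j'
    · rfl
    · exfalso
      rw [hpow u hu j' (by omega)] at h
      simp only [pow_zero, Perm.one_apply] at h
      exact hgD _ (h ▸ hu)
    · exfalso
      rw [hpow u hu j (by omega)] at h
      simp only [pow_zero, Perm.one_apply] at h
      exact hgD _ (h ▸ hu)
    · rw [hpow u hu j (by omega), hpow u hu j' (by omega)] at h
      have h' := congrArg l h
      rw [hgl, hgl] at h'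
      have := hβinj' u hu j (by omega) u hu j' (by omega) (by push_cast at h'; linear_combination h')
      rw [this.2]
  · intro x
    rw [hν]
    by_cases hx : x ∈ C
    · by_cases hxD : x ∈ D
      · rw [F1 x hxD, hgl]
      · rw [F2 x hx hxD]
        by_cases he : ∃ u ∈ D, l u = l x
        · obtain ⟨u, hu, hux⟩ := he
          rw [← hux, hh1 u hu]
        · rw [hh2 _ he, hgl]
    · rw [F3 x hx]
  · exact ⟨u0, by rw [hν, F1 u0 hu0, hgo, hou0]; simp⟩

theorem T1e (n : ℕ) : ∀ {C D : Finset α} {o : α → Bool} {S : Perm α} {w : α → ℕ} {δ : ℕ}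
    {l : α → ZMod δ}, C.card = n → Ann C o S → Wt C D o S w δ l →
    ∃ ν : Perm α, Good C D o S ν ∧ (∀ u ∈ D, sz C (S * ν⁻¹) u = w u) ∧ (∀ x, l (ν x) = l x) ∧
      ∃ x, o (ν x) ≠ o x := by
  induction n using Nat.strong_induction_on with
  | _ n ih =>
  intro C D o S w δ l hn hA hW
  by_cases hb : ∃ u ∈ D, w u = 1
  · obtain ⟨u, hu, hw⟩ := hb
    have huC := hW.DC hu
    obtain ⟨hSu, hW'⟩ := hW.redB hA hu hw
    obtain ⟨ν', hG, hz, hl, x, hx⟩ := ih _ (by rw [← hn]; exact Finset.card_erase_lt_of_mem huC) rfl (hA.del u) hW'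
    have hfu : ν' u = u := hG.fix u (by simp)
    have hSu' : S⁻¹ u ≠ u := fun h' => hSu (by rw [Perm.inv_eq_iff_eq] at h'; exact h'.symm)
    have hνu : (ν' * swap (S⁻¹ u) u) (S⁻¹ u) = u := by
      rw [Perm.mul_apply, swap_apply_left, hfu]
    have hνu2 : (ν' * swap (S⁻¹ u) u) u = ν' (S⁻¹ u) := by
      rw [Perm.mul_apply, swap_apply_right]
    have hpd : pdel u (ν' * swap (S⁻¹ u) u) = ν' := by
      have := pdel_recover hνu
      exact (mul_right_cancel this).symm
    have hνx : ∀ x, x ≠ u → x ≠ S⁻¹ u → (ν' * swap (S⁻¹ u) u) x = ν' x := by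
      intro x h1 h2; rw [Perm.mul_apply, swap_apply_of_ne_of_ne h2 h1]
    have hlu : l u = l (S⁻¹ u) := by
      have := hW.lam (S⁻¹ u) ((mem_of_fix (fix_inv hA.fix)).2 huC)
      rw [papply_inv, if_pos hu, hw] at this
      simpa using this
    generalize hν : ν' * swap (S⁻¹ u) u = ν at *
    have hG2 := Good.insB hA huC hSu (ν := ν) (D := D.erase u) (by rw [hpd]; exact hG) hνu
    rw [Finset.insert_erase hu] at hG2
    refine ⟨ν, hG2.2, ?_, ?_, ?_⟩
    · intro v hv
      by_cases hvu : v = u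
      · subst hvu; rw [sz_fix huC hG2.1, hw]
      · rw [← hz v (Finset.mem_erase.2 ⟨hvu, hv⟩), ← sz_erase_fix hvu hG2.1, ← psi_delB hνu, hpd]
    · intro x
      by_cases h1 : x = u
      · rw [h1, hνu2, hl, hlu]
      · by_cases h2 : x = S⁻¹ u
        · rw [h2, hνu, hlu]
        · rw [hνx x h1 h2, hl]
    · by_cases h1 : x = u
      · rw [h1, hfu] at hx; exact absurd rfl hx
      · by_cases h2 : x = S⁻¹ u
        · refine ⟨u, ?_⟩
          rw [hνu2, ← h2, ← hA.inv' u, ← h2]; exact hx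
        · exact ⟨x, by rw [hνx x h1 h2]; exact hx⟩
  have hw2 : ∀ u ∈ D, 2 ≤ w u := fun u hu => by
    have := hW.pos u hu
    have : w u ≠ 1 := fun h => hb ⟨u, hu, h⟩
    omega
  by_cases ha : ∃ u ∈ D, S⁻¹ u ∉ D
  · obtain ⟨u, hu, ha⟩ := ha
    have haC : S⁻¹ u ∈ C := (mem_of_fix (fix_inv hA.fix)).2 (hW.DC hu)
    have hSa : S (S⁻¹ u) ≠ S⁻¹ u := by
      rw [papply_inv]; intro h; rw [← h] at ha; exact ha hu
    obtain ⟨ν, hG, hz, hl, hx⟩ := ih _ (by rw [← hn]; exact Finset.card_erase_lt_of_mem haC) rfl (hA.del _)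
      (hW.redA hA hu (hw2 u hu) ha)
    obtain ⟨e, hG2⟩ := Good.insA hA haC hSa hG
    refine ⟨ν, hG2, ?_, hl, hx⟩
    intro v hv
    have h3 := szA hA hG2 hu ha e
    have h4 := hz v hv
    by_cases hvu : v = u
    · subst hvu; rw [Function.update_self] at h4; rw [← h3.1, h4]; have := hw2 v hu; omega
    · rw [Function.update_of_ne hvu] at h4; rw [← h3.2 v hv hvu, h4]
  push Not at ha
  exact T1e_base hA hW hw2 ha

end Core3

end

section
open Equiv Equiv.Perm
set_option linter.unusedSectionVars false
set_option linter.unusedVariables false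
section Core4
variable {α : Type*} [DecidableEq α]

theorem SneA {C : Finset α} {o : α → Bool} {S ν : Perm α} (hA : Ann C o S)
    (hf : ∀ x, x ∉ C → ν x = x) (hc : ∃ x, o (ν x) ≠ o x) {a : α} (ha : a ∈ C) (h : ν a = a) :
    S a ≠ a := by
  intro hS
  obtain ⟨x, hx⟩ := hc
  have hxC : x ∈ C := by by_contra h'; rw [hf x h'] at hx; exact hx rfl
  have hνC : ν x ∈ C := (mem_of_fix hf).2 hxC
  by_cases h1 : o x = o a
  · have := sc_fix hS (hA.tr a ha x hxC h1.symm)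
    rw [this, h] at hx; exact hx rfl
  · have h2 : o (ν x) = o a := by
      cases h3 : o (ν x) <;> cases h4 : o x <;> cases h5 : o a <;> simp_all
    have := sc_fix hS (hA.tr a ha _ hνC h2.symm)
    have h6 := ν.injective (this.trans h.symm)
    exact h1 (by rw [h6])

theorem nu_of_psi {S ν : Perm α} {u : α} (h : (S * ν⁻¹) u = u) : ν (S⁻¹ u) = u := by
  rw [Perm.mul_apply] at h
  conv_lhs => rw [← h]
  rw [pinv_apply, papply_inv]

theorem SneB {C : Finset α} {o : α → Bool} {S ν : Perm α} (hA : Ann C o S)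
    (hf : ∀ x, x ∉ C → ν x = x) (hc : ∃ x, o (ν x) ≠ o x) {u : α} (hu : u ∈ C)
    (h : (S * ν⁻¹) u = u) : S u ≠ u := by
  intro hS
  have h1 := nu_of_psi h
  have h2 : S⁻¹ u = u := by rw [Perm.inv_eq_iff_eq]; exact hS.symm
  rw [h2] at h1
  exact SneA hA hf hc hu h1 hS

theorem connB {C : Finset α} {o : α → Bool} {S ν : Perm α} (hA : Ann C o S)
    (hc : ∃ x, o (ν x) ≠ o x) {u : α} (h : ν (S⁻¹ u) = u) (hS : S u ≠ u) :
    ∃ x, o (pdel u ν x) ≠ o x := by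
  obtain ⟨x, hx⟩ := hc
  by_cases h1 : x = u
  · subst h1
    exact ⟨S⁻¹ x, by rw [pdel_of_eq h, hA.inv']; exact hx⟩
  · by_cases h2 : ν x = u
    · exfalso
      have : x = S⁻¹ u := ν.injective (h2.trans h.symm)
      rw [h2, this, hA.inv'] at hx; exact hx rfl
    · exact ⟨x, by rw [pdel_of_ne h2 h1]; exact hx⟩

theorem Good.term {C D : Finset α} {o : α → Bool} {S ν : Perm α} (hA : Ann C o S)
    (hG : Good C D o S ν) (hc : ∃ x, o (ν x) ≠ o x) (hψ : ∀ u ∈ C, (S * ν⁻¹) u ≠ u)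
    (ha : ∀ u ∈ D, S⁻¹ u ∈ D) : ∀ x ∈ C, x ∈ D ↔ o x = false := by
  have hcl : ∀ x ∈ D, ∀ y ∈ C, o x = o y → y ∈ D := fun x hx y hy hxy =>
    closed_of_inv ha hx (hA.tr x (hG.DC hx) y hy hxy)
  have h1 : ∀ u ∈ D, o u ≠ true := by
    intro u hu hou
    have huC := hG.DC hu
    have hψC : (S * ν⁻¹) u ∈ C := (mem_of_fix (psi_fixes hA.fix hG.fix)).2 huC
    have h2 := hG.star u hu hou _ hψC (sc_step _ _)
    have h3 := hcl u hu _ hψC (by rw [hou, h2])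
    exact hψ u huC (hG.trψ.eq hu h3 (sc_step _ _)).symm
  obtain ⟨x, hx⟩ := hc
  have hxC : x ∈ C := by by_contra h'; rw [hG.fix x h'] at hx; exact hx rfl
  obtain ⟨u, ⟨hu, _⟩, _⟩ := hG.trψ.2 x hxC
  have hou : o u = false := by simpa using h1 u hu
  intro x hx
  exact ⟨fun h => by simpa using h1 x h, fun h => hcl u hu x hx (by rw [hou, h])⟩

theorem T2 (n : ℕ) : ∀ {C D D' : Finset α} {o : α → Bool} {S ν : Perm α}, C.card = n →
    Ann C o S → (∃ x, o (ν x) ≠ o x) → Good C D o S ν → Good C D' o S ν → D = D' := by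
  induction n using Nat.strong_induction_on with
  | _ n ih =>
  intro C D D' o S ν hn hA hc hG hG'
  by_cases hb : ∃ u ∈ C, (S * ν⁻¹) u = u
  · obtain ⟨u, hu, hψ⟩ := hb
    have hS := SneB hA hG.fix hc hu hψ
    obtain ⟨h1, e1, G1⟩ := hG.redB hA hu hψ
    obtain ⟨h2, e2, G2⟩ := hG'.redB hA hu hψ
    have := ih _ (by rw [← hn]; exact Finset.card_erase_lt_of_mem hu) rfl (hA.del u)
      (connB hA hc e1 hS) G1 G2
    rw [← Finset.insert_erase h1, ← Finset.insert_erase h2, this]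
  by_cases ha : ∃ a ∈ C, ν a = a
  · obtain ⟨a, ha, hν⟩ := ha
    have hS := SneA hA hG.fix hc ha hν
    exact ih _ (by rw [← hn]; exact Finset.card_erase_lt_of_mem ha) rfl (hA.del a) hc
      (hG.redA hA ha hν hS).2 (hG'.redA hA ha hν hS).2
  push Not at ha hb
  have hcl : ∀ {D}, Good C D o S ν → ∀ u ∈ D, S⁻¹ u ∈ D := by
    intro D hG u hu
    by_contra h
    exact ha _ ((mem_of_fix (fix_inv hA.fix)).2 (hG.DC hu)) (hG.fixA hA hu (hb u (hG.DC hu)) h)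
  have t1 := hG.term hA hc hb (hcl hG)
  have t2 := hG'.term hA hc hb (hcl hG')
  ext x
  constructor
  · intro h; exact (t2 x (hG.DC h)).2 ((t1 x (hG.DC h)).1 h)
  · intro h; exact (t1 x (hG'.DC h)).2 ((t2 x (hG'.DC h)).1 h)

theorem Tr.avoid {C R : Finset α} {f : Perm α} (hf : ∀ x, x ∉ C → f x = x) (h : Tr C f R) {a : α}
    (ha : f a ≠ a) : ∃ R', Tr C f R' ∧ a ∉ R' ∧ R'.card = R.card := by
  by_cases haR : a ∈ R
  · have haC := h.1 haR
    have hfaC : f a ∈ C := (mem_of_fix hf).2 haC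
    have hfR : f a ∉ R := fun h' => ha (h.eq haR h' (sc_step _ _)).symm
    refine ⟨insert (f a) (R.erase a), ⟨?_, ?_⟩, ?_, ?_⟩
    · intro x hx
      rcases Finset.mem_insert.1 hx with rfl | hx
      · exact hfaC
      · exact h.1 (Finset.mem_erase.1 hx).2
    · intro x hx
      obtain ⟨y, ⟨hy, hxy⟩, hu⟩ := h.2 x hx
      by_cases hya : y = a
      · subst hya
        refine ⟨f y, ⟨Finset.mem_insert_self _ _, hxy.trans (sc_step _ _)⟩, fun z hz => ?_⟩
        rcases Finset.mem_insert.1 hz.1 with hz' | hz'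
        · exact hz'
        · exact absurd (hu z ⟨(Finset.mem_erase.1 hz').2, hz.2⟩) (Finset.mem_erase.1 hz').1
      · refine ⟨y, ⟨Finset.mem_insert_of_mem (Finset.mem_erase.2 ⟨hya, hy⟩), hxy⟩, fun z hz => ?_⟩
        rcases Finset.mem_insert.1 hz.1 with hz' | hz'
        · exfalso
          have : f.SameCycle x a := (hz' ▸ hz.2 : f.SameCycle x (f a)).trans (sc_step _ _).symm
          exact hya (hu a ⟨haR, this⟩).symm
        · exact hu z ⟨(Finset.mem_erase.1 hz').2, hz.2⟩
    · simp [ha.symm]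
    · rw [Finset.card_insert_of_notMem (fun h' => hfR (Finset.mem_erase.1 h').2),
        Finset.card_erase_add_one haR]
  · exact ⟨R, h, haR, rfl⟩

theorem Tr.two {C R : Finset α} {f : Perm α} (hf : ∀ x, x ∉ C → f x = x) (h : Tr C f R)
    (hn : ∀ x ∈ C, f x ≠ x) : 2 * R.card ≤ C.card ∧ (C.card ≤ 2 * R.card → ∀ x, f (f x) = x) := by
  have hdis : Disjoint R (R.map f.toEmbedding) := by
    rw [Finset.disjoint_left]
    intro x hx hx'
    obtain ⟨y, hy, rfl⟩ := Finset.mem_map.1 hx'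
    exact hn y (h.1 hy) (h.eq hy hx (sc_step _ _)).symm
  have hsub : R ∪ R.map f.toEmbedding ⊆ C := by
    intro x hx
    rcases Finset.mem_union.1 hx with hx | hx
    · exact h.1 hx
    · obtain ⟨y, hy, rfl⟩ := Finset.mem_map.1 hx
      exact (mem_of_fix hf).2 (h.1 hy)
  have hcard : (R ∪ R.map f.toEmbedding).card = 2 * R.card := by
    rw [Finset.card_union_of_disjoint hdis, Finset.card_map]; ring
  refine ⟨hcard ▸ Finset.card_le_card hsub, fun hle => ?_⟩
  have heq := Finset.eq_of_subset_of_card_le hsub (by rw [hcard]; exact hle)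
  have hR : ∀ y ∈ R, f (f y) = y := by
    intro y hy
    have hC : f (f y) ∈ C := (mem_of_fix hf).2 ((mem_of_fix hf).2 (h.1 hy))
    rw [← heq] at hC
    rcases Finset.mem_union.1 hC with h' | h'
    · exact (h.eq hy h' ((sc_step _ _).trans (sc_step _ _))).symm
    · exfalso
      obtain ⟨z, hz, hzz⟩ := Finset.mem_map.1 h'
      have : z = f y := f.injective hzz
      rw [this] at hz
      exact hn y (h.1 hy) (h.eq hy hz (sc_step _ _)).symm
  intro x
  by_cases hx : x ∈ C
  · rw [← heq] at hx
    rcases Finset.mem_union.1 hx with h' | h'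
    · exact hR x h'
    · obtain ⟨z, hz, rfl⟩ := Finset.mem_map.1 h'
      exact congrArg f (hR z hz)
  · rw [hf x hx, hf x hx]

theorem Tr_invol {C : Finset α} {o : α → Bool} {f : Perm α} (hf : ∀ x, x ∉ C → f x = x)
    (hff : ∀ x, f (f x) = x) (ho : ∀ x ∈ C, o (f x) ≠ o x) (b : Bool) :
    Tr C f (C.filter fun x => o x = b) := by
  refine ⟨Finset.filter_subset _ _, fun x hx => ?_⟩
  have hfx := (mem_of_fix hf).2 hx
  by_cases h : o x = b
  · refine ⟨x, ⟨Finset.mem_filter.2 ⟨hx, h⟩, SameCycle.refl _ _⟩, fun y hy => ?_⟩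
    rcases sc_invol hff hy.2 with h1 | h1
    · exact h1
    · exfalso
      have := (Finset.mem_filter.1 hy.1).2
      rw [h1, ← h] at this
      exact ho x hx this
  · refine ⟨f x, ⟨Finset.mem_filter.2 ⟨hfx, ?_⟩, sc_step _ _⟩, fun y hy => ?_⟩
    · have := ho x hx
      cases h3 : o (f x) <;> cases h4 : o x <;> cases b <;> simp_all
    · rcases sc_invol hff hy.2 with h1 | h1
      · exact absurd (h1 ▸ (Finset.mem_filter.1 hy.1).2) h
      · exact h1

theorem T3 (n : ℕ) : ∀ {C R₁ R₂ : Finset α} {o : α → Bool} {S ν : Perm α}, C.card = n →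
    Ann C o S → (∃ x, o (ν x) ≠ o x) → (∀ x, x ∉ C → ν x = x) → Tr C ν R₁ → Tr C (S * ν⁻¹) R₂ →
    C.card ≤ R₁.card + R₂.card → ∃ D, Good C D o S ν := by
  induction n using Nat.strong_induction_on with
  | _ n ih =>
  intro C R₁ R₂ o S ν hn hA hc hf h1 h2 hcard
  by_cases hb : ∃ u ∈ C, (S * ν⁻¹) u = u
  · obtain ⟨u, hu, hψ⟩ := hb
    have hS := SneB hA hf hc hu hψ
    have e := nu_of_psi hψ
    have hSu' : S⁻¹ u ≠ u := fun h' => hS (by rw [Perm.inv_eq_iff_eq] at h'; exact h'.symm)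
    have hνu : ν u ≠ u := fun h' => hSu' (ν.injective (e.trans h'.symm))
    obtain ⟨R', hR', huR', hR'c⟩ := h1.avoid hf hνu
    have h2' : Tr (C.erase u) (pdel u S * (pdel u ν)⁻¹) (R₂.erase u) := by
      rw [psi_delB e]; exact h2.erase_fix hψ
    have huR := h2.fix_mem hu hψ
    obtain ⟨D, hD⟩ := ih _ (by rw [← hn]; exact Finset.card_erase_lt_of_mem hu) rfl (hA.del u)
      (connB hA hc e hS) (pdel_fixes hf) (hR'.del huR') h2' (by
        rw [Finset.card_erase_of_mem hu, Finset.card_erase_of_mem huR, hR'c]; omega)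
    exact ⟨_, (Good.insB hA hu hS hD e).2⟩
  by_cases ha : ∃ a ∈ C, ν a = a
  · obtain ⟨a, ha, hν⟩ := ha
    have hS := SneA hA hf hc ha hν
    have hψa : (S * ν⁻¹) a ≠ a := by rwa [psi_a hν]
    obtain ⟨R', hR', haR', hR'c⟩ := h2.avoid (psi_fixes hA.fix hf) hψa
    have h2' : Tr (C.erase a) (pdel a S * ν⁻¹) R' := by
      rw [psi_del hν]; exact hR'.del haR'
    have haR := h1.fix_mem ha hν
    obtain ⟨D, hD⟩ := ih _ (by rw [← hn]; exact Finset.card_erase_lt_of_mem ha) rfl (hA.del a)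
      hc (fun x hx => by
        by_cases hxa : x = a
        · rw [hxa, hν]
        · exact hf x (fun h' => hx (Finset.mem_erase.2 ⟨hxa, h'⟩))) (h1.erase_fix hν) h2' (by
        rw [Finset.card_erase_of_mem ha, Finset.card_erase_of_mem haR, hR'c]; omega)
    exact ⟨_, (Good.insA hA ha hS hD).2⟩
  push Not at ha hb
  have hψf := psi_fixes hA.fix hf
  have t1 := h1.two hf ha
  have t2 := h2.two hψf hb
  have hνν := t1.2 (by omega)
  have hψψ := t2.2 (by omega)
  have hνi : ν⁻¹ = ν := by ext x; rw [Perm.inv_eq_iff_eq, hνν]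
  have hK : ∀ z, o (ν (S z)) = o (ν z) := by
    intro z
    have := hψψ (ν z)
    rw [hνi] at this
    simp only [Perm.mul_apply, hνν] at this
    have h3 : ν (S z) = S⁻¹ (ν z) := by rw [← this, pinv_apply]
    rw [h3, hA.inv']
  obtain ⟨x, hx⟩ := hc
  have hxC : x ∈ C := by by_contra h'; rw [hf x h'] at hx; exact hx rfl
  have hall : ∀ y ∈ C, o (ν y) ≠ o y := by
    have key : ∀ x ∈ C, o (ν x) ≠ o x → ∀ y ∈ C, o x = o y → o (ν y) ≠ o y := by
      intro x hxC hx y hy hxy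
      exact (sc_inv (f := S) (P := fun z => o (ν z) ≠ o z) (fun z => by rw [hK, hA.inv])
        (hA.tr x hxC y hy hxy)).1 hx
    intro y hy
    by_cases hxy : o x = o y
    · exact key x hxC hx y hy hxy
    · refine key (ν x) ((mem_of_fix hf).2 hxC) (by rw [hνν]; exact hx.symm) y hy ?_
      cases h3 : o (ν x) <;> cases h4 : o x <;> cases h5 : o y <;> simp_all
  refine ⟨C.filter fun x => o x = false, Finset.filter_subset _ _, hf, ?_, ?_, ?_⟩
  · have : C \ (C.filter fun x => o x = false) = C.filter fun x => o x = true := by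
      ext x; simp only [Finset.mem_sdiff, Finset.mem_filter]
      constructor
      · rintro ⟨h1, h2⟩; exact ⟨h1, by by_contra h3; exact h2 ⟨h1, by simpa using h3⟩⟩
      · rintro ⟨h1, h2⟩; exact ⟨h1, by simp [h2]⟩
    rw [this]
    exact Tr_invol hf hνν hall true
  · refine Tr_invol hψf hψψ (fun x hx => ?_) false
    rw [hνi, Perm.mul_apply, hA.inv]; exact hall x hx
  · intro u hu hou
    rw [(Finset.mem_filter.1 hu).2] at hou; simp at hou

theorem sz_spec {C : Finset α} {f : Perm α} (hf : ∀ x, x ∉ C → f x = x) {x : α} (hx : x ∈ C) :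
    sz C f x = Function.minimalPeriod f x ∧ 0 < Function.minimalPeriod f x := by
  classical
  have hit : ∀ j : ℕ, (f ^ j) x ∈ C := by
    intro j
    induction j with
    | zero => exact hx
    | succ j ih => rw [add_comm, pow_add, pow_one, Perm.mul_apply]; exact (mem_of_fix hf).2 ih
  have hpos : 0 < Function.minimalPeriod f x := by
    rw [Function.minimalPeriod_pos_iff_mem_periodicPts]
    obtain ⟨i, j, hij, h⟩ := Finite.exists_ne_map_eq_of_infinite (fun j : ℕ => (⟨(f ^ j) x, hit j⟩ : C))
    have h : (f ^ i) x = (f ^ j) x := by simpa using h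
    have key : ∀ i j : ℕ, i < j → (f ^ i) x = (f ^ j) x → x ∈ Function.periodicPts f := by
      intro i j hij h
      refine ⟨j - i, by omega, ?_⟩
      have e : (f ^ i) ((f ^ (j - i)) x) = (f ^ i) x := by
        rw [← Perm.mul_apply, ← pow_add, h]; congr 2; omega
      have := (f ^ i).injective e
      rw [Function.IsPeriodicPt, Function.IsFixedPt, Equiv.Perm.iterate_eq_pow]; exact this
    rcases lt_or_gt_of_ne hij with h' | h'
    · exact key i j h' h
    · exact key j i h' h.symm
  refine ⟨?_, hpos⟩
  have hper : (f ^ (Function.minimalPeriod f x)) x = x := by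
    rw [← Equiv.Perm.iterate_eq_pow]; exact Function.isPeriodicPt_minimalPeriod f x
  unfold sz
  have : (C.filter fun y => f.SameCycle x y) =
      (Finset.range (Function.minimalPeriod f x)).image (fun j => f^[j] x) := by
    ext y
    simp only [Finset.mem_filter, Finset.mem_image, Finset.mem_range, Equiv.Perm.iterate_eq_pow]
    constructor
    · rintro ⟨_, h⟩; exact sc_period hpos hper h
    · rintro ⟨j, hj, rfl⟩
      exact ⟨hit j, ⟨j, by simp⟩⟩
  rw [this, Finset.card_image_iff.2, Finset.card_range]
  have := Function.iterate_injOn_Iio_minimalPeriod (f := f) (x := x)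
  simpa using this

theorem lev_ex {C : Finset α} {o : α → Bool} {S : Perm α} {δ : ℕ}
    (hA : Ann C o S) (hd : 1 ≤ δ) (hcard : (C.filter fun x => o x = true).card = δ) :
    ∃ l : α → ZMod δ, ∀ x ∈ C, o x = true → l (S x) = l x + 1 := by
  classical
  have hne : (C.filter fun x => o x = true).Nonempty := Finset.card_pos.1 (by omega)
  obtain ⟨x0, hx0⟩ := hne
  rw [Finset.mem_filter] at hx0
  have hmp : Function.minimalPeriod S x0 = δ := by
    rw [← (sz_spec hA.fix hx0.1).1, ← hcard]
    unfold sz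
    congr 1
    ext y
    simp only [Finset.mem_filter]
    constructor
    · rintro ⟨h1, h2⟩; exact ⟨h1, by rw [← sc_inv' hA.inv h2, hx0.2]⟩
    · rintro ⟨h1, h2⟩; exact ⟨h1, hA.tr _ hx0.1 _ h1 (by rw [hx0.2, h2])⟩
  have hdvd : ∀ a b : ℤ, (S ^ a) x0 = (S ^ b) x0 → (a : ZMod δ) = b := by
    intro a b h
    rw [ZMod.intCast_eq_intCast_iff_dvd_sub]
    have h1 : (S ^ (b - a)) x0 = x0 := by
      rw [sub_eq_add_neg, add_comm, zpow_add, Perm.mul_apply, ← h, ← Perm.mul_apply, ← zpow_add]; simp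
    have := (MulAction.zpow_smul_eq_iff_minimalPeriod_dvd (a := S) (b := x0) (n := b - a)).1 h1
    rw [← hmp]; exact this
  let l : α → ZMod δ := fun x => if h : ∃ k : ℤ, (S ^ k) x0 = x then (h.choose : ZMod δ) else 0
  have hl : ∀ k : ℤ, l ((S ^ k) x0) = k := by
    intro k
    have h : ∃ k' : ℤ, (S ^ k') x0 = (S ^ k) x0 := ⟨k, rfl⟩
    have : l ((S ^ k) x0) = h.choose := dif_pos h
    rw [this]; exact hdvd _ _ h.choose_spec
  refine ⟨l, fun x hx hox => ?_⟩
  obtain ⟨k, rfl⟩ := hA.tr x0 hx0.1 x hx (by rw [hx0.2, hox])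
  have : S ((S ^ k) x0) = (S ^ (k + 1)) x0 := by
    rw [add_comm, zpow_add, zpow_one, Perm.mul_apply]
  rw [this, hl, hl]; push_cast; ring

end Core4

end

section
open Equiv Equiv.Perm
set_option linter.unusedSectionVars false
set_option linter.unusedVariables false
section Core5
variable {α : Type*} [DecidableEq α]

theorem sz_sum {C D R : Finset α} {f : Perm α} (h : Tr C f D) (hR : R ⊆ D) :
    ∃ T : Finset α, (∀ x, x ∈ T ↔ x ∈ C ∧ ∃ u ∈ R, f.SameCycle u x) ∧ ∑ u ∈ R, sz C f u = T.card := by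
  classical
  refine ⟨R.biUnion fun u => C.filter fun y => f.SameCycle u y, ?_, ?_⟩
  · intro x; simp only [Finset.mem_biUnion, Finset.mem_filter]; tauto
  · rw [Finset.card_biUnion]
    · rfl
    · intro u hu v hv huv
      rw [Function.onFun, Finset.disjoint_left]
      intro x hx hx'
      rw [Finset.mem_filter] at hx hx'
      exact huv (h.eq (hR hu) (hR hv) (hx.2.trans hx'.2.symm))

theorem sz_sum_all {C D : Finset α} {f : Perm α} (h : Tr C f D) : ∑ u ∈ D, sz C f u = C.card := by
  obtain ⟨T, hT, e⟩ := sz_sum h (Finset.Subset.refl D)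
  rw [e]; congr 1; ext x; rw [hT]
  constructor
  · exact fun h => h.1
  · intro hx
    obtain ⟨y, hy, _⟩ := h.2 x hx
    exact ⟨hx, y, hy.1, hy.2.symm⟩

theorem outer_lt {C D : Finset α} {o : α → Bool} {S ν : Perm α} (hA : Ann C o S)
    (hc : ∃ x, o (ν x) ≠ o x) (hG : Good C D o S ν) :
    ∑ u ∈ D.filter (fun x => o x = true), sz C (S * ν⁻¹) u < (C.filter fun x => o x = true).card := by
  obtain ⟨T, hT, e⟩ := sz_sum hG.trψ (Finset.filter_subset (fun x => o x = true) D)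
  rw [e]
  have hsub : T ⊆ C.filter fun x => o x = true := by
    intro x hx
    obtain ⟨h1, u, h2, h3⟩ := (hT x).1 hx
    rw [Finset.mem_filter] at h2 ⊢
    exact ⟨h1, hG.star u h2.1 h2.2 x h1 h3⟩
  refine Finset.card_lt_card (lt_of_le_of_ne hsub fun heq => ?_)
  obtain ⟨x, hx⟩ := hc
  have hxC : x ∈ C := by by_contra h'; rw [hG.fix x h'] at hx; exact hx rfl
  have hyC : ν x ∈ C := (mem_of_fix hG.fix).2 hxC
  have hSC : S x ∈ C := (mem_of_fix hA.fix).2 hxC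
  have e2 : (S * ν⁻¹) (ν x) = S x := by rw [Perm.mul_apply, pinv_apply]
  have hsc : (S * ν⁻¹).SameCycle (ν x) (S x) := by rw [← e2]; exact sc_step _ _
  have key : ∀ y ∈ C, ∀ z ∈ C, o y = true → (S * ν⁻¹).SameCycle y z → o z = true := by
    intro y hy z hz hoy hyz
    have : y ∈ T := by rw [heq, Finset.mem_filter]; exact ⟨hy, hoy⟩
    obtain ⟨_, u, h2, h3⟩ := (hT y).1 this
    rw [Finset.mem_filter] at h2
    exact hG.star u h2.1 h2.2 z hz (h3.trans hyz)
  have hSx := hA.inv x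
  cases h1 : o x
  · have h2 : o (ν x) = true := by cases h : o (ν x) <;> simp_all
    have := key _ hyC _ hSC h2 hsc
    rw [hSx, h1] at this; simp at this
  · have := key _ hSC _ hyC (by rw [hSx, h1]) hsc.symm
    rw [this, h1] at hx; exact hx rfl

theorem Lam_base {C D : Finset α} {o : α → Bool} {S ν : Perm α} {δ : ℕ}
    (hA : Ann C o S) (hc : ∃ x, o (ν x) ≠ o x) (hG : Good C D o S ν) (hd : 1 ≤ δ)
    (hδ : (C.filter fun x => o x = true).card =
      δ + ∑ u ∈ D.filter (fun x => o x = true), sz C (S * ν⁻¹) u)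
    (hψ : ∀ u ∈ C, (S * ν⁻¹) u ≠ u) (ha : ∀ u ∈ D, S⁻¹ u ∈ D) :
    ∃ l : α → ZMod δ, (∀ x ∈ C, l (S x) = l x + (if S x ∈ D then 1 - (sz C (S * ν⁻¹) (S x) : ZMod δ) else 1)) ∧
      ∀ x, l (ν x) = l x := by
  have hD := hG.term hA hc hψ ha
  have hcard : (C.filter fun x => o x = true).card = δ := by
    rw [hδ, Finset.filter_eq_empty_iff.2]
    · simp
    · intro x hx; rw [(hD x (hG.DC hx)).1 hx]; simp
  have hnD : ∀ x ∈ C, o x = true → x ∉ D := fun x hx hox h => by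
    rw [hD x hx, hox] at h; simp at h
  have hSC : ∀ x ∈ C, S x ∈ C := fun x hx => (mem_of_fix hA.fix).2 hx
  have hνC : ∀ x ∈ C, ν x ∈ C := fun x hx => (mem_of_fix hG.fix).2 hx
  obtain ⟨l0, hl0⟩ := lev_ex hA hd hcard
  have in1 : ∀ x ∈ C, o x = false → o (ν x) = true := by
    intro x hx hox
    by_contra hy
    have hyD : ν x ∈ D := by rw [hD _ (hνC x hx)]; simpa using hy
    have hSD : S x ∈ D := by rw [hD _ (hSC x hx), hA.inv, hox]
    have e : (S * ν⁻¹) (ν x) = S x := by rw [Perm.mul_apply, pinv_apply]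
    have := hG.trψ.eq hyD hSD ((sc_step _ _).trans (by rw [e]))
    rw [this] at e
    exact hψ _ (hSC x hx) e
  have out0 : ∀ x ∈ C, ∀ y ∈ C, o x = true → o y = true → ν.SameCycle x y → x = y := by
    intro x hx y hy hox hoy h
    exact hG.trν.eq (Finset.mem_sdiff.2 ⟨hx, hnD x hx hox⟩) (Finset.mem_sdiff.2 ⟨hy, hnD y hy hoy⟩) h
  have invo : ∀ x ∈ C, o x = true → o (ν x) = false → ν (ν x) = x := by
    intro x hx hox h
    exact (out0 x hx _ (hνC _ (hνC x hx)) hox (in1 _ (hνC x hx) h) ((sc_step _ _).trans (sc_step _ _))).symm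
  let l : α → ZMod δ := fun x => if o x = true then l0 x else if x ∈ C then l0 (ν x) else 0
  have l1 : ∀ x, o x = true → l x = l0 x := fun x h => if_pos h
  have l2 : ∀ x ∈ C, o x = false → l x = l0 (ν x) := fun x hx h => by simp [l, hx, h]
  have lν : ∀ x, l (ν x) = l x := by
    intro x
    by_cases hx : x ∈ C
    · cases hox : o x
      · rw [l2 x hx hox, l1 _ (in1 x hx hox)]
      · cases h : o (ν x)
        · rw [l2 _ (hνC x hx) h, invo x hx hox h, l1 x hox]
        · rw [out0 (ν x) (hνC x hx) x hx h hox (sc_step _ _).symm]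
    · rw [hG.fix x hx]
  refine ⟨l, fun x hx => ?_, lν⟩
  cases hox : o x
  · have hvD : S x ∈ D := by rw [hD _ (hSC x hx), hA.inv, hox]
    rw [if_pos hvD]
    have hψf := psi_fixes hA.fix hG.fix
    obtain ⟨hk, hkpos⟩ := sz_spec hψf (hSC x hx)
    have hψC : ∀ j : ℕ, ((S * ν⁻¹) ^ j) (S x) ∈ C := by
      intro j
      induction j with
      | zero => exact hSC x hx
      | succ j ih => rw [add_comm, pow_add, pow_one, Perm.mul_apply]; exact (mem_of_fix hψf).2 ih
    have hper : ((S * ν⁻¹) ^ (Function.minimalPeriod (S * ν⁻¹ : Perm α) (S x))) (S x) = S x := by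
      rw [← Equiv.Perm.iterate_eq_pow]; exact Function.isPeriodicPt_minimalPeriod _ _
    have hnot : ∀ j : ℕ, 0 < j → j < Function.minimalPeriod (S * ν⁻¹ : Perm α) (S x) →
        o (((S * ν⁻¹) ^ j) (S x)) = true := by
      intro j h1 h2
      by_contra h3
      have h4 : ((S * ν⁻¹) ^ j) (S x) ∈ D := by rw [hD _ (hψC j)]; simpa using h3
      have h5 := hG.trψ.eq hvD h4 ⟨j, by simp⟩
      have h6 : Function.IsPeriodicPt (S * ν⁻¹ : Perm α) j (S x) := by
        rw [Function.IsPeriodicPt, Function.IsFixedPt, Equiv.Perm.iterate_eq_pow]; exact h5.symm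
      have := h6.minimalPeriod_le h1
      omega
    have hstep : ∀ y ∈ C, o ((S * ν⁻¹) y) = true → l ((S * ν⁻¹) y) = l y + 1 := by
      intro y hy h
      have hyC : ν⁻¹ y ∈ C := (mem_of_fix (fix_inv hG.fix)).2 hy
      rw [Perm.mul_apply, hA.inv] at h
      rw [Perm.mul_apply, l1 _ (by rw [hA.inv, h]), hl0 _ hyC h, ← l1 _ h, ← lν (ν⁻¹ y), papply_inv]
    have hlev : ∀ j : ℕ, j < Function.minimalPeriod (S * ν⁻¹ : Perm α) (S x) →
        l (((S * ν⁻¹) ^ j) (S x)) = l (S x) + j := by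
      intro j
      induction j with
      | zero => intro _; simp
      | succ j ih =>
        intro hj
        have h1 := hnot (j+1) (by omega) hj
        rw [add_comm, pow_add, pow_one, Perm.mul_apply] at h1 ⊢
        rw [hstep _ (hψC j) h1, ih (by omega)]; push_cast; ring
    rw [hk]
    generalize Function.minimalPeriod (S * ν⁻¹ : Perm α) (S x) = k at *
    obtain ⟨k, rfl⟩ : ∃ k', k = k' + 1 := ⟨k - 1, by omega⟩
    have h1 := hlev k (by omega)
    rw [add_comm, pow_add, pow_one, Perm.mul_apply] at hper
    have h2 : ((S * ν⁻¹) ^ k) (S x) = ν x := by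
      apply (S * ν⁻¹).injective
      rw [hper, Perm.mul_apply, pinv_apply]
    rw [h2, lν] at h1
    rw [h1]; push_cast; ring
  · rw [if_neg (hnD _ (hSC x hx) (by rw [hA.inv, hox])), l1 x hox, l1 _ (by rw [hA.inv, hox]), hl0 x hx hox]

theorem Lam (n : ℕ) : ∀ {C D : Finset α} {o : α → Bool} {S ν : Perm α} {δ : ℕ}, C.card = n →
    Ann C o S → (∃ x, o (ν x) ≠ o x) → Good C D o S ν → 1 ≤ δ →
    (C.filter fun x => o x = true).card =
      δ + ∑ u ∈ D.filter (fun x => o x = true), sz C (S * ν⁻¹) u →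
    ∃ l : α → ZMod δ, (∀ x ∈ C, l (S x) = l x + (if S x ∈ D then 1 - (sz C (S * ν⁻¹) (S x) : ZMod δ) else 1)) ∧
      ∀ x, l (ν x) = l x := by
  induction n using Nat.strong_induction_on with
  | _ n ih =>
  intro C D o S ν δ hn hA hc hG hd hδ
  by_cases hb : ∃ u ∈ C, (S * ν⁻¹) u = u
  · obtain ⟨u, hu, hψ⟩ := hb
    have hS := SneB hA hG.fix hc hu hψ
    obtain ⟨huD, e, G1⟩ := hG.redB hA hu hψ
    have hSu' : S⁻¹ u ≠ u := fun h' => hS (by rw [Perm.inv_eq_iff_eq] at h'; exact h'.symm)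
    have hνu : ν u ≠ u := fun h' => hSu' (ν.injective (e.trans h'.symm))
    have hsz : ∀ v, v ≠ u → sz (C.erase u) (pdel u S * (pdel u ν)⁻¹) v = sz C (S * ν⁻¹) v := by
      intro v hv; rw [psi_delB e, sz_erase_fix hv hψ]
    have hsum : ∑ v ∈ D.filter (fun x => o x = true), sz C (S * ν⁻¹) v =
      (∑ v ∈ (D.erase u).filter (fun x => o x = true), sz (C.erase u) (pdel u S * (pdel u ν)⁻¹) v) +
        if o u = true then 1 else 0 := by
      rw [Finset.sum_congr rfl (fun v hv => hsz v (Finset.mem_erase.1 (Finset.mem_filter.1 hv).1).1),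
        Finset.filter_erase]
      split_ifs with hb
      · rw [← Finset.sum_erase_add _ _ (show u ∈ D.filter (fun x => o x = true) by simp [huD, hb]),
          sz_fix hu hψ]
      · rw [Finset.erase_eq_of_notMem (by simp [hb])]; simp
    rw [hsum, card_filter_erase hu] at hδ
    obtain ⟨l', hl1, hl2⟩ := ih _ (by rw [← hn]; exact Finset.card_erase_lt_of_mem hu) rfl (hA.del u)
      (connB hA hc e hS) G1 hd (by omega)
    have hlS : ∀ x, x ≠ u → Function.update l' u (l' (S⁻¹ u)) x = l' x := fun x hx =>
      Function.update_of_ne hx _ _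
    refine ⟨Function.update l' u (l' (S⁻¹ u)), ?_, ?_⟩
    · intro x hx
      by_cases h1 : x = u
      · subst h1
        rw [Function.update_self, hlS _ hS]
        have h2 := hl1 (S⁻¹ x) (Finset.mem_erase.2 ⟨hSu', (mem_of_fix (fix_inv hA.fix)).2 hx⟩)
        rw [pdel_of_eq (papply_inv S x), hsz _ hS] at h2
        simpa [hS] using h2
      · by_cases h2 : S x = u
        · rw [h2, Function.update_self, hlS x h1, if_pos huD, sz_fix hu hψ, ← h2, pinv_apply]; simp
        · rw [hlS _ h2, hlS _ h1]
          have h3 := hl1 x (Finset.mem_erase.2 ⟨h1, hx⟩)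
          rw [pdel_of_ne h2 h1, hsz _ h2] at h3
          simpa [h2] using h3
    · intro x
      by_cases h1 : x = u
      · subst h1
        rw [Function.update_self, hlS _ hνu]
        have := hl2 (S⁻¹ x)
        rwa [pdel_of_eq e] at this
      · by_cases h2 : ν x = u
        · rw [h2, Function.update_self, hlS x h1, ν.injective (e.trans h2.symm)]
        · rw [hlS _ h2, hlS _ h1]
          have := hl2 x
          rwa [pdel_of_ne h2 h1] at this
  push Not at hb
  by_cases ha : ∃ u ∈ D, S⁻¹ u ∉ D
  · obtain ⟨u, hu, ha⟩ := ha
    have huC := hG.DC hu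
    have haC : S⁻¹ u ∈ C := (mem_of_fix (fix_inv hA.fix)).2 huC
    have hν := hG.fixA hA hu (hb u huC) ha
    have hSa' : S (S⁻¹ u) = u := papply_inv S u
    have hou := hA.inv' u
    obtain ⟨hs1, hs2⟩ := szA hA hG hu ha hν
    generalize haa : S⁻¹ u = a at *
    have hua : u ≠ a := fun h => ha (h ▸ hu)
    have hSa : S a ≠ a := by rw [hSa']; exact hua
    obtain ⟨haD, G1⟩ := hG.redA hA haC hν hSa
    have hsum := sum_filter_update hu o true (sz C (S * ν⁻¹)) (by omega)
    have hsum2 : ∑ v ∈ D.filter (fun x => o x = true), sz (C.erase a) (pdel a S * ν⁻¹) v =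
        ∑ v ∈ D.filter (fun x => o x = true), Function.update (sz C (S * ν⁻¹)) u (sz C (S * ν⁻¹) u - 1) v := by
      refine Finset.sum_congr rfl fun v hv => ?_
      by_cases hvu : v = u
      · subst hvu; rw [Function.update_self]; omega
      · rw [Function.update_of_ne hvu, hs2 v (Finset.mem_filter.1 hv).1 hvu]
    rw [hsum, ← hsum2, card_filter_erase haC, hou] at hδ
    obtain ⟨l', hl1, hl2⟩ := ih _ (by rw [← hn]; exact Finset.card_erase_lt_of_mem haC) rfl (hA.del a)
      hc G1 hd (by omega)
    have hlS : ∀ x, x ≠ a → Function.update l' a (l' (S⁻¹ a) + 1) x = l' x := fun x hx =>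
      Function.update_of_ne hx _ _
    have hSia : S⁻¹ a ≠ a := fun h => hSa (by rw [Perm.inv_eq_iff_eq] at h; exact h.symm)
    refine ⟨Function.update l' a (l' (S⁻¹ a) + 1), ?_, ?_⟩
    · intro x hx
      by_cases h1 : x = a
      · subst h1
        rw [hSa', Function.update_self, hlS _ hua, if_pos hu]
        have h2 := hl1 (S⁻¹ x) (Finset.mem_erase.2 ⟨hSia, (mem_of_fix (fix_inv hA.fix)).2 hx⟩)
        rw [pdel_of_eq (papply_inv S x), hSa', if_pos hu] at h2
        rw [h2, ← hs1]; push_cast; ring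
      · by_cases h2 : S x = a
        · rw [h2, Function.update_self, hlS x h1, if_neg haD, ← h2, pinv_apply]
        · rw [hlS _ h2, hlS _ h1]
          have h3 := hl1 x (Finset.mem_erase.2 ⟨h1, hx⟩)
          rw [pdel_of_ne h2 h1] at h3
          rw [h3]
          have h4 : S x ≠ u := fun h => h1 (S.injective (h.trans hSa'.symm))
          by_cases h5 : S x ∈ D
          · rw [if_pos h5, if_pos h5, hs2 _ h5 h4]
          · rw [if_neg h5, if_neg h5]
    · intro x
      by_cases h1 : x = a
      · rw [h1, hν]
      · rw [hlS x h1, hlS _ (fun h => h1 (ν.injective (h.trans hν.symm))), hl2]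
  push Not at ha
  exact Lam_base hA hc hG hd hδ hb ha

theorem LamW {C D : Finset α} {o : α → Bool} {S ν : Perm α} {δ : ℕ}
    (hA : Ann C o S) (hc : ∃ x, o (ν x) ≠ o x) (hG : Good C D o S ν) (hd : 1 ≤ δ)
    (hδ : (C.filter fun x => o x = true).card =
      δ + ∑ u ∈ D.filter (fun x => o x = true), sz C (S * ν⁻¹) u) :
    ∃ l : α → ZMod δ, Wt C D o S (sz C (S * ν⁻¹)) δ l ∧ ∀ x, l (ν x) = l x := by
  obtain ⟨l, h1, h2⟩ := Lam _ rfl hA hc hG hd hδ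
  refine ⟨l, ⟨hG.DC, fun u hu => sz_pos (hG.DC hu), hd, hδ, ?_, h1⟩, h2⟩
  have h3 := sz_sum_all hG.trψ
  have hsp : ∀ (E : Finset α) (F : α → ℕ), ∑ u ∈ E, F u =
      ∑ u ∈ E.filter (fun x => o x = true), F u + ∑ u ∈ E.filter (fun x => o x = false), F u := by
    intro E F
    rw [← Finset.sum_filter_add_sum_filter_not E (fun x => o x = true)]
    simp
  have h4 := hsp C (fun _ => 1)
  simp only [← Finset.card_eq_sum_ones] at h4
  rw [hsp D, h4, hδ] at h3
  omega

end Core5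

end

section
open Equiv Equiv.Perm
set_option linter.unusedSectionVars false
set_option linter.unusedVariables false

theorem sz_neg {n : ℕ} {x : ℤ} (h : x ∈ signedSet n) : -x ∈ signedSet n := by
  obtain ⟨h1, h2⟩ := h; exact ⟨by simpa using h1, by rwa [abs_neg]⟩

theorem inB.mem {n : ℕ} {τ : Perm ℤ} (h : inB n τ) {x : ℤ} : τ x ∈ signedSet n ↔ x ∈ signedSet n := by
  constructor
  · intro hx; by_contra h'; rw [h.2 x h'] at hx; exact h' hx
  · intro hx; by_contra h'; have := τ.injective (h.2 _ h'); rw [this] at h'; exact h' hx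

theorem inB_one (n : ℕ) : inB n 1 := ⟨fun _ => rfl, fun _ _ => rfl⟩

theorem inB.mul {n : ℕ} {τ σ : Perm ℤ} (h : inB n τ) (h' : inB n σ) : inB n (τ * σ) := by
  refine ⟨fun x => ?_, fun x hx => ?_⟩
  · rw [Perm.mul_apply, h'.1, h.1]; rfl
  · rw [Perm.mul_apply, h'.2 x hx, h.2 x hx]

theorem inB.inv {n : ℕ} {τ : Perm ℤ} (h : inB n τ) : inB n τ⁻¹ := by
  refine ⟨fun x => ?_, fun x hx => ?_⟩
  · rw [Perm.inv_eq_iff_eq, h.1, papply_inv]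
  · rw [Perm.inv_eq_iff_eq, h.2 x hx]

/-- odd functions supported on the signed set and fixed by τ -/
def Fx (n : ℕ) (τ : Perm ℤ) : Submodule ℚ (ℤ → ℚ) where
  carrier := {f | (∀ x, f (-x) = - f x) ∧ (∀ x, x ∉ signedSet n → f x = 0) ∧ ∀ x, f (τ x) = f x}
  add_mem' := by
    rintro f g ⟨h1, h2, h3⟩ ⟨k1, k2, k3⟩
    refine ⟨fun x => ?_, fun x hx => ?_, fun x => ?_⟩
    · simp only [Pi.add_apply, h1, k1]; ring
    · simp only [Pi.add_apply, h2 x hx, k2 x hx]; ring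
    · simp only [Pi.add_apply, h3, k3]
  zero_mem' := by simp
  smul_mem' := by
    rintro c f ⟨h1, h2, h3⟩
    refine ⟨fun x => ?_, fun x hx => ?_, fun x => ?_⟩
    · simp only [Pi.smul_apply, h1, smul_neg]
    · simp only [Pi.smul_apply, h2 x hx, smul_zero]
    · simp only [Pi.smul_apply, h3]

theorem Fx_le (n : ℕ) (τ : Perm ℤ) : Fx n τ ≤ Fx n 1 := fun f hf => ⟨hf.1, hf.2.1, fun _ => rfl⟩

theorem Fx_inf (n : ℕ) (τ σ : Perm ℤ) : Fx n τ ⊓ Fx n σ ≤ Fx n (τ * σ) := by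
  rintro f ⟨h1, h2⟩
  exact ⟨h1.1, h1.2.1, fun x => by rw [Perm.mul_apply, h1.2.2, h2.2.2]⟩

theorem Fx_inv (n : ℕ) (τ : Perm ℤ) {f : ℤ → ℚ} (h : f ∈ Fx n τ) (x : ℤ) : f (τ⁻¹ x) = f x := by
  rw [← h.2.2 (τ⁻¹ x), papply_inv]

theorem Fx_sc {n : ℕ} {τ : Perm ℤ} {f : ℤ → ℚ} (h : f ∈ Fx n τ) {x y : ℤ} (hxy : τ.SameCycle x y) :
    f x = f y := sc_inv' h.2.2 hxy

/-- upper bound on dimension by restriction -/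
theorem dim_le (F : Submodule ℚ (ℤ → ℚ)) (P : Finset ℤ)
    (h : ∀ f ∈ F, (∀ y ∈ P, f y = 0) → f = 0) :
    FiniteDimensional ℚ F ∧ Module.finrank ℚ F ≤ P.card := by
  let φ : F →ₗ[ℚ] (P → ℚ) :=
    { toFun := fun f y => f.1 y.1, map_add' := fun _ _ => rfl, map_smul' := fun _ _ => rfl }
  have hφ : Function.Injective φ := by
    rw [← LinearMap.ker_eq_bot, LinearMap.ker_eq_bot']
    intro f hf
    apply Subtype.ext
    exact h f.1 f.2 (fun y hy => congrFun hf ⟨y, hy⟩)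
  have hfd : FiniteDimensional ℚ F := FiniteDimensional.of_injective φ hφ
  refine ⟨hfd, ?_⟩
  have := LinearMap.finrank_le_finrank_of_injective hφ
  simpa using this

theorem le_dim (F : Submodule ℚ (ℤ → ℚ)) [FiniteDimensional ℚ F] (P : Finset ℤ) (e : ℤ → ℤ → ℚ)
    (he : ∀ y ∈ P, e y ∈ F) (h1 : ∀ y ∈ P, ∀ z ∈ P, e y z = if y = z then 1 else 0) :
    P.card ≤ Module.finrank ℚ F := by
  let v : P → F := fun y => ⟨e y.1, he y.1 y.2⟩
  have hv : LinearIndependent ℚ v := by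
    rw [Fintype.linearIndependent_iff]
    intro g hg i
    have := congrFun (congrArg Subtype.val hg) i.1
    simp only [Submodule.coe_sum, Finset.sum_apply, Submodule.coe_smul, Pi.smul_apply, smul_eq_mul,
      ZeroMemClass.coe_zero, Pi.zero_apply, v] at this
    rw [Finset.sum_eq_single i] at this
    · rw [h1 _ i.2 _ i.2] at this; simpa using this
    · intro b _ hb
      rw [h1 _ b.2 _ i.2, if_neg (fun h => hb (Subtype.ext h))]; simp
    · intro h; exact absurd (Finset.mem_univ _) h
  simpa using hv.fintype_card_le_finrank

theorem V_zero {n : ℕ} {f : ℤ → ℚ} (hf : f ∈ Fx n 1) (h : ∀ y ∈ Finset.Icc (1:ℤ) n, f y = 0) : f = 0 := by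
  ext x
  by_cases hx : x ∈ signedSet n
  · obtain ⟨h0, hx⟩ := hx
    rw [abs_le] at hx
    rcases lt_or_gt_of_ne h0 with h' | h'
    · have := h (-x) (by rw [Finset.mem_Icc]; omega)
      rw [hf.1] at this; simpa using this
    · exact h x (by rw [Finset.mem_Icc]; omega)
  · exact hf.2.1 x hx

instance fdFx (n : ℕ) (τ : Perm ℤ) : FiniteDimensional ℚ (Fx n τ) :=
  (dim_le _ (Finset.Icc (1:ℤ) n) (fun f hf h => V_zero (Fx_le n τ hf) h)).1

/-- basis vector -/
def ev (i : ℤ) : ℤ → ℚ := fun x => (if x = i then 1 else 0) - (if x = -i then 1 else 0)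

theorem ev_mem {n : ℕ} {τ : Perm ℤ} (hτ : inB n τ) {i : ℤ} (hi : i ∈ signedSet n) (h : τ i = i) :
    ev i ∈ Fx n τ := by
  have h' : τ (-i) = -i := by rw [hτ.1, h]
  refine ⟨fun x => ?_, fun x hx => ?_, fun x => ?_⟩
  · have e1 : (-x = i) ↔ (x = -i) := by omega
    have e2 : (-x = -i) ↔ (x = i) := by omega
    simp only [ev, e1, e2]; ring
  · have e1 : x ≠ i := by rintro rfl; exact hx hi
    have e2 : x ≠ -i := by rintro rfl; exact hx (sz_neg hi)
    simp [ev, e1, e2]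
  · have e1 : (τ x = i) ↔ (x = i) := ⟨fun h2 => τ.injective (h2.trans h.symm), fun h2 => by rw [h2, h]⟩
    have e2 : (τ x = -i) ↔ (x = -i) := ⟨fun h2 => τ.injective (h2.trans h'.symm), fun h2 => by rw [h2, h']⟩
    simp only [ev, e1, e2]

theorem ev_self {i : ℤ} (hi : i ≠ 0) : ev i i = 1 := by
  have : i ≠ -i := by omega
  simp [ev, this]

theorem ev_ne {i x : ℤ} (h : x ≠ i) : ev i x ≠ 1 := by
  simp only [ev, if_neg h]
  split_ifs <;> norm_num

theorem dimV (n : ℕ) : Module.finrank ℚ (Fx n 1) = n := by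
  apply le_antisymm
  · have := (dim_le _ (Finset.Icc (1:ℤ) n) (fun f hf h => V_zero (n := n) hf h)).2
    simpa using this
  · have := le_dim (Fx n 1) (Finset.Icc (1:ℤ) n) ev (fun y hy => ?_) (fun y hy z hz => ?_)
    · simpa using this
    · rw [Finset.mem_Icc] at hy
      exact ev_mem (inB_one n) ⟨by omega, by rw [abs_le]; omega⟩ rfl
    · rw [Finset.mem_Icc] at hy hz
      have e : z ≠ -y := by omega
      by_cases hyz : y = z
      · subst hyz; simp [ev, e]
      · simp [ev, e, hyz, Ne.symm hyz]

/-- dimension of the fixed space -/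
noncomputable def dm (n : ℕ) (τ : Perm ℤ) : ℕ := Module.finrank ℚ (Fx n τ)

theorem dm_le (n : ℕ) (τ : Perm ℤ) : dm n τ ≤ n :=
  (Submodule.finrank_mono (Fx_le n τ)).trans_eq (dimV n)

theorem dim_inf (n : ℕ) (F G : Submodule ℚ (ℤ → ℚ)) (hF : F ≤ Fx n 1) (hG : G ≤ Fx n 1) :
    Module.finrank ℚ F + Module.finrank ℚ G ≤ n + Module.finrank ℚ (F ⊓ G : Submodule ℚ (ℤ → ℚ)) := by
  have := Submodule.finiteDimensional_of_le hF
  have := Submodule.finiteDimensional_of_le hG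
  have h1 := Submodule.finrank_sup_add_finrank_inf_eq F G
  have h2 := Submodule.finrank_mono (sup_le hF hG)
  rw [dimV] at h2
  omega

theorem dm_mul (n : ℕ) (τ σ : Perm ℤ) : dm n τ + dm n σ ≤ n + dm n (τ * σ) := by
  have h1 := dim_inf n (Fx n τ) (Fx n σ) (Fx_le _ _) (Fx_le _ _)
  have h2 := Submodule.finrank_mono (Fx_inf n τ σ)
  unfold dm; omega

theorem dim_ker (F : Submodule ℚ (ℤ → ℚ)) [FiniteDimensional ℚ F] (l : (ℤ → ℚ) →ₗ[ℚ] ℚ) :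
    Module.finrank ℚ F ≤ Module.finrank ℚ (F ⊓ LinearMap.ker l : Submodule ℚ (ℤ → ℚ)) + 1 := by
  have h1 := LinearMap.finrank_range_add_finrank_ker (l.comp F.subtype)
  have h2 : Module.finrank ℚ (LinearMap.range (l.comp F.subtype)) ≤ 1 := by
    have := Submodule.finrank_le (LinearMap.range (l.comp F.subtype))
    simpa using this
  have h3 : Module.finrank ℚ (LinearMap.ker (l.comp F.subtype)) =
      Module.finrank ℚ (F ⊓ LinearMap.ker l : Submodule ℚ (ℤ → ℚ)) := by
    rw [← Submodule.finrank_map_subtype_eq F, LinearMap.ker_comp, Submodule.map_comap_subtype]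
  omega

/-- reflection data -/
def IsRfl (n : ℕ) (g : Perm ℤ) (a b : ℤ) : Prop :=
  inB n g ∧ a ∈ signedSet n ∧ g b = a ∧ g * g = 1 ∧
    ∀ f ∈ Fx n 1, f a = f b → ∀ x, f (g x) = f x

theorem refl_pair {n : ℕ} {a b : ℤ} (ha : a ∈ signedSet n) (hb : b ∈ signedSet n) (h1 : a ≠ b)
    (h2 : a ≠ -b) : IsRfl n (swap a b * swap (-a) (-b)) a b := by
  have ha0 := ha.1
  have hb0 := hb.1
  have s1 : swap (-a) (-b) a = a := swap_apply_of_ne_of_ne (by omega) (by omega)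
  have s2 : swap (-a) (-b) b = b := swap_apply_of_ne_of_ne (by omega) (by omega)
  have s3 : swap a b (-a) = -a := swap_apply_of_ne_of_ne (by omega) (by omega)
  have s4 : swap a b (-b) = -b := swap_apply_of_ne_of_ne (by omega) (by omega)
  have fa : (swap a b * swap (-a) (-b)) a = b := by
    rw [Perm.mul_apply, s1, swap_apply_left]
  have fb : (swap a b * swap (-a) (-b)) b = a := by
    rw [Perm.mul_apply, s2, swap_apply_right]
  have fna : (swap a b * swap (-a) (-b)) (-a) = -b := by
    rw [Perm.mul_apply, swap_apply_left, s4]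
  have fnb : (swap a b * swap (-a) (-b)) (-b) = -a := by
    rw [Perm.mul_apply, swap_apply_right, s3]
  have fo : ∀ x, x ≠ a → x ≠ b → x ≠ -a → x ≠ -b → (swap a b * swap (-a) (-b)) x = x := by
    intro x h1 h2 h3 h4
    rw [Perm.mul_apply, swap_apply_of_ne_of_ne h3 h4, swap_apply_of_ne_of_ne h1 h2]
  generalize swap a b * swap (-a) (-b) = g at *
  refine ⟨⟨fun x => ?_, fun x hx => ?_⟩, ha, fb, ?_, ?_⟩
  · by_cases e1 : x = a
    · rw [e1, fna, fa]
    by_cases e2 : x = b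
    · rw [e2, fnb, fb]
    by_cases e3 : x = -a
    · rw [e3, fna, neg_neg, fa, neg_neg]
    by_cases e4 : x = -b
    · rw [e4, fnb, neg_neg, fb, neg_neg]
    rw [fo x e1 e2 e3 e4, fo (-x) (by omega) (by omega) (by omega) (by omega)]
  · refine fo x ?_ ?_ ?_ ?_
    · rintro rfl; exact hx ha
    · rintro rfl; exact hx hb
    · rintro rfl; exact hx (sz_neg ha)
    · rintro rfl; exact hx (sz_neg hb)
  · ext x
    rw [Perm.mul_apply, Perm.one_apply]
    by_cases e1 : x = a
    · rw [e1, fa, fb]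
    by_cases e2 : x = b
    · rw [e2, fb, fa]
    by_cases e3 : x = -a
    · rw [e3, fna, fnb]
    by_cases e4 : x = -b
    · rw [e4, fnb, fna]
    rw [fo x e1 e2 e3 e4, fo x e1 e2 e3 e4]
  · intro f hf hab x
    by_cases e1 : x = a
    · rw [e1, fa, hab]
    by_cases e2 : x = b
    · rw [e2, fb, hab]
    by_cases e3 : x = -a
    · rw [e3, fna, hf.1, hf.1, hab]
    by_cases e4 : x = -b
    · rw [e4, fnb, hf.1, hf.1, hab]
    rw [fo x e1 e2 e3 e4]

theorem refl_single {n : ℕ} {a : ℤ} (ha : a ∈ signedSet n) : IsRfl n (swap a (-a)) a (-a) := by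
  have ha0 := ha.1
  have fo : ∀ x, x ≠ a → x ≠ -a → swap a (-a) x = x := fun x h1 h2 => swap_apply_of_ne_of_ne h1 h2
  refine ⟨⟨fun x => ?_, fun x hx => ?_⟩, ha, swap_apply_right _ _, swap_mul_self _ _, ?_⟩
  · by_cases e1 : x = a
    · rw [e1, swap_apply_right, swap_apply_left, neg_neg]
    by_cases e2 : x = -a
    · rw [e2, neg_neg, swap_apply_right, swap_apply_left]
    rw [fo x e1 e2, fo (-x) (by omega) (by omega)]
  · refine fo x ?_ ?_
    · rintro rfl; exact hx ha
    · rintro rfl; exact hx (sz_neg ha)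
  · intro f hf hab x
    by_cases e1 : x = a
    · rw [e1, swap_apply_left, hab]
    by_cases e2 : x = -a
    · rw [e2, swap_apply_right, hab]
    rw [fo x e1 e2]

theorem gen_refl {n : ℕ} {g : Perm ℤ} (hg : g ∈ genB n) : ∃ a b, IsRfl n g a b := by
  have mem : ∀ i : ℤ, 1 ≤ i → i ≤ n → i ∈ signedSet n := fun i h1 h2 =>
    ⟨by omega, by rw [abs_le]; omega⟩
  rcases hg with ⟨i, j, h1, h2, h3, h4, h5, rfl⟩ | ⟨i, j, h1, h2, h3, h4, h5, rfl⟩ | ⟨i, h1, h2, rfl⟩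
  · exact ⟨i, j, refl_pair (mem i h1 h2) (mem j h3 h4) h5 (by omega)⟩
  · have := refl_pair (mem i h1 h2) (sz_neg (mem j h3 h4)) (by omega) (by omega)
    rw [neg_neg] at this
    exact ⟨i, -j, this⟩
  · exact ⟨i, -i, refl_single (mem i h1 h2)⟩

theorem refl_gen {n : ℕ} {a b : ℤ} (ha : a ∈ signedSet n) (hb : b ∈ signedSet n) (h1 : a ≠ b) :
    ∃ g ∈ genB n, IsRfl n g a b := by
  have ha' := ha; have hb' := hb
  obtain ⟨ha0, ha1⟩ := ha'
  obtain ⟨hb0, hb1⟩ := hb'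
  rw [abs_le] at ha1 hb1
  by_cases h2 : a = -b
  · have e : b = -a := by omega
    subst e
    refine ⟨_, ?_, refl_single ha⟩
    rcases lt_or_gt_of_ne ha0 with h | h
    · exact Or.inr (Or.inr ⟨-a, by omega, by omega, by rw [neg_neg, swap_comm]⟩)
    · exact Or.inr (Or.inr ⟨a, by omega, by omega, rfl⟩)
  · refine ⟨_, ?_, refl_pair ha hb h1 h2⟩
    have hcomm : swap a b * swap (-a) (-b) = swap (-a) (-b) * swap a b := by
      apply Equiv.Perm.Disjoint.commute
      intro x
      by_cases h : x = a ∨ x = b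
      · right; rw [swap_apply_of_ne_of_ne (by omega) (by omega)]
      · left; rw [swap_apply_of_ne_of_ne (by omega) (by omega)]
    rcases lt_or_gt_of_ne ha0 with h | h <;> rcases lt_or_gt_of_ne hb0 with h' | h'
    · exact Or.inl ⟨-a, -b, by omega, by omega, by omega, by omega, by omega, by
        rw [neg_neg, neg_neg]; exact hcomm⟩
    · exact Or.inr (Or.inl ⟨-a, b, by omega, by omega, by omega, by omega, by omega, by
        rw [neg_neg]; exact hcomm⟩)
    · exact Or.inr (Or.inl ⟨a, -b, by omega, by omega, by omega, by omega, by omega, by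
        rw [neg_neg]⟩)
    · exact Or.inl ⟨a, b, by omega, by omega, by omega, by omega, by omega, rfl⟩

theorem dm_refl {n : ℕ} {g : Perm ℤ} {a b : ℤ} (h : IsRfl n g a b) : n ≤ dm n g + 1 := by
  let l : (ℤ → ℚ) →ₗ[ℚ] ℚ :=
    { toFun := fun f => f a - f b
      map_add' := fun f g => by simp only [Pi.add_apply]; ring
      map_smul' := fun c f => by simp only [Pi.smul_apply, smul_eq_mul, RingHom.id_apply]; ring }
  have h1 := dim_ker (Fx n 1) l
  rw [dimV] at h1
  have h2 : (Fx n 1 ⊓ LinearMap.ker l : Submodule ℚ (ℤ → ℚ)) ≤ Fx n g := by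
    rintro f ⟨hf, hl⟩
    refine ⟨hf.1, hf.2.1, h.2.2.2.2 f hf ?_⟩
    have : f a - f b = 0 := hl
    linarith
  have h3 := Submodule.finrank_mono h2
  unfold dm; omega

theorem len_lower {n : ℕ} (l : List (Perm ℤ)) (hl : ∀ g ∈ l, g ∈ genB n) :
    n ≤ dm n l.prod + l.length := by
  induction l with
  | nil => exact le_of_eq (dimV n).symm
  | cons g l ih =>
    have h1 := ih (fun g hg => hl g (List.mem_cons_of_mem _ hg))
    obtain ⟨a, b, h2⟩ := gen_refl (hl g List.mem_cons_self)
    have h3 := dm_refl h2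
    have h4 := dm_mul n g l.prod
    rw [List.prod_cons, List.length_cons]
    omega

theorem len_upper {n : ℕ} (k : ℕ) : ∀ τ : Perm ℤ, inB n τ → n - dm n τ ≤ k →
    ∃ l : List (Perm ℤ), (∀ g ∈ l, g ∈ genB n) ∧ l.prod = τ ∧ l.length + dm n τ ≤ n := by
  induction k with
  | zero =>
    intro τ hτ hk
    have h1 : dm n τ = n := le_antisymm (dm_le n τ) (by omega)
    have h2 : Fx n τ = Fx n 1 := by
      have := fdFx n 1
      exact Submodule.eq_of_le_of_finrank_eq (Fx_le n τ) (by rw [dimV]; exact h1)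
    refine ⟨[], by simp, ?_, by simp [h1]⟩
    ext x
    by_cases hx : x ∈ signedSet n
    · have h3 : ev x ∈ Fx n τ := by rw [h2]; exact ev_mem (inB_one n) hx rfl
      have h4 := h3.2.2 x
      rw [ev_self hx.1] at h4
      by_contra h5
      exact ev_ne (Ne.symm h5) h4
    · rw [hτ.2 x hx]; rfl
  | succ k ih =>
    intro τ hτ hk
    by_cases h1 : ∃ x, τ x ≠ x
    · obtain ⟨x, hx⟩ := h1
      have hxX : x ∈ signedSet n := by by_contra h; exact hx (hτ.2 x h)
      obtain ⟨g, hg, hr⟩ := refl_gen hxX (hτ.mem.2 hxX) (Ne.symm hx)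
      have hgτ : inB n (g * τ) := hr.1.mul hτ
      have hfix : (g * τ) x = x := by rw [Perm.mul_apply]; exact hr.2.2.1
      have hlt : Fx n τ < Fx n (g * τ) := by
        refine lt_of_le_of_ne (fun f hf => ⟨hf.1, hf.2.1, fun y => ?_⟩) fun heq => ?_
        · rw [Perm.mul_apply, hr.2.2.2.2 f (Fx_le _ _ hf) (hf.2.2 x).symm, hf.2.2]
        · have h3 := ev_mem hgτ hxX hfix
          rw [← heq] at h3
          have h4 := h3.2.2 x
          rw [ev_self hxX.1] at h4
          exact ev_ne hx h4
      have h5 := Submodule.finrank_lt_finrank_of_lt hlt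
      have h6 : dm n τ < dm n (g * τ) := h5
      obtain ⟨l, hl1, hl2, hl3⟩ := ih (g * τ) hgτ (by omega)
      refine ⟨g :: l, ?_, ?_, ?_⟩
      · intro g' hg'
        rcases List.mem_cons.1 hg' with rfl | h
        · exact hg
        · exact hl1 g' h
      · rw [List.prod_cons, hl2, ← mul_assoc, hr.2.2.2.1, one_mul]
      · rw [List.length_cons]; omega
    · push Not at h1
      have : τ = 1 := by ext x; rw [h1 x]; rfl
      subst this
      exact ⟨[], by simp, rfl, by simp [dm, dimV]⟩

theorem lenB_eq {n : ℕ} {τ : Perm ℤ} (hτ : inB n τ) : lenB n τ + dm n τ = n := by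
  obtain ⟨l, h1, h2, h3⟩ := len_upper (n - dm n τ) τ hτ le_rfl
  have h4 : lenB n τ ≤ l.length := Nat.sInf_le ⟨l, rfl, h1, h2⟩
  have h5 := Nat.sInf_mem (s := {k : ℕ | ∃ l : List (Equiv.Perm ℤ),
    l.length = k ∧ (∀ g ∈ l, g ∈ genB n) ∧ l.prod = τ}) ⟨_, l, rfl, h1, h2⟩
  obtain ⟨l', e1, e2, e3⟩ := h5
  have h6 := len_lower l' e2
  rw [e3, e1] at h6
  have : lenB n τ = sInf {k : ℕ | ∃ l : List (Equiv.Perm ℤ),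
    l.length = k ∧ (∀ g ∈ l, g ∈ genB n) ∧ l.prod = τ} := rfl
  omega

end

section
open Equiv Equiv.Perm
set_option linter.unusedSectionVars false
set_option linter.unusedVariables false

theorem leB_iff {n : ℕ} {τ σ : Perm ℤ} (hτ : inB n τ) (hσ : inB n σ) :
    leB n τ σ ↔ dm n τ + dm n (τ⁻¹ * σ) = n + dm n σ := by
  have h1 := lenB_eq hτ
  have h2 := lenB_eq hσ
  have h3 := lenB_eq (hτ.inv.mul hσ)
  unfold leB; omega

theorem leB_Fx {n : ℕ} {τ σ : Perm ℤ} (h : dm n τ + dm n (τ⁻¹ * σ) = n + dm n σ) :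
    Fx n σ ≤ Fx n τ ⊓ Fx n (τ⁻¹ * σ) := by
  have h1 : Fx n τ ⊓ Fx n (τ⁻¹ * σ) ≤ Fx n σ := by
    have := Fx_inf n τ (τ⁻¹ * σ)
    rwa [mul_inv_cancel_left] at this
  have h2 := dim_inf n (Fx n τ) (Fx n (τ⁻¹ * σ)) (Fx_le _ _) (Fx_le _ _)
  have h3 := Submodule.finrank_mono h1
  unfold dm at h
  exact (Submodule.eq_of_le_of_finrank_le h1 (by omega)).ge

theorem sc_neg {n : ℕ} {τ : Perm ℤ} (hτ : inB n τ) {x y : ℤ} (h : τ.SameCycle x y) :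
    τ.SameCycle (-x) (-y) := by
  have := (sc_inv (P := fun z => τ.SameCycle (-x) (-z)) (fun z => ?_) h).1 (SameCycle.refl _ _)
  · exact this
  · show τ.SameCycle (-x) (-(τ z)) ↔ τ.SameCycle (-x) (-z)
    rw [← hτ.1]
    exact ⟨fun h => h.trans (sc_step τ _).symm, fun h => h.trans (sc_step τ _)⟩

theorem negOrbit {n : ℕ} {τ : Perm ℤ} (hτ : inB n τ) (x : ℤ) :
    negSet (permOrbit τ x) = permOrbit τ x ↔ τ.SameCycle x (-x) := by
  constructor
  · intro h
    have : x ∈ negSet (permOrbit τ x) := by rw [h]; exact SameCycle.refl _ _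
    exact this
  · intro h
    ext y
    show τ.SameCycle x (-y) ↔ τ.SameCycle x y
    constructor
    · intro h2
      have := sc_neg hτ h2
      rw [neg_neg] at this
      exact h.trans this
    · intro h2
      exact h.trans (sc_neg hτ h2)

theorem orb_eq {τ : Perm ℤ} {x y : ℤ} (h : τ.SameCycle x y) : permOrbit τ x = permOrbit τ y := by
  ext z
  exact ⟨fun h2 => SameCycle.trans h.symm h2, fun h2 => SameCycle.trans h h2⟩

open Classical in
/-- indicator -/
noncomputable def indQ (P : Prop) : ℚ := if P then 1 else 0

theorem indQ_pos {P : Prop} (h : P) : indQ P = 1 := if_pos h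

theorem indQ_neg {P : Prop} (h : ¬ P) : indQ P = 0 := if_neg h

/-- test function -/
noncomputable def tf (τ : Perm ℤ) (x : ℤ) : ℤ → ℚ := fun y =>
  indQ (τ.SameCycle x y) - indQ (τ.SameCycle (-x) y)

theorem sc_mem {n : ℕ} {τ : Perm ℤ} (hτ : inB n τ) {x y : ℤ} (h : τ.SameCycle x y) :
    x ∈ signedSet n ↔ y ∈ signedSet n :=
  sc_inv (P := fun z => z ∈ signedSet n) (fun z => hτ.mem) h

theorem tf_mem {n : ℕ} {τ : Perm ℤ} (hτ : inB n τ) {x : ℤ} (hx : x ∈ signedSet n) : tf τ x ∈ Fx n τ := by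
  refine ⟨fun y => ?_, fun y hy => ?_, fun y => ?_⟩
  · have e1 : τ.SameCycle x (-y) ↔ τ.SameCycle (-x) y :=
      ⟨fun h => by simpa using sc_neg hτ h, fun h => by simpa using sc_neg hτ h⟩
    have e2 : τ.SameCycle (-x) (-y) ↔ τ.SameCycle x y :=
      ⟨fun h => by simpa using sc_neg hτ h, fun h => by simpa using sc_neg hτ h⟩
    simp only [tf, propext e1, propext e2]; ring
  · have e1 : ¬ τ.SameCycle x y := fun h => hy ((sc_mem hτ h).1 hx)
    have e2 : ¬ τ.SameCycle (-x) y := fun h => hy ((sc_mem hτ h).1 (sz_neg hx))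
    simp [tf, indQ_neg e1, indQ_neg e2]
  · have e1 : ∀ z, τ.SameCycle z (τ y) ↔ τ.SameCycle z y := fun z => sameCycle_apply_right
    simp only [tf, propext (e1 _)]

theorem tf_self {τ : Perm ℤ} {x : ℤ} (h : ¬ τ.SameCycle x (-x)) : tf τ x x = 1 := by
  have : ¬ τ.SameCycle (-x) x := fun h2 => h h2.symm
  simp [tf, indQ_neg this, indQ_pos (SameCycle.refl τ x)]

theorem tf_one {τ : Perm ℤ} {x y : ℤ} (h : tf τ x y = 1) : τ.SameCycle x y := by
  by_contra h2
  simp only [tf, indQ_neg h2] at h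
  by_cases h3 : τ.SameCycle (-x) y
  · rw [indQ_pos h3] at h; norm_num at h
  · rw [indQ_neg h3] at h; norm_num at h

/-- the block of `x` in `omegaTilde` : same-block relation -/
theorem omega_cases {n : ℕ} {σ : Perm ℤ} (hσ : inB n σ) {B : Set ℤ} (hB : B ∈ omegaTilde n σ) :
    (∃ x ∈ signedSet n, ¬ σ.SameCycle x (-x) ∧ B = permOrbit σ x) ∨
    (∀ y, y ∈ B ↔ y ∈ signedSet n ∧ σ.SameCycle y (-y)) := by
  rcases hB with ⟨⟨x, hx, rfl⟩, h⟩ | ⟨rfl, h⟩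
  · left
    rw [Ne, negOrbit hσ] at h
    exact ⟨x, hx, h, rfl⟩
  · right
    intro y
    constructor
    · rintro ⟨A, ⟨⟨x, hx, rfl⟩, h2⟩, hy⟩
      rw [negOrbit hσ] at h2
      have hy : σ.SameCycle x y := hy
      exact ⟨(sc_mem hσ hy).1 hx, hy.symm.trans (h2.trans (sc_neg hσ hy))⟩
    · rintro ⟨hy, h2⟩
      exact ⟨permOrbit σ y, ⟨⟨y, hy, rfl⟩, (negOrbit hσ y).2 h2⟩, SameCycle.refl _ _⟩

theorem omega_zero {n : ℕ} {σ : Perm ℤ} (hσ : inB n σ) {x : ℤ} (hx : x ∈ signedSet n)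
    (h : σ.SameCycle x (-x)) : ∃ B ∈ omegaTilde n σ, ∀ y, y ∈ B ↔ y ∈ signedSet n ∧ σ.SameCycle y (-y) := by
  have h1 : (⋃₀ {A | A ∈ orbitsOn n σ ∧ negSet A = A}) ∈ omegaTilde n σ :=
    Or.inr ⟨rfl, x, permOrbit σ x, ⟨⟨x, hx, rfl⟩, (negOrbit hσ x).2 h⟩, SameCycle.refl _ _⟩
  refine ⟨_, h1, ?_⟩
  rcases omega_cases hσ h1 with ⟨y, hy, h2, h3⟩ | h2
  · exfalso
    have : y ∈ ⋃₀ {A | A ∈ orbitsOn n σ ∧ negSet A = A} := by rw [h3]; exact SameCycle.refl _ _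
    obtain ⟨A, ⟨⟨z, hz, rfl⟩, h4⟩, h5⟩ := this
    have h5 : σ.SameCycle z y := h5
    rw [orb_eq h5, negOrbit hσ] at h4
    exact h2 h4
  · exact h2

theorem omega_orb {n : ℕ} {σ : Perm ℤ} (hσ : inB n σ) {x : ℤ} (hx : x ∈ signedSet n)
    (h : ¬ σ.SameCycle x (-x)) : permOrbit σ x ∈ omegaTilde n σ :=
  Or.inl ⟨⟨x, hx, rfl⟩, by rwa [Ne, negOrbit hσ]⟩

theorem Fx_zero {n : ℕ} {τ : Perm ℤ} {f : ℤ → ℚ} (h : f ∈ Fx n τ) {x : ℤ} (hx : τ.SameCycle x (-x)) :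
    f x = 0 := by
  have h1 := Fx_sc h hx
  rw [h.1] at h1
  linarith

theorem refines_iff {n : ℕ} {τ σ : Perm ℤ} (hτ : inB n τ) (hσ : inB n σ) :
    refines (omegaTilde n τ) (omegaTilde n σ) ↔ Fx n σ ≤ Fx n τ := by
  constructor
  · intro h f hf
    refine ⟨hf.1, hf.2.1, fun x => ?_⟩
    by_cases hx : x ∈ signedSet n
    · have : ∃ A ∈ omegaTilde n τ, x ∈ A ∧ τ x ∈ A := by
        by_cases hi : τ.SameCycle x (-x)
        · obtain ⟨B, hB, h2⟩ := omega_zero hτ hx hi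
          refine ⟨B, hB, (h2 x).2 ⟨hx, hi⟩, (h2 _).2 ⟨hτ.mem.2 hx, ?_⟩⟩
          exact (sc_step τ x).symm.trans (hi.trans (sc_neg hτ (sc_step τ x)))
        · exact ⟨_, omega_orb hτ hx hi, SameCycle.refl _ _, sc_step τ x⟩
      obtain ⟨A, hA, h1, h2⟩ := this
      obtain ⟨B, hB, hAB⟩ := h A hA
      rcases omega_cases hσ hB with ⟨y, hy, h3, rfl⟩ | h3
      · have e1 : σ.SameCycle y x := hAB h1
        have e2 : σ.SameCycle y (τ x) := hAB h2
        rw [← Fx_sc hf e1, ← Fx_sc hf e2]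
      · rw [Fx_zero hf ((h3 _).1 (hAB h1)).2, Fx_zero hf ((h3 _).1 (hAB h2)).2]
    · rw [hτ.2 x hx]
  · intro h A hA
    rcases omega_cases hτ hA with ⟨x, hx, h3, rfl⟩ | h3
    · by_cases hi : σ.SameCycle x (-x)
      · obtain ⟨B, hB, h2⟩ := omega_zero hσ hx hi
        refine ⟨B, hB, fun y hy => ?_⟩
        have hy : τ.SameCycle x y := hy
        have hyX := (sc_mem hτ hy).1 hx
        rw [h2]
        refine ⟨hyX, ?_⟩
        by_contra h4
        have h5 := Fx_sc (h (tf_mem hσ hyX)) hy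
        rw [tf_self h4] at h5
        have h6 := tf_one h5
        exact h4 (h6.trans (hi.trans (sc_neg hσ h6).symm))
      · refine ⟨_, omega_orb hσ hx hi, fun y hy => ?_⟩
        have hy : τ.SameCycle x y := hy
        have h5 := Fx_sc (h (tf_mem hσ hx)) hy
        rw [tf_self hi] at h5
        exact tf_one h5.symm
    · obtain ⟨x, hx⟩ : A.Nonempty := by
        rcases hA with ⟨⟨x, hx, rfl⟩, _⟩ | ⟨_, h⟩
        · exact ⟨x, SameCycle.refl _ _⟩
        · exact h
      have key : ∀ y ∈ A, y ∈ signedSet n ∧ σ.SameCycle y (-y) := by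
        intro y hy
        have hy := (h3 y).1 hy
        refine ⟨hy.1, ?_⟩
        by_contra h4
        have h5 := Fx_zero (h (tf_mem hσ hy.1)) hy.2
        rw [tf_self h4] at h5
        norm_num at h5
      obtain ⟨B, hB, h2⟩ := omega_zero hσ (key x hx).1 (key x hx).2
      exact ⟨B, hB, fun y hy => (h2 y).2 (key y hy)⟩

/-- the operator γ-1 -/
def Tg (γ : Perm ℤ) : (ℤ → ℚ) →ₗ[ℚ] (ℤ → ℚ) where
  toFun f := fun x => f (γ⁻¹ x) - f x
  map_add' f g := by ext x; simp only [Pi.add_apply]; ring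
  map_smul' c f := by ext x; simp only [Pi.smul_apply, smul_eq_mul, RingHom.id_apply]; ring

/-- orthogonality space -/
def Wg (n : ℕ) (γ : Perm ℤ) (F : Submodule ℚ (ℤ → ℚ)) : Submodule ℚ (ℤ → ℚ) where
  carrier := {f | f ∈ Fx n 1 ∧ ∀ g ∈ F, ∑ x ∈ Finset.Icc (-n:ℤ) n, Tg γ f x * g x = 0}
  add_mem' := by
    rintro a b ⟨h1, h2⟩ ⟨h3, h4⟩
    refine ⟨add_mem h1 h3, fun g hg => ?_⟩
    simp only [map_add, Pi.add_apply, add_mul, Finset.sum_add_distrib, h2 g hg, h4 g hg, add_zero]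
  zero_mem' := ⟨zero_mem _, fun g hg => by simp⟩
  smul_mem' := by
    rintro c a ⟨h1, h2⟩
    refine ⟨Submodule.smul_mem _ _ h1, fun g hg => ?_⟩
    simp only [map_smul, Pi.smul_apply, smul_eq_mul, mul_assoc, ← Finset.mul_sum, h2 g hg, mul_zero]

theorem off_sum {n : ℕ} {x : ℤ} (h : x ∈ signedSet n) : x ∈ Finset.Icc (-n:ℤ) n := by
  have := h.2; rw [abs_le] at this; exact Finset.mem_Icc.2 this

theorem sum_perm {n : ℕ} {τ : Perm ℤ} (hτ : inB n τ) (f : ℤ → ℚ) :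
    ∑ x ∈ Finset.Icc (-n:ℤ) n, f (τ x) = ∑ x ∈ Finset.Icc (-n:ℤ) n, f x := by
  have hm : ∀ x, τ x ∈ Finset.Icc (-n:ℤ) n ↔ x ∈ Finset.Icc (-n:ℤ) n := by
    intro x
    by_cases hx : x ∈ signedSet n
    · exact ⟨fun _ => off_sum hx, fun _ => off_sum (hτ.mem.2 hx)⟩
    · rw [hτ.2 x hx]
  refine Finset.sum_bij (fun x _ => τ x) (fun x hx => (hm x).2 hx) (fun x _ y _ h => τ.injective h)
    (fun y hy => ⟨τ⁻¹ y, ?_, papply_inv τ y⟩) (fun _ _ => rfl)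
  rw [← hm, papply_inv]; exact hy

theorem Tg_mem {n : ℕ} {γ : Perm ℤ} (hγ : inB n γ) {f : ℤ → ℚ} (hf : f ∈ Fx n 1) : Tg γ f ∈ Fx n 1 := by
  refine ⟨fun x => ?_, fun x hx => ?_, fun _ => rfl⟩
  · show f (γ⁻¹ (-x)) - f (-x) = -(f (γ⁻¹ x) - f x)
    rw [hγ.inv.1, hf.1, hf.1]; ring
  · show f (γ⁻¹ x) - f x = 0
    rw [hγ.inv.2 x hx]; ring

theorem rho_W {n : ℕ} {γ τ : Perm ℤ} (hτ : inB n τ) : Fx n (τ⁻¹ * γ) ≤ Wg n γ (Fx n τ) := by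
  intro f hf
  refine ⟨Fx_le _ _ hf, fun g hg => ?_⟩
  have e : ∀ x, Tg γ f x * g x = (f (τ⁻¹ x) * g (τ⁻¹ x)) - f x * g x := by
    intro x
    have h1 : f (γ⁻¹ x) = f (τ⁻¹ x) := by
      rw [← hf.2.2 (γ⁻¹ x), Perm.mul_apply, papply_inv]
    show (f (γ⁻¹ x) - f x) * g x = _
    rw [h1, Fx_inv n τ hg]; ring
  rw [Finset.sum_congr rfl (fun x _ => e x), Finset.sum_sub_distrib,
    sum_perm hτ.inv (fun x => f x * g x), sub_self]

theorem W_dim {n : ℕ} {γ : Perm ℤ} (hγ : inB n γ) (h0 : Fx n γ = ⊥) {F : Submodule ℚ (ℤ → ℚ)}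
    (hF : F ≤ Fx n 1) : Module.finrank ℚ (Wg n γ F) + Module.finrank ℚ F ≤ n := by
  have hW : Wg n γ F ≤ Fx n 1 := fun f hf => hf.1
  let W' := (Wg n γ F).map (Tg γ)
  have hW' : W' ≤ Fx n 1 := by
    rintro _ ⟨f, hf, rfl⟩
    exact Tg_mem hγ hf.1
  have fdW := Submodule.finiteDimensional_of_le hW'
  have h1 : Module.finrank ℚ (Wg n γ F) ≤ Module.finrank ℚ W' := by
    let φ : Wg n γ F →ₗ[ℚ] W' := (Tg γ).restrict (fun f hf => ⟨f, hf, rfl⟩)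
    refine LinearMap.finrank_le_finrank_of_injective (f := φ) ?_
    rw [← LinearMap.ker_eq_bot, LinearMap.ker_eq_bot']
    intro f hf
    have h2 : Tg γ f.1 = 0 := congrArg Subtype.val hf
    have h3 : f.1 ∈ Fx n γ := by
      refine ⟨(hW f.2).1, (hW f.2).2.1, fun x => ?_⟩
      have h4 : f.1 (γ⁻¹ (γ x)) - f.1 (γ x) = 0 := congrFun h2 (γ x)
      rw [pinv_apply] at h4
      linarith
    rw [h0] at h3
    exact Subtype.ext ((Submodule.mem_bot ℚ).1 h3)
  have h2 := dim_inf n W' F hW' hF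
  have h3 : W' ⊓ F = ⊥ := by
    rw [eq_bot_iff]
    rintro _ ⟨⟨f, hf, rfl⟩, h⟩
    have h4 := hf.2 _ h
    rw [Finset.sum_eq_zero_iff_of_nonneg (fun x _ => mul_self_nonneg _)] at h4
    rw [Submodule.mem_bot]
    ext x
    by_cases hx : x ∈ signedSet n
    · exact mul_self_eq_zero.1 (h4 x (off_sum hx))
    · exact (Tg_mem hγ hf.1).2.1 x hx
  rw [h3] at h2
  simp only [finrank_bot] at h2
  omega

section BW
variable {n : ℕ} {γ : Perm ℤ}

theorem rho_eq (hγ : inB n γ) (h0 : Fx n γ = ⊥) {τ : Perm ℤ} (hτ : inB n τ)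
    (h : dm n τ + dm n (τ⁻¹ * γ) = n) : Fx n (τ⁻¹ * γ) = Wg n γ (Fx n τ) := by
  have hW : Wg n γ (Fx n τ) ≤ Fx n 1 := fun f hf => hf.1
  have fdW := Submodule.finiteDimensional_of_le hW
  have h1 := W_dim hγ h0 (Fx_le n τ)
  unfold dm at h
  exact Submodule.eq_of_le_of_finrank_le (rho_W hτ) (by omega)

theorem W_anti {F G : Submodule ℚ (ℤ → ℚ)} (h : F ≤ G) : Wg n γ G ≤ Wg n γ F :=
  fun f hf => ⟨hf.1, fun g hg => hf.2 g (h hg)⟩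

theorem rho_gam {τ : Perm ℤ} {f : ℤ → ℚ} (hf : f ∈ Fx n (τ⁻¹ * γ)) (x : ℤ) : f (γ⁻¹ x) = f (τ⁻¹ x) := by
  rw [← hf.2.2 (γ⁻¹ x), Perm.mul_apply, papply_inv]

theorem dm_bot (h0 : Fx n γ = ⊥) : dm n γ = 0 := by
  unfold dm; rw [h0]; simp

theorem inf_bot (h0 : Fx n γ = ⊥) (τ : Perm ℤ) : Fx n τ ⊓ Fx n (τ⁻¹ * γ) = ⊥ := by
  rw [eq_bot_iff, ← h0]
  have := Fx_inf n τ (τ⁻¹ * γ)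
  rwa [mul_inv_cancel_left] at this

theorem BW_le (hγ : inB n γ) (h0 : Fx n γ = ⊥) {τ σ : Perm ℤ} (hτ : inB n τ) (hσ : inB n σ)
    (h1 : dm n τ + dm n (τ⁻¹ * γ) = n) (h2 : dm n σ + dm n (σ⁻¹ * γ) = n) (h : Fx n σ ≤ Fx n τ) :
    dm n τ + dm n (τ⁻¹ * σ) = n + dm n σ := by
  have h3 : Fx n (τ⁻¹ * γ) ≤ Fx n (σ⁻¹ * γ) := by
    rw [rho_eq hγ h0 hτ h1, rho_eq hγ h0 hσ h2]; exact W_anti h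
  have h4 : Fx n σ ⊔ Fx n (τ⁻¹ * γ) ≤ Fx n (τ⁻¹ * σ) := by
    refine sup_le (fun f hf => ⟨hf.1, hf.2.1, fun x => ?_⟩) (fun f hf => ⟨hf.1, hf.2.1, fun x => ?_⟩)
    · rw [Perm.mul_apply, Fx_inv n τ (h hf), hf.2.2]
    · rw [Perm.mul_apply, ← rho_gam hf, rho_gam (h3 hf), pinv_apply]
  have h5 : Fx n σ ⊓ Fx n (τ⁻¹ * γ) = ⊥ := by
    rw [eq_bot_iff, ← inf_bot h0 σ]
    exact inf_le_inf_left _ h3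
  have h6 := Submodule.finrank_sup_add_finrank_inf_eq (Fx n σ) (Fx n (τ⁻¹ * γ))
  rw [h5, finrank_bot] at h6
  have h7 := Submodule.finrank_mono h4
  have h8 := dm_mul n τ (τ⁻¹ * σ)
  rw [mul_inv_cancel_left] at h8
  unfold dm at *
  omega

theorem BW_inj (hγ : inB n γ) (h0 : Fx n γ = ⊥) {τ σ : Perm ℤ} (hτ : inB n τ) (hσ : inB n σ)
    (h1 : dm n τ + dm n (τ⁻¹ * γ) = n) (h2 : dm n σ + dm n (σ⁻¹ * γ) = n) (h : Fx n σ = Fx n τ) :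
    σ = τ := by
  have h3 := BW_le hγ h0 hτ hσ h1 h2 h.le
  have h4 : dm n σ = dm n τ := by unfold dm; rw [h]
  have h5 : dm n (τ⁻¹ * σ) = n := by omega
  have h6 : Fx n (τ⁻¹ * σ) = Fx n 1 :=
    Submodule.eq_of_le_of_finrank_eq (Fx_le n _) (by rw [dimV]; exact h5)
  ext x
  by_cases hx : x ∈ signedSet n
  · have h3 : ev x ∈ Fx n (τ⁻¹ * σ) := by rw [h6]; exact ev_mem (inB_one n) hx rfl
    have h4 := h3.2.2 x
    rw [ev_self hx.1] at h4
    have h7 : (τ⁻¹ * σ) x = x := by by_contra h5; exact ev_ne h5 h4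
    rw [Perm.mul_apply, Perm.inv_eq_iff_eq] at h7
    exact h7
  · rw [hτ.2 x hx, hσ.2 x hx]
end BW

end

section
open Equiv Equiv.Perm
set_option linter.unusedSectionVars false
set_option linter.unusedVariables false

/-- the list of a signed cycle -/
def cycL (a b : ℕ) : List ℤ :=
  ((List.range b).map fun i : ℕ => ((a : ℤ) + (i : ℤ) + 1)) ++
      ((List.range b).map fun i : ℕ => -((a : ℤ) + (i : ℤ) + 1))

theorem cycL_len (a b : ℕ) : (cycL a b).length = b + b := by simp [cycL]

theorem cycL_nodup (a b : ℕ) : (cycL a b).Nodup := by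
  unfold cycL
  rw [List.nodup_append]
  refine ⟨?_, ?_, ?_⟩
  · refine List.Nodup.map ?_ List.nodup_range
    intro i j h
    have : (a:ℤ) + i + 1 = a + j + 1 := h
    omega
  · refine List.Nodup.map ?_ List.nodup_range
    intro i j h
    have : -((a:ℤ) + i + 1) = -(a + j + 1) := h
    omega
  · intro x hx y hy
    rw [List.mem_map] at hx hy
    obtain ⟨i, _, rfl⟩ := hx
    obtain ⟨j, _, rfl⟩ := hy
    omega

theorem cycL_lo (a b i : ℕ) (h : i < (cycL a b).length) (hi : i < b) : (cycL a b)[i] = (a:ℤ) + i + 1 := by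
  have h' : i < (((List.range b).map fun i : ℕ => ((a : ℤ) + (i : ℤ) + 1)) ++
      ((List.range b).map fun i : ℕ => -((a : ℤ) + (i : ℤ) + 1))).length := h
  show (((List.range b).map fun i : ℕ => ((a : ℤ) + (i : ℤ) + 1)) ++
      ((List.range b).map fun i : ℕ => -((a : ℤ) + (i : ℤ) + 1)))[i] = _
  rw [List.getElem_append_left (by simpa using hi)]
  simp

theorem cycL_hi (a b i : ℕ) (h : i < (cycL a b).length) (hi : b ≤ i) :
    (cycL a b)[i] = -((a:ℤ) + ((i - b : ℕ) : ℤ) + 1) := by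
  have h' : i < (((List.range b).map fun i : ℕ => ((a : ℤ) + (i : ℤ) + 1)) ++
      ((List.range b).map fun i : ℕ => -((a : ℤ) + (i : ℤ) + 1))).length := h
  show (((List.range b).map fun i : ℕ => ((a : ℤ) + (i : ℤ) + 1)) ++
      ((List.range b).map fun i : ℕ => -((a : ℤ) + (i : ℤ) + 1)))[i] = _
  rw [List.getElem_append_right (by simpa using hi)]
  simp

theorem mem_cycL (a b : ℕ) (x : ℤ) : x ∈ cycL a b ↔ (a < |x| ∧ |x| ≤ a + b) := by
  unfold cycL
  rw [List.mem_append, List.mem_map, List.mem_map]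
  constructor
  · rintro (⟨i, hi, rfl⟩ | ⟨i, hi, rfl⟩)
    · rw [List.mem_range] at hi
      rw [abs_of_pos (by omega)]; omega
    · rw [List.mem_range] at hi
      rw [abs_of_neg (by omega)]; omega
  · rintro ⟨h1, h2⟩
    rcases lt_or_ge x 0 with h | h
    · rw [abs_of_neg h] at h1 h2
      refine Or.inr ⟨(-x - a - 1).toNat, ?_, ?_⟩
      · rw [List.mem_range]; omega
      · omega
    · rw [abs_of_nonneg h] at h1 h2
      refine Or.inl ⟨(x - a - 1).toNat, ?_, ?_⟩
      · rw [List.mem_range]; omega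
      · omega

theorem cyc_step (a b : ℕ) (x : ℤ) (h1 : a < x) (h2 : x < a + b) : (cycL a b).formPerm x = x + 1 := by
  obtain ⟨i, rfl⟩ : ∃ i : ℕ, x = a + i + 1 := ⟨(x - a - 1).toNat, by omega⟩
  have hl := cycL_len a b
  have e := List.formPerm_apply_getElem _ (cycL_nodup a b) i (by omega)
  rw [cycL_lo _ _ _ _ (by omega)] at e
  rw [e]
  have : (i + 1) % (cycL a b).length = i + 1 := Nat.mod_eq_of_lt (by omega)
  simp only [this]
  rw [cycL_lo _ _ _ _ (by omega)]
  push_cast; ring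

theorem cyc_end (a b : ℕ) (hb : 1 ≤ b) : (cycL a b).formPerm (a + b) = -(a+1) := by
  have hl := cycL_len a b
  have e := List.formPerm_apply_getElem _ (cycL_nodup a b) (b-1) (by omega)
  rw [cycL_lo _ _ _ _ (by omega), show (a:ℤ) + (b - 1 : ℕ) + 1 = a + b by omega] at e
  rw [e]
  have : (b - 1 + 1) % (cycL a b).length = b := by
    rw [Nat.mod_eq_of_lt (by omega)]; omega
  simp only [this]
  rw [cycL_hi _ _ _ _ (by omega)]
  simp

theorem cyc_step' (a b : ℕ) (x : ℤ) (h1 : a < x) (h2 : x < a + b) : (cycL a b).formPerm (-x) = -x - 1 := by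
  obtain ⟨i, rfl⟩ : ∃ i : ℕ, x = a + i + 1 := ⟨(x - a - 1).toNat, by omega⟩
  have hl := cycL_len a b
  have e := List.formPerm_apply_getElem _ (cycL_nodup a b) (b + i) (by omega)
  rw [cycL_hi _ _ _ _ (by omega), show b + i - b = i by omega] at e
  rw [e]
  have : (b + i + 1) % (cycL a b).length = b + i + 1 := Nat.mod_eq_of_lt (by omega)
  simp only [this]
  rw [cycL_hi _ _ _ _ (by omega), show b + i + 1 - b = i + 1 by omega]
  push_cast; ring

theorem cyc_end' (a b : ℕ) (hb : 1 ≤ b) : (cycL a b).formPerm (-(a + b)) = a+1 := by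
  have hl := cycL_len a b
  have e := List.formPerm_apply_getElem _ (cycL_nodup a b) (b + b-1) (by omega)
  rw [cycL_hi _ _ _ _ (by omega), show b + b - 1 - b = b - 1 by omega,
    show (a:ℤ) + (b - 1 : ℕ) + 1 = a + b by omega] at e
  rw [e]
  have : (b + b - 1 + 1) % (cycL a b).length = 0 := by
    rw [hl, show b + b - 1 + 1 = b + b by omega, Nat.mod_self]
  simp only [this]
  rw [cycL_lo _ _ _ _ (by omega)]
  simp

theorem cyc_fix (a b : ℕ) (x : ℤ) (h : ¬ (a < |x| ∧ |x| ≤ a + b)) : (cycL a b).formPerm x = x :=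
  List.formPerm_apply_of_notMem (by rwa [mem_cycL])

theorem gam_def (p q : ℕ) : gammaPQ p q = (cycL 0 p).formPerm * (cycL p q).formPerm := by
  have e : ∀ b : ℕ, (List.flatMap (fun a : ℕ => [(a:ℤ)]) (List.range b)) = (List.range b).map (fun a : ℕ => (a:ℤ)) :=
    fun b => List.flatMap_pure_eq_map _ _
  unfold gammaPQ cycL
  simp [e, Function.comp_def]

theorem cyc_odd (a b : ℕ) (x : ℤ) : (cycL a b).formPerm (-x) = -((cycL a b).formPerm x) := by
  have key : ∀ x : ℤ, 0 ≤ x → (cycL a b).formPerm (-x) = -((cycL a b).formPerm x) := by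
    intro x hx
    by_cases h : a < |x| ∧ |x| ≤ a + b
    · rw [abs_of_nonneg hx] at h
      by_cases h2 : x = a + b
      · subst h2
        rw [cyc_end a b (by omega), cyc_end' a b (by omega)]; ring
      · rw [cyc_step a b x h.1 (by omega), cyc_step' a b x h.1 (by omega)]; ring
    · rw [cyc_fix _ _ _ h, cyc_fix _ _ (-x) (by rwa [abs_neg])]
  rcases le_total 0 x with h | h
  · exact key x h
  · have := key (-x) (by omega)
    rw [neg_neg] at this
    rw [this, neg_neg]

theorem cyc_mem (a b : ℕ) (x : ℤ) : (a < |(cycL a b).formPerm x| ∧ |(cycL a b).formPerm x| ≤ a + b) ↔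
    (a < |x| ∧ |x| ≤ a + b) := by
  constructor
  · intro h
    by_contra h2
    rw [cyc_fix _ _ _ h2] at h; exact h2 h
  · intro h
    by_contra h2
    have := (cycL a b).formPerm.injective (cyc_fix _ _ _ h2)
    rw [this] at h2; exact h2 h

section
variable {p q : ℕ} (hp : 1 ≤ p) (hq : 1 ≤ q)

theorem gam_out {x : ℤ} (h : |x| ≤ p) : gammaPQ p q x = (cycL 0 p).formPerm x := by
  rw [gam_def, Perm.mul_apply, cyc_fix p q x (by omega)]

theorem gam_in {x : ℤ} (h : p < |x|) : gammaPQ p q x = (cycL p q).formPerm x := by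
  rw [gam_def, Perm.mul_apply, cyc_fix 0 p]
  by_cases h2 : |x| ≤ p + q
  · have := (cyc_mem p q x).2 ⟨h, h2⟩
    push_cast; omega
  · rw [cyc_fix p q x (by omega)]; push_cast; omega

theorem gam_o (x : ℤ) : |gammaPQ p q x| ≤ p ↔ |x| ≤ p := by
  by_cases h : |x| ≤ p
  · rw [gam_out h]
    by_cases h2 : x = 0
    · subst h2; rw [cyc_fix _ _ _ (by simp)]
    · have h3 := abs_pos.2 h2
      have := (cyc_mem 0 p x).2 (by push_cast; omega)
      push_cast at this
      omega
  · rw [gam_in (by omega)]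
    by_cases h2 : |x| ≤ p + q
    · have := (cyc_mem p q x).2 ⟨by omega, h2⟩
      omega
    · rw [cyc_fix p q x (by omega)]

theorem gam_inB : inB (p + q) (gammaPQ p q) := by
  refine ⟨fun x => ?_, fun x hx => ?_⟩
  · rw [gam_def, Perm.mul_apply, cyc_odd, cyc_odd]; rfl
  · have h : x = 0 ∨ (p:ℤ) + q < |x| := by
      by_contra h
      push Not at h
      exact hx ⟨h.1, by push_cast; omega⟩
    rcases h with h | h
    · subst h
      rw [gam_out (by simp), cyc_fix _ _ _ (by simp)]
    · rw [gam_in (by omega), cyc_fix _ _ _ (by omega)]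

theorem gam_step {x : ℤ} (h1 : 1 ≤ x) (h2 : x < p + q) (h3 : x ≠ p) : gammaPQ p q x = x + 1 := by
  rcases lt_or_gt_of_ne h3 with h | h
  · rw [gam_out (by rw [abs_of_pos (by omega)]; omega), cyc_step 0 p x (by push_cast; omega) (by push_cast; omega)]
  · rw [gam_in (by rw [abs_of_pos (by omega)]; omega), cyc_step p q x (by omega) (by omega)]

theorem gam_endo (hp : 1 ≤ p) : gammaPQ p q p = -1 := by
  rw [gam_out (by rw [abs_of_pos (by omega)])]
  have := cyc_end 0 p hp
  simpa using this

theorem gam_endi (hq : 1 ≤ q) : gammaPQ p q (p + q) = -(p+1) := by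
  rw [gam_in (by rw [abs_of_pos (by omega)]; omega), cyc_end p q hq]

/-- positions on outer/inner circle reached from base -/
theorem gam_sc_pos {a b : ℤ} (ha : 1 ≤ a) (hab : ∀ x, a ≤ x → x < b → gammaPQ p q x = x + 1) (k : ℕ) :
    a + k ≤ b → (gammaPQ p q).SameCycle a (a + k) := by
  induction k with
  | zero => intro _; rw [Nat.cast_zero, add_zero]
  | succ k ih =>
    intro h
    push_cast at h
    have h1 := ih (by omega)
    have h2 := hab (a + k) (by omega) (by omega)
    have h3 := sc_step (gammaPQ p q) (a + k)
    rw [h2] at h3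
    have := h1.trans h3
    push_cast
    rwa [← add_assoc]

theorem gam_sc_o (hp : 1 ≤ p) {x : ℤ} (h0 : x ≠ 0) (h : |x| ≤ p) : (gammaPQ p q).SameCycle 1 x := by
  have hpos : ∀ x : ℤ, 1 ≤ x → x ≤ p → (gammaPQ p q).SameCycle 1 x := by
    intro x h1 h2
    have := gam_sc_pos (p := p) (q := q) (a := 1) (b := p) le_rfl
      (fun x h1 h2 => gam_step h1 (by omega) (by omega)) (x - 1).toNat (by omega)
    rwa [show (1:ℤ) + ((x - 1).toNat : ℤ) = x by omega] at this
  have hneg : (gammaPQ p q).SameCycle 1 (-1) := by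
    have h3 := sc_step (gammaPQ p q) p
    rw [gam_endo hp] at h3
    exact (hpos p (by omega) le_rfl).trans h3
  rw [abs_le] at h
  rcases lt_or_gt_of_ne h0 with h' | h'
  · have := sc_neg gam_inB (hpos (-x) (by omega) (by omega))
    rw [neg_neg] at this
    exact hneg.trans this
  · exact hpos x (by omega) h.2

theorem gam_sc_i (hq : 1 ≤ q) {x : ℤ} (h1 : p < |x|) (h : |x| ≤ p + q) :
    (gammaPQ p q).SameCycle (p + 1) x := by
  have hpos : ∀ x : ℤ, (p:ℤ) + 1 ≤ x → x ≤ p + q → (gammaPQ p q).SameCycle (p + 1) x := by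
    intro x h1 h2
    have := gam_sc_pos (p := p) (q := q) (a := p + 1) (b := p + q) (by omega)
      (fun x h1 h2 => gam_step (by omega) (by omega) (by omega)) (x - (p + 1)).toNat (by omega)
    rwa [show (p + 1:ℤ) + ((x - (p + 1)).toNat : ℤ) = x by omega] at this
  have hneg : (gammaPQ p q).SameCycle (p + 1) (-(p + 1)) := by
    have h3 := sc_step (gammaPQ p q) (p + q)
    rw [gam_endi hq] at h3
    exact (hpos (p + q) (by omega) le_rfl).trans h3
  rcases lt_or_ge x 0 with h' | h'
  · rw [abs_of_neg h'] at h1 h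
    have := sc_neg gam_inB (hpos (-x) (by omega) (by omega))
    rw [neg_neg] at this
    exact hneg.trans this
  · rw [abs_of_nonneg h'] at h1 h
    exact hpos x (by omega) h

theorem gam_bot (hp : 1 ≤ p) (hq : 1 ≤ q) : Fx (p + q) (gammaPQ p q) = ⊥ := by
  rw [eq_bot_iff]
  intro f hf
  rw [Submodule.mem_bot]
  ext x
  by_cases hx : x ∈ signedSet (p + q)
  · have h2 := hx.2
    push_cast at h2
    apply Fx_zero hf
    by_cases h : |x| ≤ p
    · exact (gam_sc_o hp hx.1 h).symm.trans (gam_sc_o hp (neg_ne_zero.2 hx.1) (by rwa [abs_neg]))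
    · exact (gam_sc_i hq (by omega) h2).symm.trans (gam_sc_i hq (by rw [abs_neg]; omega) (by rwa [abs_neg]))
  · exact hf.2.1 x hx
end

end

section
open Equiv Equiv.Perm
set_option linter.unusedSectionVars false
set_option linter.unusedVariables false

/-- the signed set as a finset -/
noncomputable def Xf (n : ℕ) : Finset ℤ := (Finset.Icc (-n:ℤ) n).erase 0

theorem mem_Xf {n : ℕ} {x : ℤ} : x ∈ Xf n ↔ x ∈ signedSet n := by
  unfold Xf signedSet
  rw [Finset.mem_erase, Finset.mem_Icc, Set.mem_ofPred_eq, abs_le]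

theorem card_Xf (n : ℕ) : (Xf n).card = 2 * n := by
  unfold Xf
  rw [Finset.card_erase_of_mem (by rw [Finset.mem_Icc]; omega), Int.card_Icc]
  omega

theorem exists_tr {α : Type*} [DecidableEq α] (C : Finset α) (f : Perm α) (hf : ∀ x ∉ C, f x = x) :
    ∃ R, Tr C f R := by
  classical
  let rep : α → α := fun x => Quotient.out (Quotient.mk (SameCycle.setoid f) x)
  have hrep : ∀ x, f.SameCycle (rep x) x := fun x => Quotient.exact (Quotient.out_eq (Quotient.mk (SameCycle.setoid f) x))
  have hrep2 : ∀ x y, f.SameCycle x y → rep x = rep y := fun x y h =>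
    congrArg Quotient.out (Quotient.sound (s := SameCycle.setoid f) h)
  have hC : ∀ x y, f.SameCycle x y → (x ∈ C ↔ y ∈ C) := fun x y h =>
    sc_inv (P := fun z => z ∈ C) (fun z => mem_of_fix hf) h
  refine ⟨C.image rep, ?_, ?_⟩
  · intro y hy
    obtain ⟨x, hx, rfl⟩ := Finset.mem_image.1 hy
    exact (hC _ _ (hrep x)).2 hx
  · intro x hx
    refine ⟨rep x, ⟨Finset.mem_image_of_mem _ hx, (hrep x).symm⟩, ?_⟩
    rintro y ⟨hy, hxy⟩
    obtain ⟨z, hz, rfl⟩ := Finset.mem_image.1 hy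
    exact (hrep2 _ _ (hxy.trans (hrep z))).symm

theorem tr_dm {n : ℕ} {τ : Perm ℤ} {R : Finset ℤ} (hτ : inB n τ) (hR : Tr (Xf n) τ R) :
    2 * dm n τ ≤ R.card ∧ ((∀ x ∈ Xf n, ¬ τ.SameCycle x (-x)) → R.card ≤ 2 * dm n τ) := by
  have hneg : ∀ x ∈ Xf n, -x ∈ Xf n := fun x hx => mem_Xf.2 (sz_neg (mem_Xf.1 hx))
  have h1 : ∀ y : ℤ, ∃ z, y ∈ R → z ∈ R ∧ τ.SameCycle (-y) z := by
    intro y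
    by_cases hy : y ∈ R
    · obtain ⟨z, hz, _⟩ := hR.2 (-y) (hneg y (hR.1 hy))
      exact ⟨z, fun _ => hz⟩
    · exact ⟨0, fun h => absurd h hy⟩
  choose r hr using h1
  have uniq : ∀ y ∈ R, ∀ z ∈ R, τ.SameCycle y z → y = z := by
    intro y hy z hz h
    exact (hR.2 y (hR.1 hy)).unique ⟨hy, SameCycle.refl _ _⟩ ⟨hz, h⟩
  have rr : ∀ y ∈ R, r (r y) = y := by
    intro y hy
    have a := hr y hy
    have b := hr (r y) a.1
    have c := sc_neg hτ a.2
    rw [neg_neg] at c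
    exact (uniq y hy _ b.1 (c.trans b.2)).symm
  let P := R.filter (fun y => y < r y)
  let Q := R.filter (fun y => r y < y)
  have hPR : P ⊆ R := Finset.filter_subset _ _
  have hPQ : Disjoint P Q := by
    rw [Finset.disjoint_left]
    intro y hy hy'
    have := (Finset.mem_filter.1 hy).2
    have := (Finset.mem_filter.1 hy').2
    omega
  have hcard : P.card = Q.card := by
    refine Finset.card_bij (fun y _ => r y) ?_ ?_ ?_
    · intro y hy
      obtain ⟨a, b⟩ := Finset.mem_filter.1 hy
      exact Finset.mem_filter.2 ⟨(hr y a).1, by rw [rr y a]; exact b⟩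
    · intro y hy z hz h
      have := congrArg r h
      rwa [rr y (hPR hy), rr z (hPR hz)] at this
    · intro y hy
      obtain ⟨a, b⟩ := Finset.mem_filter.1 hy
      exact ⟨r y, Finset.mem_filter.2 ⟨(hr y a).1, by rw [rr y a]; exact b⟩, rr y a⟩
  have hsub : P ∪ Q ⊆ R := Finset.union_subset hPR (Finset.filter_subset _ _)
  have hcu := Finset.card_union_of_disjoint hPQ
  constructor
  · have h2 := Finset.card_le_card hsub
    have h3 : dm n τ ≤ P.card := by
      refine (dim_le _ P ?_).2
      intro f hf h0
      have h4 : ∀ y ∈ R, f y = 0 := by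
        intro y hy
        have a := hr y hy
        rcases lt_trichotomy y (r y) with h | h | h
        · exact h0 y (Finset.mem_filter.2 ⟨hy, h⟩)
        · rw [← h] at a
          exact Fx_zero hf a.2.symm
        · have h5 := h0 (r y) (Finset.mem_filter.2 ⟨a.1, by rw [rr y hy]; exact h⟩)
          rw [← Fx_sc hf a.2, hf.1] at h5
          linarith
      ext x
      by_cases hx : x ∈ signedSet n
      · obtain ⟨y, ⟨hy, hxy⟩, _⟩ := hR.2 x (mem_Xf.2 hx)
        rw [Fx_sc hf hxy, h4 y hy]; rfl
      · exact hf.2.1 x hx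
    omega
  · intro hno
    have h2 : R ⊆ P ∪ Q := by
      intro y hy
      rcases lt_trichotomy y (r y) with h | h | h
      · exact Finset.mem_union_left _ (Finset.mem_filter.2 ⟨hy, h⟩)
      · exfalso
        have a := (hr y hy).2
        rw [← h] at a
        exact hno y (hR.1 hy) a.symm
      · exact Finset.mem_union_right _ (Finset.mem_filter.2 ⟨hy, h⟩)
    have h3 : P.card ≤ dm n τ := by
      refine le_dim (Fx n τ) P (tf τ) (fun y hy => tf_mem hτ (mem_Xf.1 (hR.1 (hPR hy)))) ?_
      intro y hy z hz
      obtain ⟨a, b⟩ := Finset.mem_filter.1 hy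
      obtain ⟨a', b'⟩ := Finset.mem_filter.1 hz
      by_cases hyz : y = z
      · subst hyz
        rw [if_pos rfl, tf_self (hno y (hR.1 a))]
      · rw [if_neg hyz]
        have e1 : ¬ τ.SameCycle y z := fun h => hyz (uniq y a z a' h)
        have e2 : ¬ τ.SameCycle (-y) z := by
          intro h
          have e3 := hr y a
          have e4 := uniq z a' (r y) e3.1 (h.symm.trans e3.2)
          rw [e4, rr y a] at b'
          omega
        simp [tf, indQ_neg e1, indQ_neg e2]
    have h4 := Finset.card_le_card h2
    omega

end

section
open Equiv Equiv.Perm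
set_option linter.unusedSectionVars false
set_option linter.unusedVariables false

/-- rotation of `range m` -/
def rotN (m : ℕ) : Perm ℕ := (List.range m).formPerm

theorem rotN_lt {m i : ℕ} (h : i + 1 < m) : rotN m i = i + 1 := by
  have := List.formPerm_apply_getElem (List.range m) List.nodup_range i (by simp; omega)
  simp only [List.getElem_range, List.length_range] at this
  rw [Nat.mod_eq_of_lt h] at this
  exact this

theorem rotN_end {m i : ℕ} (h : i + 1 = m) : rotN m i = 0 := by
  have := List.formPerm_apply_getElem (List.range m) List.nodup_range i (by simp; omega)
  simp only [List.getElem_range, List.length_range] at this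
  rw [h, Nat.mod_self] at this
  exact this

theorem rotN_ge {m i : ℕ} (h : m ≤ i) : rotN m i = i :=
  List.formPerm_apply_of_notMem (by simpa using h)

/-- fibrewise permutation -/
def fib (g : ℕ → Perm ℤ) : Perm (ℤ × ℕ) where
  toFun z := (g z.2 z.1, z.2)
  invFun z := ((g z.2)⁻¹ z.1, z.2)
  left_inv z := by simp
  right_inv z := by simp

theorem fib_apply (g : ℕ → Perm ℤ) (x : ℤ) (i : ℕ) : fib g (x, i) = (g i x, i) := rfl
theorem fib_inv_apply (g : ℕ → Perm ℤ) (x : ℤ) (i : ℕ) : (fib g)⁻¹ (x, i) = ((g i)⁻¹ x, i) := rfl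

/-- shear permutation -/
def shr (r : ℤ → Perm ℕ) : Perm (ℤ × ℕ) where
  toFun z := (z.1, r z.1 z.2)
  invFun z := (z.1, (r z.1)⁻¹ z.2)
  left_inv z := by simp
  right_inv z := by simp

open Classical in
/-- the big rotation -/
noncomputable def SS (n m : ℕ) (γ : Perm ℤ) : Perm (ℤ × ℕ) :=
  fib (fun i => if i = 0 then γ else 1) * shr (fun x => if x ∈ Xf n then rotN m else 1)

/-- the big set -/
noncomputable def Cm (n m : ℕ) : Finset (ℤ × ℕ) := Xf n ×ˢ Finset.range m

theorem mem_Cm {n m : ℕ} {x : ℤ} {i : ℕ} : (x, i) ∈ Cm n m ↔ x ∈ Xf n ∧ i < m := by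
  unfold Cm; rw [Finset.mem_product, Finset.mem_range]

theorem card_Cm (n m : ℕ) : (Cm n m).card = 2 * n * m := by
  unfold Cm; rw [Finset.card_product, card_Xf, Finset.card_range]

theorem SS_lt {n m : ℕ} {γ : Perm ℤ} {x : ℤ} {i : ℕ} (hx : x ∈ Xf n) (hi : i + 1 < m) :
    SS n m γ (x, i) = (x, i + 1) := by
  show ((if (if x ∈ Xf n then rotN m else 1) i = 0 then γ else 1) x, (if x ∈ Xf n then rotN m else 1) i) = _
  rw [if_pos hx, rotN_lt hi, if_neg (by omega)]; rfl

theorem SS_end {n m : ℕ} {γ : Perm ℤ} {x : ℤ} {i : ℕ} (hx : x ∈ Xf n) (hi : i + 1 = m) :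
    SS n m γ (x, i) = (γ x, 0) := by
  show ((if (if x ∈ Xf n then rotN m else 1) i = 0 then γ else 1) x, (if x ∈ Xf n then rotN m else 1) i) = _
  rw [if_pos hx, rotN_end hi, if_pos rfl]

theorem SS_out {n m : ℕ} (hm : 1 ≤ m) {γ : Perm ℤ} (hγ : inB n γ) {z : ℤ × ℕ} (hz : z ∉ Cm n m) : SS n m γ z = z := by
  obtain ⟨x, i⟩ := z
  rw [mem_Cm] at hz
  show ((if (if x ∈ Xf n then rotN m else 1) i = 0 then γ else 1) x, (if x ∈ Xf n then rotN m else 1) i) = _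
  by_cases hx : x ∈ Xf n
  · have hi : m ≤ i := by by_contra h; exact hz ⟨hx, by omega⟩
    rw [if_pos hx, rotN_ge hi, if_neg (by omega)]; rfl
  · rw [if_neg hx, Perm.one_apply]
    split_ifs with h
    · rw [hγ.2 x (fun h => hx (mem_Xf.2 h))]
    · rfl

/-- outer/inner marker -/
def om (p : ℕ) : ℤ × ℕ → Bool := fun z => decide (|z.1| ≤ p)

theorem om_true {p : ℕ} {z : ℤ × ℕ} : om p z = true ↔ |z.1| ≤ p := by simp [om]
theorem om_eq {p : ℕ} {z w : ℤ × ℕ} : om p z = om p w ↔ (|z.1| ≤ p ↔ |w.1| ≤ p) := by simp [om]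

theorem SS_sc0 {n m : ℕ} {γ : Perm ℤ} {x : ℤ} (hx : x ∈ Xf n) (i : ℕ) : i < m →
    (SS n m γ).SameCycle (x, 0) (x, i) := by
  induction i with
  | zero => intro _; exact SameCycle.refl _ _
  | succ i ih =>
    intro h
    have h1 := sc_step (SS n m γ) (x, i)
    rw [SS_lt hx h] at h1
    exact (ih (by omega)).trans h1

theorem SS_scγ {n m : ℕ} (hm : 1 ≤ m) {γ : Perm ℤ} (hγ : inB n γ) {x y : ℤ} (hx : x ∈ Xf n) (h : γ.SameCycle x y) :
    (SS n m γ).SameCycle (x, 0) (y, 0) := by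
  have hX : ∀ z, γ z ∈ Xf n ↔ z ∈ Xf n := fun z => by rw [mem_Xf, mem_Xf]; exact hγ.mem
  have key : ∀ z ∈ Xf n, (SS n m γ).SameCycle (z, 0) (γ z, 0) := by
    intro z hz
    have h1 := sc_step (SS n m γ) (z, m - 1)
    rw [SS_end hz (by omega)] at h1
    exact (SS_sc0 hz (m-1) (by omega)).trans h1
  have := (sc_inv (P := fun z => z ∈ Xf n ∧ (SS n m γ).SameCycle (x, 0) (z, 0)) (fun z => ?_) h).1
    ⟨hx, SameCycle.refl _ _⟩
  · exact this.2
  · show γ z ∈ Xf n ∧ (SS n m γ).SameCycle (x, 0) (γ z, 0) ↔ z ∈ Xf n ∧ (SS n m γ).SameCycle (x, 0) (z, 0)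
    rw [hX]
    exact ⟨fun h => ⟨h.1, h.2.trans (key z h.1).symm⟩, fun h => ⟨h.1, h.2.trans (key z h.1)⟩⟩

theorem SS_ann {p q m : ℕ} (hp : 1 ≤ p) (hq : 1 ≤ q) (hm : 1 ≤ m) :
    Ann (Cm (p+q) m) (om p) (SS (p+q) m (gammaPQ p q)) := by
  refine ⟨fun z hz => SS_out hm gam_inB hz, ?_, ?_⟩
  · rintro ⟨x, i⟩
    by_cases hz : (x, i) ∈ Cm (p+q) m
    · rw [mem_Cm] at hz
      by_cases hi : i + 1 = m
      · rw [SS_end hz.1 hi, om_eq]; exact gam_o x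
      · rw [SS_lt hz.1 (by omega), om_eq]
    · rw [SS_out hm gam_inB hz]
  · rintro ⟨x, i⟩ hx ⟨y, j⟩ hy h
    rw [mem_Cm] at hx hy
    rw [om_eq] at h
    refine (SS_sc0 hx.1 i hx.2).symm.trans (SameCycle.trans (SS_scγ hm gam_inB hx.1 ?_) (SS_sc0 hy.1 j hy.2))
    have h1 := mem_Xf.1 hx.1
    have h2 := mem_Xf.1 hy.1
    have h3 := h1.2
    have h4 := h2.2
    push_cast at h3 h4
    simp only at h
    by_cases h5 : |x| ≤ p
    · exact (gam_sc_o hp h1.1 h5).symm.trans (gam_sc_o hp h2.1 (h.1 h5))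
    · have h6 : ¬ |y| ≤ p := fun h7 => h5 (h.2 h7)
      exact (gam_sc_i hq (by omega) h3).symm.trans (gam_sc_i hq (by omega) h4)

theorem fib_sc {g : ℕ → Perm ℤ} {x y : ℤ} {i j : ℕ} :
    (fib g).SameCycle (x, i) (y, j) ↔ i = j ∧ (g i).SameCycle x y := by
  constructor
  · intro h
    have h1 : i = j := sc_inv' (F := Prod.snd) (fun z => rfl) h
    refine ⟨h1, ?_⟩
    subst h1
    have := (sc_inv (P := fun z : ℤ × ℕ => z.2 = i ∧ (g i).SameCycle x z.1) (fun z => ?_) h).1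
      ⟨rfl, SameCycle.refl _ _⟩
    · exact this.2
    · obtain ⟨z, k⟩ := z
      show k = i ∧ (g i).SameCycle x (g k z) ↔ k = i ∧ (g i).SameCycle x z
      constructor
      · rintro ⟨rfl, h⟩; exact ⟨rfl, h.trans (sc_step _ _).symm⟩
      · rintro ⟨rfl, h⟩; exact ⟨rfl, h.trans (sc_step _ _)⟩
  · rintro ⟨rfl, h⟩
    refine (sc_inv (P := fun z => (fib g).SameCycle (x, i) (z, i)) (fun z => ?_) h).1 (SameCycle.refl _ _)
    have h2 := sc_step (fib g) (z, i)
    exact ⟨fun h => h.trans h2.symm, fun h => h.trans h2⟩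

/-- slice -/
noncomputable def slc (E : Finset (ℤ × ℕ)) (i : ℕ) : Finset ℤ := (E.filter (fun z => z.2 = i)).image Prod.fst

theorem mem_slc {E : Finset (ℤ × ℕ)} {i : ℕ} {x : ℤ} : x ∈ slc E i ↔ (x, i) ∈ E := by
  unfold slc
  rw [Finset.mem_image]
  constructor
  · rintro ⟨⟨y, j⟩, h, rfl⟩
    rw [Finset.mem_filter] at h
    obtain ⟨h, rfl⟩ := h
    exact h
  · intro h
    exact ⟨(x, i), Finset.mem_filter.2 ⟨h, rfl⟩, rfl⟩

theorem card_slc {E : Finset (ℤ × ℕ)} {m : ℕ} (h : ∀ z ∈ E, z.2 < m) :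
    E.card = ∑ i ∈ Finset.range m, (slc E i).card := by
  rw [Finset.card_eq_sum_card_fiberwise (f := Prod.snd) (t := Finset.range m)
    (fun z hz => Finset.mem_coe.2 (Finset.mem_range.2 (h z hz)))]
  refine Finset.sum_congr rfl fun i _ => ?_
  unfold slc
  rw [Finset.card_image_of_injOn]
  intro z hz w hw hzw
  have h1 := (Finset.mem_filter.1 (Finset.mem_coe.1 hz)).2
  have h2 := (Finset.mem_filter.1 (Finset.mem_coe.1 hw)).2
  exact Prod.ext hzw (h1.trans h2.symm)

theorem tr_slc {n m : ℕ} {g : ℕ → Perm ℤ} {R : Finset (ℤ × ℕ)} (h : Tr (Cm n m) (fib g) R) {i : ℕ} (hi : i < m) :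
    Tr (Xf n) (g i) (slc R i) := by
  refine ⟨fun x hx => (mem_Cm.1 (h.1 (mem_slc.1 hx))).1, fun x hx => ?_⟩
  obtain ⟨⟨y, j⟩, ⟨hy, hxy⟩, hu⟩ := h.2 (x, i) (mem_Cm.2 ⟨hx, hi⟩)
  rw [fib_sc] at hxy
  obtain ⟨rfl, hxy⟩ := hxy
  refine ⟨y, ⟨mem_slc.2 hy, hxy⟩, ?_⟩
  rintro z ⟨hz, hxz⟩
  have := hu (z, i) ⟨mem_slc.1 hz, fib_sc.2 ⟨rfl, hxz⟩⟩
  exact congrArg Prod.fst this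

theorem tr_fib {n m : ℕ} {g : ℕ → Perm ℤ} {R : ℕ → Finset ℤ} (h : ∀ i < m, Tr (Xf n) (g i) (R i)) :
    ∃ R' : Finset (ℤ × ℕ), Tr (Cm n m) (fib g) R' ∧ R'.card = ∑ i ∈ Finset.range m, (R i).card := by
  let R' := (Cm n m).filter (fun z => z.1 ∈ R z.2)
  have hm : ∀ x i, (x, i) ∈ R' ↔ i < m ∧ x ∈ R i := by
    intro x i
    rw [Finset.mem_filter, mem_Cm]
    exact ⟨fun h => ⟨h.1.2, h.2⟩, fun h' => ⟨⟨(h i h'.1).1 h'.2, h'.1⟩, h'.2⟩⟩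
  refine ⟨R', ⟨Finset.filter_subset _ _, ?_⟩, ?_⟩
  · rintro ⟨x, i⟩ hx
    rw [mem_Cm] at hx
    obtain ⟨y, ⟨hy, hxy⟩, hu⟩ := (h i hx.2).2 x hx.1
    refine ⟨(y, i), ⟨(hm _ _).2 ⟨hx.2, hy⟩, fib_sc.2 ⟨rfl, hxy⟩⟩, ?_⟩
    rintro ⟨z, j⟩ ⟨hz, hxz⟩
    rw [fib_sc] at hxz
    obtain ⟨rfl, hxz⟩ := hxz
    rw [hu z ⟨((hm _ _).1 hz).2, hxz⟩]
  · rw [card_slc (m := m) (fun z hz => ((hm z.1 z.2).1 hz).1)]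
    refine Finset.sum_congr rfl fun i hi => ?_
    congr 1
    ext x
    rw [mem_slc, hm]
    exact ⟨fun h => h.2, fun h => ⟨Finset.mem_range.1 hi, h⟩⟩

/-- negation on the big set -/
def epsN : Perm (ℤ × ℕ) where
  toFun z := (-z.1, z.2)
  invFun z := (-z.1, z.2)
  left_inv z := by simp
  right_inv z := by simp

theorem eps_apply (x : ℤ) (i : ℕ) : epsN (x, i) = (-x, i) := rfl
theorem eps_inv : epsN⁻¹ = epsN := rfl
theorem eps_eps (z : ℤ × ℕ) : epsN (epsN z) = z := by
  obtain ⟨x, i⟩ := z; rw [eps_apply, eps_apply, neg_neg]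

theorem eps_C {n m : ℕ} {z : ℤ × ℕ} : epsN z ∈ Cm n m ↔ z ∈ Cm n m := by
  obtain ⟨x, i⟩ := z
  rw [eps_apply, mem_Cm, mem_Cm, mem_Xf, mem_Xf]
  exact ⟨fun h => ⟨by simpa using sz_neg h.1, h.2⟩, fun h => ⟨sz_neg h.1, h.2⟩⟩

theorem eps_o {p : ℕ} (z : ℤ × ℕ) : om p (epsN z) = om p z := by
  obtain ⟨x, i⟩ := z
  rw [eps_apply, om_eq, abs_neg]

theorem eps_S {n m : ℕ} (hm : 1 ≤ m) {γ : Perm ℤ} (hγ : inB n γ) (z : ℤ × ℕ) :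
    SS n m γ (epsN z) = epsN (SS n m γ z) := by
  by_cases hz : z ∈ Cm n m
  · have hz' := eps_C.2 hz
    obtain ⟨x, i⟩ := z
    rw [eps_apply] at *
    rw [mem_Cm] at hz hz'
    by_cases hi : i + 1 = m
    · rw [SS_end hz.1 hi, SS_end hz'.1 hi, eps_apply, hγ.1]
    · rw [SS_lt hz.1 (by omega), SS_lt hz'.1 (by omega), eps_apply]
  · rw [SS_out hm hγ hz, SS_out hm hγ (fun h => hz (eps_C.1 h))]

theorem tr_conj {α : Type*} [DecidableEq α] {C R : Finset α} {f e : Perm α} (he : ∀ z, e z ∈ C ↔ z ∈ C)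
    (h : Tr C f R) : Tr C (e * f * e⁻¹) (R.image e) := by
  have he' : ∀ z, e⁻¹ z ∈ C ↔ z ∈ C := fun z => by rw [← he, papply_inv]
  refine ⟨?_, fun x hx => ?_⟩
  · intro y hy
    obtain ⟨x, hx, rfl⟩ := Finset.mem_image.1 hy
    exact (he x).2 (h.1 hx)
  · obtain ⟨y, ⟨hy, hxy⟩, hu⟩ := h.2 (e⁻¹ x) ((he' x).2 hx)
    refine ⟨e y, ⟨Finset.mem_image_of_mem _ hy, ?_⟩, ?_⟩
    · rw [sameCycle_conj, pinv_apply]; exact hxy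
    · rintro z ⟨hz, hxz⟩
      obtain ⟨w, hw, rfl⟩ := Finset.mem_image.1 hz
      rw [sameCycle_conj, pinv_apply] at hxz
      rw [hu w ⟨hw, hxz⟩]

theorem good_conj {α : Type*} [DecidableEq α] {C D : Finset α} {o : α → Bool} {S ν e : Perm α} (he : ∀ z, e z ∈ C ↔ z ∈ C)
    (ho : ∀ z, o (e z) = o z) (hS : e * S * e⁻¹ = S)
    (h : Good C D o S ν) : Good C (D.image e) o S (e * ν * e⁻¹) := by
  have he' : ∀ z, e⁻¹ z ∈ C ↔ z ∈ C := fun z => by rw [← he, papply_inv]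
  have hψ : S * (e * ν * e⁻¹)⁻¹ = e * (S * ν⁻¹) * e⁻¹ := by
    conv_lhs => rw [← hS]
    group
  have himg : C.image e = C := by
    ext z
    rw [Finset.mem_image]
    constructor
    · rintro ⟨w, hw, rfl⟩; exact (he w).2 hw
    · intro hz; exact ⟨e⁻¹ z, (he' z).2 hz, papply_inv e z⟩
  refine ⟨?_, ?_, ?_, ?_, ?_⟩
  · intro y hy
    obtain ⟨x, hx, rfl⟩ := Finset.mem_image.1 hy
    exact (he x).2 (h.DC hx)
  · intro x hx
    rw [Perm.mul_apply, Perm.mul_apply, h.fix _ (fun h' => hx ((he' x).1 h')), papply_inv]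
  · have := tr_conj he h.trν
    rwa [Finset.image_sdiff _ _ e.injective, himg] at this
  · rw [hψ]; exact tr_conj he h.trψ
  · intro u hu hou x hx hux
    obtain ⟨w, hw, rfl⟩ := Finset.mem_image.1 hu
    rw [hψ, sameCycle_conj, pinv_apply] at hux
    have := h.star w hw (by rw [← ho]; exact hou) (e⁻¹ x) ((he' x).2 hx) hux
    rw [← ho, papply_inv] at this
    exact this

end

section
open Equiv Equiv.Perm
set_option linter.unusedSectionVars false
set_option linter.unusedVariables false

/-- the fibrewise increments -/
def nu (σ : ℕ → Perm ℤ) : Perm (ℤ × ℕ) := fib (fun i => (σ i)⁻¹ * σ (i+1))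

theorem nu_out {n m : ℕ} {γ : Perm ℤ} {σ : ℕ → Perm ℤ} (hB : ∀ i, inB n (σ i)) (he : ∀ i, m ≤ i → σ i = γ)
    (z : ℤ × ℕ) (hz : z ∉ Cm n m) : nu σ z = z := by
  obtain ⟨x, i⟩ := z
  rw [mem_Cm] at hz
  show (((σ i)⁻¹ * σ (i+1)) x, i) = (x, i)
  by_cases hx : x ∈ Xf n
  · have hi : m ≤ i := by by_contra h; exact hz ⟨hx, by omega⟩
    rw [he i hi, he (i+1) (by omega), inv_mul_cancel, Perm.one_apply]
  · rw [((hB i).inv.mul (hB (i+1))).2 x (fun h => hx (mem_Xf.2 h))]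

theorem psi_lt {n m : ℕ} {γ : Perm ℤ} {σ : ℕ → Perm ℤ} (hB : ∀ i, inB n (σ i)) {x : ℤ} (hx : x ∈ Xf n) {i : ℕ} (hi : i + 1 < m) :
    (SS n m γ * (nu σ)⁻¹) ((σ i)⁻¹ x, i) = ((σ (i+1))⁻¹ x, i+1) := by
  rw [Perm.mul_apply, nu, fib_inv_apply]
  have h1 : (((σ i)⁻¹ * σ (i+1))⁻¹) ((σ i)⁻¹ x) = (σ (i+1))⁻¹ x := by
    rw [mul_inv_rev, inv_inv, Perm.mul_apply, papply_inv]
  rw [h1, SS_lt (mem_Xf.2 ((hB _).inv.mem.2 (mem_Xf.1 hx))) hi]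

theorem psi_end {n m : ℕ} {γ : Perm ℤ} {σ : ℕ → Perm ℤ} (hB : ∀ i, inB n (σ i)) {x : ℤ} (hx : x ∈ Xf n) {i : ℕ} (hi : i + 1 = m) :
    (SS n m γ * (nu σ)⁻¹) ((σ i)⁻¹ x, i) = (γ ((σ m)⁻¹ x), 0) := by
  rw [Perm.mul_apply, nu, fib_inv_apply]
  have h1 : (((σ i)⁻¹ * σ (i+1))⁻¹) ((σ i)⁻¹ x) = (σ (i+1))⁻¹ x := by
    rw [mul_inv_rev, inv_inv, Perm.mul_apply, papply_inv]
  rw [h1, SS_end (mem_Xf.2 ((hB _).inv.mem.2 (mem_Xf.1 hx))) hi, hi]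

theorem psi_iter {n m : ℕ} {γ : Perm ℤ} {σ : ℕ → Perm ℤ} (hB : ∀ i, inB n (σ i)) (h0 : σ 0 = 1) {x : ℤ} (hx : x ∈ Xf n) (i : ℕ) :
    i < m → ((SS n m γ * (nu σ)⁻¹)^i) (x, 0) = ((σ i)⁻¹ x, i) := by
  induction i with
  | zero => intro _; rw [h0, pow_zero, inv_one]; rfl
  | succ i ih =>
    intro h
    rw [pow_succ', Perm.mul_apply, ih (by omega), psi_lt hB hx h]

theorem psi_full {n m : ℕ} (hm : 1 ≤ m) {γ : Perm ℤ} {σ : ℕ → Perm ℤ} (hB : ∀ i, inB n (σ i)) (h0 : σ 0 = 1) {x : ℤ} (hx : x ∈ Xf n) :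
    ((SS n m γ * (nu σ)⁻¹)^m) (x, 0) = (γ ((σ m)⁻¹ x), 0) := by
  obtain ⟨k, rfl⟩ : ∃ k, m = k + 1 := ⟨m-1, by omega⟩
  rw [pow_succ', Perm.mul_apply, psi_iter hB h0 hx k (by omega), psi_end hB hx rfl]

/-- chains -/
structure Ch (n m : ℕ) (γ : Perm ℤ) (σ : ℕ → Perm ℤ) : Prop where
  B : ∀ i, inB n (σ i)
  z : σ 0 = 1
  e : ∀ i, m ≤ i → σ i = γ
  d : ∑ i ∈ Finset.range m, dm n ((σ i)⁻¹ * σ (i+1)) + n = m * n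

theorem psi_sz {n m : ℕ} (hm : 1 ≤ m) {γ : Perm ℤ} {σ : ℕ → Perm ℤ} (hγ : inB n γ) (hB : ∀ i, inB n (σ i))
    (h0 : σ 0 = 1) (he : ∀ i, m ≤ i → σ i = γ) {u : ℤ × ℕ} (hu : u ∈ Cm n m) :
    sz (Cm n m) (SS n m γ * (nu σ)⁻¹) u = m := by
  set ψ := SS n m γ * (nu σ)⁻¹ with hψ
  have hfix : ∀ z ∉ Cm n m, ψ z = z := by
    intro z hz
    rw [hψ, Perm.mul_apply]
    rw [fix_inv (nu_out hB he) z hz, SS_out hm hγ hz]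
  have key : ∀ x ∈ Xf n, sz (Cm n m) ψ (x, 0) = m := by
    intro x hx
    have hmem : (x, 0) ∈ Cm n m := mem_Cm.2 ⟨hx, by omega⟩
    obtain ⟨h1, h2⟩ := sz_spec hfix hmem
    rw [h1]
    have hper : (ψ^m) (x, 0) = (x, 0) := by
      rw [hψ, psi_full hm hB h0 hx, he m le_rfl, papply_inv]
    have hle : Function.minimalPeriod ψ (x, 0) ≤ m := by
      apply Function.IsPeriodicPt.minimalPeriod_le (by omega)
      show ψ^[m] (x, 0) = (x, 0)
      rw [← Perm.coe_pow]; exact hper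
    by_contra hne
    have hlt : Function.minimalPeriod ψ (x, 0) < m := by omega
    have h3 := psi_iter (γ := γ) hB h0 hx _ hlt
    have h4 : (ψ ^ (Function.minimalPeriod ψ (x, 0))) (x, 0) = (x, 0) := by
      rw [Perm.coe_pow]; exact Function.iterate_minimalPeriod
    rw [← hψ, h4] at h3
    have := congrArg Prod.snd h3
    simp only at this
    omega
  obtain ⟨y, i⟩ := u
  rw [mem_Cm] at hu
  have hx : σ i y ∈ Xf n := mem_Xf.2 ((hB i).mem.2 (mem_Xf.1 hu.1))
  have h5 : ψ.SameCycle (σ i y, 0) (y, i) := ⟨i, by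
    have := psi_iter (γ := γ) hB h0 hx i hu.2
    rw [pinv_apply] at this
    rw [zpow_natCast]; exact this⟩
  refine Eq.trans ?_ (key _ hx)
  unfold sz
  congr 1
  classical
  ext z
  rw [Finset.mem_filter, Finset.mem_filter]
  refine and_congr_right fun _ => ?_
  exact ⟨fun h => h5.trans h, fun h => h5.symm.trans h⟩

theorem psi_tr {n m : ℕ} (hm : 1 ≤ m) {γ : Perm ℤ} {σ : ℕ → Perm ℤ} (hγ : inB n γ) (hB : ∀ i, inB n (σ i))
    (h0 : σ 0 = 1) (he : ∀ i, m ≤ i → σ i = γ) {R : Finset (ℤ × ℕ)} (hR : Tr (Cm n m) (SS n m γ * (nu σ)⁻¹) R) :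
    R.card = 2 * n := by
  have h1 := sz_sum_all hR
  rw [Finset.sum_congr rfl (fun u hu => psi_sz hm hγ hB h0 he (hR.1 hu)), Finset.sum_const, smul_eq_mul, card_Cm] at h1
  exact Nat.eq_of_mul_eq_mul_right (by omega) h1

theorem psi_fix {n m : ℕ} (hm : 1 ≤ m) {γ : Perm ℤ} {σ : ℕ → Perm ℤ} (hγ : inB n γ) (hB : ∀ i, inB n (σ i))
    (he : ∀ i, m ≤ i → σ i = γ) (z : ℤ × ℕ) (hz : z ∉ Cm n m) : (SS n m γ * (nu σ)⁻¹) z = z := by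
  rw [Perm.mul_apply]
  rw [fix_inv (nu_out hB he) z hz, SS_out hm hγ hz]

/-- connectedness -/
def Cn (p : ℕ) (σ : ℕ → Perm ℤ) : Prop := ∃ z, om p (nu σ z) ≠ om p z

theorem ch_good {p q m : ℕ} (hp : 1 ≤ p) (hq : 1 ≤ q) (hm : 1 ≤ m) {σ : ℕ → Perm ℤ}
    (h : Ch (p+q) m (gammaPQ p q) σ) (hc : Cn p σ) :
    ∃ D, Good (Cm (p+q) m) D (om p) (SS (p+q) m (gammaPQ p q)) (nu σ) := by
  have hR : ∀ i, ∃ R, Tr (Xf (p+q)) ((σ i)⁻¹ * σ (i+1)) R := fun i =>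
    exists_tr _ _ (fun x hx => ((h.B i).inv.mul (h.B (i+1))).2 x (fun h' => hx (mem_Xf.2 h')))
  choose R hR using hR
  obtain ⟨R₁, hR₁, hc₁⟩ := tr_fib (m := m) (fun i _ => hR i)
  obtain ⟨R₂, hR₂⟩ := exists_tr (Cm (p+q) m) (SS (p+q) m (gammaPQ p q) * (nu σ)⁻¹) (psi_fix hm gam_inB h.B h.e)
  have hc₂ := psi_tr hm gam_inB h.B h.z h.e hR₂
  refine T3 _ rfl (SS_ann hp hq hm) hc (nu_out h.B h.e) hR₁ hR₂ ?_
  rw [hc₁, hc₂, card_Cm]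
  have h1 : ∑ i ∈ Finset.range m, 2 * dm (p+q) ((σ i)⁻¹ * σ (i+1)) ≤ ∑ i ∈ Finset.range m, (R i).card :=
    Finset.sum_le_sum fun i _ => (tr_dm ((h.B i).inv.mul (h.B (i+1))) (hR i)).1
  rw [← Finset.mul_sum] at h1
  have h2 := h.d
  nlinarith

theorem nu_eps {n : ℕ} {σ : ℕ → Perm ℤ} (hB : ∀ i, inB n (σ i)) (z : ℤ × ℕ) : nu σ (epsN z) = epsN (nu σ z) := by
  obtain ⟨x, i⟩ := z
  rw [eps_apply, nu, fib_apply, fib_apply, eps_apply, ((hB i).inv.mul (hB (i+1))).1]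

theorem conj_eq {α : Type*} [DecidableEq α] {e f : Perm α} (h : ∀ z, f (e z) = e (f z)) : e * f * e⁻¹ = f := by
  ext z
  rw [Perm.mul_apply, Perm.mul_apply, ← h, papply_inv]

theorem good_symm {p q m : ℕ} (hp : 1 ≤ p) (hq : 1 ≤ q) (hm : 1 ≤ m) {ν : Perm (ℤ × ℕ)} (hν : ∀ z, ν (epsN z) = epsN (ν z))
    (hc : ∃ z, om p (ν z) ≠ om p z) {D : Finset (ℤ × ℕ)} 
    (hg : Good (Cm (p+q) m) D (om p) (SS (p+q) m (gammaPQ p q)) ν) (z : ℤ × ℕ) : epsN z ∈ D ↔ z ∈ D := by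
  have h1 := good_conj (e := epsN) (fun z => eps_C) eps_o (conj_eq (eps_S hm gam_inB)) hg
  rw [conj_eq hν] at h1
  have h2 := T2 _ rfl (SS_ann hp hq hm) hc hg h1
  have key : ∀ z, z ∈ D → epsN z ∈ D := by
    intro z hz
    rw [h2]; exact Finset.mem_image_of_mem _ hz
  refine ⟨fun h => ?_, key z⟩
  have := key _ h
  rwa [eps_eps] at this

/-- no invariant orbit -/
theorem good_noinv {n m : ℕ} {o : ℤ × ℕ → Bool} {S ν : Perm (ℤ × ℕ)}  {D : Finset (ℤ × ℕ)} 
    (hν : ∀ z, ν (epsN z) = epsN (ν z))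
    (hg : Good (Cm n m) D o S ν) (hs : ∀ z, epsN z ∈ D ↔ z ∈ D) {z : ℤ × ℕ} (hz : z ∈ Cm n m) : ¬ ν.SameCycle z (epsN z) := by
  intro h
  obtain ⟨y, ⟨hy, hzy⟩, hu⟩ := hg.trν.2 z hz
  have h1 : ν.SameCycle (epsN z) (epsN y) := by
    have : (epsN * ν * epsN⁻¹).SameCycle (epsN z) (epsN y) := by
      rw [sameCycle_conj, pinv_apply, pinv_apply]; exact hzy
    rwa [conj_eq hν] at this
  have h2 : epsN y ∈ Cm n m \ D := by
    rw [Finset.mem_sdiff] at hy ⊢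
    rw [eps_C, hs]; exact hy
  have h3 : epsN y = y := hu _ ⟨h2, h.trans h1⟩
  obtain ⟨x, i⟩ := y
  rw [eps_apply] at h3
  have h4 : -x = x := congrArg Prod.fst h3
  have h5 := (mem_Xf.1 (mem_Cm.1 (Finset.mem_sdiff.1 hy).1).1).1
  omega

end

section
open Equiv Equiv.Perm
set_option linter.unusedSectionVars false
set_option linter.unusedVariables false

theorem tele {n : ℕ} (σ : ℕ → Perm ℤ) (i j : ℕ) :
    ∑ k ∈ Finset.range j, dm n ((σ (i+k))⁻¹ * σ (i+k+1)) + n ≤ dm n ((σ i)⁻¹ * σ (i+j)) + j * n := by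
  induction j with
  | zero => simp; exact (dimV n).ge
  | succ j ih =>
    rw [Finset.sum_range_succ]
    have h := dm_mul n ((σ i)⁻¹ * σ (i+j)) ((σ (i+j))⁻¹ * σ (i+j+1))
    rw [mul_assoc, mul_inv_cancel_left] at h
    rw [show i + (j+1) = i + j + 1 by ring]
    nlinarith

theorem ch_snc {n m : ℕ} {γ : Perm ℤ} (h0 : Fx n γ = ⊥) {σ : ℕ → Perm ℤ} (h : Ch n m γ σ) {i : ℕ} (hi : i ≤ m) :
    dm n (σ i) + dm n ((σ i)⁻¹ * γ) = n := by
  have h1 := tele (n := n) σ 0 i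
  have h2 := tele (n := n) σ i (m - i)
  have h3 := h.d
  rw [show m = i + (m - i) by omega, Finset.sum_range_add] at h3
  rw [show i + (m - i) = m by omega, h.e m le_rfl] at h2
  simp only [zero_add, h.z, inv_one, one_mul] at h1
  have h4 := dm_mul n (σ i) ((σ i)⁻¹ * γ)
  rw [mul_inv_cancel_left, dm_bot h0] at h4
  obtain ⟨k, rfl⟩ := Nat.exists_eq_add_of_le hi
  rw [Nat.add_sub_cancel_left] at *
  simp only [add_mul] at h3
  omega

theorem ch_le {n m : ℕ} {γ : Perm ℤ} (h0 : Fx n γ = ⊥) {σ : ℕ → Perm ℤ} (h : Ch n m γ σ) {i j : ℕ} (hij : i ≤ j) (hj : j ≤ m) :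
    dm n (σ i) + dm n ((σ i)⁻¹ * σ j) = n + dm n (σ j) := by
  have h1 := tele (n := n) σ 0 i
  obtain ⟨k, rfl⟩ := Nat.exists_eq_add_of_le hij
  obtain ⟨l, rfl⟩ := Nat.exists_eq_add_of_le hj
  have h2 := tele (n := n) σ i k
  have h5 := tele (n := n) σ (i+k) l
  have h3 := h.d
  rw [Finset.sum_range_add, Finset.sum_range_add] at h3
  rw [h.e _ le_rfl] at h5
  simp only [zero_add, h.z, inv_one, one_mul] at h1
  have h4 := dm_mul n (σ i) ((σ i)⁻¹ * σ (i+k))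
  rw [mul_inv_cancel_left] at h4
  have h6 := ch_snc h0 h hj
  simp only [add_mul] at h3
  omega

theorem dm_one (n : ℕ) : dm n 1 = n := dimV n

/-- extend a finite sequence to a chain -/
def ext1 (m : ℕ) (γ : Perm ℤ) (τ : ℕ → Perm ℤ) (i : ℕ) : Perm ℤ :=
  if i = 0 then 1 else if i < m then τ (i-1) else γ

theorem ext_ch {n m : ℕ} (hm : 1 ≤ m) {γ : Perm ℤ} (hγ : inB n γ) (h0 : Fx n γ = ⊥) {τ : ℕ → Perm ℤ}
    (hB : ∀ i, i + 1 < m → inB n (τ i)) (hs : ∀ i, i + 1 < m → dm n (τ i) + dm n ((τ i)⁻¹ * γ) = n)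
    (hF : ∀ i, i + 2 < m → Fx n (τ (i+1)) ≤ Fx n (τ i)) : Ch n m γ (ext1 m γ τ) := by
  have hd0 := dm_bot h0
  have B : ∀ i, inB n (ext1 m γ τ i) := by
    intro i; unfold ext1; split_ifs
    · exact inB_one _
    · exact hB _ (by omega)
    · exact hγ
  have s : ∀ i, dm n (ext1 m γ τ i) + dm n ((ext1 m γ τ i)⁻¹ * γ) = n := by
    intro i; unfold ext1; split_ifs
    · rw [inv_one, one_mul, dm_one, hd0, add_zero]
    · exact hs _ (by omega)
    · rw [inv_mul_cancel, dm_one, hd0, zero_add]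
  have F : ∀ i, Fx n (ext1 m γ τ (i+1)) ≤ Fx n (ext1 m γ τ i) := by
    intro i
    unfold ext1
    by_cases h1 : i = 0
    · rw [if_pos h1]; exact Fx_le _ _
    · rw [if_neg h1, if_neg (by omega)]
      by_cases h2 : i + 1 < m
      · rw [if_pos h2, if_pos (by omega)]
        have := hF (i-1) (by omega)
        rwa [show i - 1 + 1 = i + 1 - 1 by omega] at this
      · rw [if_neg h2, h0]; exact bot_le
  have z : ext1 m γ τ 0 = 1 := rfl
  have e : ∀ i, m ≤ i → ext1 m γ τ i = γ := by
    intro i hi; unfold ext1; rw [if_neg (by omega), if_neg (by omega)]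
  refine ⟨B, z, e, ?_⟩
  have key : ∀ j, ∑ i ∈ Finset.range j, dm n ((ext1 m γ τ i)⁻¹ * ext1 m γ τ (i+1)) + n = j * n + dm n (ext1 m γ τ j) := by
    intro j
    induction j with
    | zero => rw [z, dm_one]; simp
    | succ j ih =>
      rw [Finset.sum_range_succ]
      have := BW_le hγ h0 (B j) (B (j+1)) (s j) (s (j+1)) (F j)
      nlinarith
  rw [key, e m le_rfl, hd0, add_zero]

theorem cross_of_cn {p n m : ℕ} {σ : ℕ → Perm ℤ} (hc : Cn p σ) : ∃ i x, ¬ (|σ i x| ≤ p ↔ |x| ≤ p) := by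
  by_contra hcon
  push Not at hcon
  obtain ⟨⟨x, i⟩, h⟩ := hc
  apply h
  rw [nu, fib_apply, om_eq]
  show |((σ i)⁻¹ * σ (i+1)) x| ≤ p ↔ |x| ≤ p
  rw [← hcon (i+1) x, ← hcon i, Perm.mul_apply, papply_inv]

theorem cn_of_cross {p i : ℕ} {σ : ℕ → Perm ℤ} (h0 : σ 0 = 1) {x : ℤ} (h : ¬ (|σ i x| ≤ p ↔ |x| ≤ p)) : Cn p σ := by
  by_contra hcon
  unfold Cn at hcon
  push Not at hcon
  apply h
  clear h
  induction i generalizing x with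
  | zero => rw [h0]; rfl
  | succ i ih =>
    have h1 := hcon (x, i)
    rw [nu, fib_apply, om_eq] at h1
    simp only at h1
    rw [← h1, ← ih (x := ((σ i)⁻¹ * σ (i+1)) x), Perm.mul_apply, papply_inv]

theorem conn_pos {p q : ℕ} (hp : 1 ≤ p) (hq : 1 ≤ q) {τ : Perm ℤ} (hτ : inB (p+q) τ)
    (hd : dm (p+q) τ + dm (p+q) (τ⁻¹ * gammaPQ p q) = p+q) {x : ℤ} (hx : ¬ (|τ x| ≤ p ↔ |x| ≤ p)) :
    0 < connectivity p q (omegaTilde (p+q) τ) := by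
  have hch := ext_ch (m := 2) (by omega) gam_inB (gam_bot hp hq) (τ := fun _ => τ) (fun i _ => hτ) (fun i _ => hd) (fun i _ => le_rfl)
  have hcn : Cn p (ext1 2 (gammaPQ p q) (fun _ => τ)) := cn_of_cross (i := 1) rfl hx
  obtain ⟨D, hD⟩ := ch_good hp hq (by omega) hch hcn
  have hs := good_symm hp hq (by omega) (nu_eps hch.B) hcn hD
  have hno : ∀ y ∈ signedSet (p+q), ¬ τ.SameCycle y (-y) := by
    intro y hy h
    apply good_noinv (nu_eps hch.B) hD hs (z := (y, 0)) (mem_Cm.2 ⟨mem_Xf.2 hy, by omega⟩)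
    rw [eps_apply, nu, fib_sc]
    exact ⟨rfl, by simpa [ext1] using h⟩
  have hxs : x ∈ signedSet (p+q) := by
    by_contra h
    rw [hτ.2 x h] at hx; exact hx Iff.rfl
  have hmem : ∀ y ∈ signedSet (p+q), ¬ (|τ y| ≤ p ↔ |y| ≤ p) → permOrbit τ y ∈ {A | A ∈ omegaTilde (p+q) τ ∧ negSet A ≠ A ∧ (A ∩ signedSet p).Nonempty ∧
    (A ∩ innerSet p q).Nonempty} := by
    intro y hy hyc
    refine ⟨omega_orb hτ hy (hno y hy), fun h => hno y hy ((negOrbit hτ y).1 h), ?_⟩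
    have h1 : y ∈ permOrbit τ y := SameCycle.refl _ _
    have h2 : τ y ∈ permOrbit τ y := sc_step τ y
    have hτy := hτ.mem.2 hy
    have h3 := hy.2
    have h4 := hτy.2
    push_cast at h3 h4
    by_cases h : |y| ≤ p
    · refine ⟨⟨y, h1, hy.1, h⟩, ⟨τ y, h2, ?_, h4⟩⟩
      by_contra h'
      exact hyc ⟨fun _ => h, fun _ => by omega⟩
    · refine ⟨⟨τ y, h2, hτy.1, ?_⟩, ⟨y, h1, by omega, h3⟩⟩
      by_contra h'
      exact hyc ⟨fun h'' => absurd h'' h', fun h'' => absurd h'' h⟩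
  have hfin : {A | A ∈ omegaTilde (p+q) τ ∧ negSet A ≠ A ∧ (A ∩ signedSet p).Nonempty ∧
    (A ∩ innerSet p q).Nonempty}.Finite := by
    apply Set.Finite.subset ((Xf (p+q)).finite_toSet.image (permOrbit τ))
    rintro A ⟨hA, hA2, -⟩
    rcases hA with ⟨⟨y, hy, rfl⟩, -⟩ | hA
    · exact ⟨y, mem_Xf.2 hy, rfl⟩
    · exfalso
      rcases omega_cases hτ (Or.inr hA) with ⟨y, hy, h, rfl⟩ | h
      · obtain ⟨z, hz⟩ := hA.2
        rw [hA.1] at hz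
        obtain ⟨B, ⟨⟨w, hw, rfl⟩, hB⟩, -⟩ := hz
        exact hno w hw ((negOrbit hτ w).1 hB)
      · obtain ⟨z, hz⟩ := hA.2
        exact hno z ((h z).1 hz).1 ((h z).1 hz).2
  unfold connectivity
  apply Nat.div_pos _ (by omega)
  apply (Set.one_lt_ncard_iff hfin).2
  refine ⟨permOrbit τ x, permOrbit τ (-x), hmem x hxs hx, hmem (-x) (sz_neg hxs) (by rw [hτ.1, abs_neg, abs_neg]; exact hx), ?_⟩
  intro h
  have h1 : -x ∈ permOrbit τ (-x) := SameCycle.refl _ _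
  rw [← h] at h1
  exact hno x hxs h1

theorem cross_of_conn {p q : ℕ} {τ : Perm ℤ} (hτ : inB (p+q) τ)
    (h : 0 < connectivity p q (omegaTilde (p+q) τ)) : ∃ x, ¬ (|τ x| ≤ p ↔ |x| ≤ p) := by
  unfold connectivity at h
  have hne : {A | A ∈ omegaTilde (p+q) τ ∧ negSet A ≠ A ∧ (A ∩ signedSet p).Nonempty ∧
    (A ∩ innerSet p q).Nonempty}.Nonempty := by
    by_contra hc
    rw [Set.not_nonempty_iff_eq_empty] at hc
    rw [hc, Set.ncard_empty] at h
    simp at h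
  obtain ⟨A, hA, hA2, ⟨y, hy, hy2⟩, ⟨z, hz, hz2⟩⟩ := hne
  by_contra hcon
  push Not at hcon
  rcases omega_cases hτ hA with ⟨x, hx, -, rfl⟩ | h
  · have h1 : τ.SameCycle y z := SameCycle.trans (SameCycle.symm hy) hz
    have h2 := (sc_inv (P := fun z : ℤ => |z| ≤ p) hcon h1).1 hy2.2
    have h3 := hz2.1
    omega
  · apply hA2
    ext w
    show -w ∈ A ↔ w ∈ A
    rw [h, h, neg_neg]
    constructor
    · rintro ⟨h1, h2⟩; exact ⟨by simpa using sz_neg h1, h2.symm⟩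
    · rintro ⟨h1, h2⟩; exact ⟨sz_neg h1, h2.symm⟩

theorem ncard_eq {p q m : ℕ} (hp : 1 ≤ p) (hq : 1 ≤ q) (hm : 2 ≤ m) :
    {f : Fin (m - 1) → Set (Set ℤ) |
        (∀ i, f i ∈ NCB p q) ∧
        (∀ i j : Fin (m - 1), i ≤ j → refines (f i) (f j)) ∧
        (∃ i, 0 < connectivity p q (f i))}.ncard = {σ | Ch (p+q) m (gammaPQ p q) σ ∧ Cn p σ}.ncard := by
  have h0 := gam_bot hp hq
  have hd0 := dm_bot h0
  symm
  apply Set.ncard_congr (fun σ _ => fun i : Fin (m-1) => omegaTilde (p+q) (σ (i+1)))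
  · rintro σ ⟨h, hc⟩
    refine ⟨fun i => ⟨σ (i+1), ⟨h.B _, ?_⟩, rfl⟩, fun i j hij => ?_, ?_⟩
    · rw [leB_iff (h.B _) gam_inB, hd0, add_zero]
      exact ch_snc h0 h (by omega)
    · show refines (omegaTilde (p+q) (σ (i+1))) (omegaTilde (p+q) (σ (j+1)))
      rw [refines_iff (h.B _) (h.B _)]
      have hij' : (i:ℕ) ≤ j := hij
      exact (leB_Fx (ch_le h0 h (by omega) (by omega))).trans inf_le_left
    · obtain ⟨i, x, hx⟩ := cross_of_cn (n := p+q) (m := m) hc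
      have hi0 : i ≠ 0 := by rintro rfl; rw [h.z] at hx; exact hx Iff.rfl
      have him : i < m := by
        by_contra hh; rw [h.e i (by omega)] at hx; exact hx (gam_o x)
      refine ⟨⟨i-1, by omega⟩, ?_⟩
      show 0 < connectivity p q (omegaTilde (p+q) (σ (i-1+1)))
      rw [show i - 1 + 1 = i by omega]
      exact conn_pos hp hq (h.B i) (ch_snc h0 h him.le) hx
  · rintro σ σ' ⟨h, hc⟩ ⟨h', hc'⟩ heq
    funext i
    by_cases hi0 : i = 0
    · rw [hi0, h.z, h'.z]
    by_cases him : i < m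
    · have h1 : omegaTilde (p+q) (σ (i-1+1)) = omegaTilde (p+q) (σ' (i-1+1)) := congrFun heq ⟨i-1, by omega⟩
      rw [show i - 1 + 1 = i by omega] at h1
      have r1 : refines (omegaTilde (p+q) (σ i)) (omegaTilde (p+q) (σ i)) := fun A hA => ⟨A, hA, subset_rfl⟩
      apply BW_inj gam_inB h0 (h'.B i) (h.B i) (ch_snc h0 h' him.le) (ch_snc h0 h him.le)
      apply le_antisymm
      · rw [← refines_iff (h'.B i) (h.B i), ← h1]; exact r1
      · rw [← refines_iff (h.B i) (h'.B i), ← h1]; exact r1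
    · rw [h.e i (by omega), h'.e i (by omega)]
  · rintro f ⟨h1, h2, i, h3⟩
    choose τ hτ hf using h1
    have hB : ∀ i, inB (p+q) (τ i) := fun i => (hτ i).1
    have hs : ∀ i, dm (p+q) (τ i) + dm (p+q) ((τ i)⁻¹ * gammaPQ p q) = p+q := by
      intro i
      have := (leB_iff (hB i) gam_inB).1 (hτ i).2
      rwa [hd0, add_zero] at this
    let t : ℕ → Perm ℤ := fun i => if h : i < m - 1 then τ ⟨i, h⟩ else 1
    have ht : ∀ i (h : i < m-1), t i = τ ⟨i, h⟩ := fun i h => dif_pos h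
    have hch := ext_ch (m := m) (by omega) gam_inB h0 (τ := t)
      (fun i hi => by rw [ht i (by omega)]; exact hB _)
      (fun i hi => by rw [ht i (by omega)]; exact hs _)
      (fun i hi => by
        rw [ht i (by omega), ht (i+1) (by omega), ← refines_iff (hB _) (hB _), ← hf, ← hf]
        exact h2 _ _ (by rw [Fin.mk_le_mk]; omega))
    have hval : ∀ i : Fin (m-1), ext1 m (gammaPQ p q) t (i+1) = τ i := by
      intro i
      have := i.2
      unfold ext1
      rw [if_neg (by omega), if_pos (by omega), Nat.add_sub_cancel, ht i i.2]
    refine ⟨ext1 m (gammaPQ p q) t, ⟨hch, ?_⟩, ?_⟩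
    · rw [hf] at h3
      obtain ⟨x, hx⟩ := cross_of_conn (hB i) h3
      apply cn_of_cross (i := i+1) (x := x) rfl
      rw [hval]; exact hx
    · funext i
      show omegaTilde (p+q) (ext1 m (gammaPQ p q) t (i+1)) = f i
      rw [hval, hf]

end

section
open Equiv Equiv.Perm
set_option linter.unusedSectionVars false
set_option linter.unusedVariables false

/-- position to point -/
def pt (m s : ℕ) : ℤ × ℕ := (((s / m : ℕ) : ℤ) + 1, s % m)

theorem pt_mk {m : ℕ} {a i : ℕ} (hi : i < m) : pt m (a * m + i) = ((a:ℤ) + 1, i) := by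
  unfold pt
  rw [show (a * m + i) / m = a by
    rw [mul_comm, Nat.mul_add_div (by omega), Nat.div_eq_of_lt hi, add_zero],
    show (a * m + i) % m = i by rw [Nat.mul_add_mod_self_right, Nat.mod_eq_of_lt hi]]

theorem cnt_pt {m a b : ℕ} (hm : 1 ≤ m) {D : Finset (ℤ × ℕ)} (hD : ∀ z ∈ D, z.2 < m) :
    ((Finset.Ico (a*m) (b*m)).filter (fun s => pt m s ∈ D)).card = (D.filter (fun z => (a:ℤ) < z.1 ∧ z.1 ≤ (b:ℤ))).card := by
  apply Finset.card_bij (fun s _ => pt m s)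
  · intro s hs
    rw [Finset.mem_filter, Finset.mem_Ico] at hs
    rw [Finset.mem_filter]
    refine ⟨hs.2, ?_⟩
    unfold pt
    have h1 : a ≤ s / m := (Nat.le_div_iff_mul_le (by omega)).2 hs.1.1
    have h2 : s / m < b := (Nat.div_lt_iff_lt_mul (by omega)).2 hs.1.2
    constructor <;> omega
  · intro s hs t ht h
    unfold pt at h
    rw [Prod.mk.injEq] at h
    have h1 : s / m = t / m := by omega
    rw [← Nat.div_add_mod s m, ← Nat.div_add_mod t m, h1, h.2]
  · rintro ⟨x, i⟩ hz
    rw [Finset.mem_filter] at hz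
    obtain ⟨h1, h2, h3⟩ := hz
    have hi := hD _ h1
    simp only at h2 h3 hi
    obtain ⟨y, rfl⟩ : ∃ y : ℕ, x = (y:ℤ) + 1 := ⟨(x-1).toNat, by omega⟩
    refine ⟨y * m + i, ?_, pt_mk hi⟩
    rw [Finset.mem_filter, pt_mk hi, Finset.mem_Ico]
    refine ⟨⟨?_, ?_⟩, h1⟩
    · have : a * m ≤ y * m := Nat.mul_le_mul_right _ (by omega)
      omega
    · have : (y+1) * m ≤ b * m := Nat.mul_le_mul_right _ (by omega)
      rw [add_mul] at this
      omega

theorem sum_h {δ m a b : ℕ} (hab : a ≤ b) (hm : 1 ≤ m) {D : Finset (ℤ × ℕ)} (hD : ∀ z ∈ D, z.2 < m) :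
    ∑ s ∈ Finset.Ico (a*m) (b*m), (if pt m s ∈ D then 1 - (m : ZMod δ) else 1) =
      ((b * m : ℕ) : ZMod δ) - ((a * m : ℕ) : ZMod δ) - m * ((D.filter (fun z => (a:ℤ) < z.1 ∧ z.1 ≤ (b:ℤ))).card : ZMod δ) := by
  rw [← cnt_pt hm hD]
  have : ∀ s ∈ Finset.Ico (a*m) (b*m), (if pt m s ∈ D then 1 - (m : ZMod δ) else 1) = 1 - (if pt m s ∈ D then (m : ZMod δ) else 0) := by
    intro s _; split_ifs <;> simp
  rw [Finset.sum_congr rfl this, Finset.sum_sub_distrib, Finset.sum_ite, Finset.sum_const_zero, add_zero,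
    Finset.sum_const, Finset.sum_const, Nat.card_Ico, nsmul_eq_mul, nsmul_eq_mul, Nat.cast_sub (Nat.mul_le_mul_right _ hab)]
  ring

theorem lam_exists {p q m c k : ℕ} (hp : 1 ≤ p) (hq : 1 ≤ q) (hm : 1 ≤ m) {D : Finset (ℤ × ℕ)}
    (hD : ∀ z ∈ D, z.2 < m) (hs : ∀ z, epsN z ∈ D ↔ z ∈ D)
    (ho : (D.filter (fun z => ((0:ℕ):ℤ) < z.1 ∧ z.1 ≤ (p:ℤ))).card + c = p)
    (hi : (D.filter (fun z => (p:ℤ) < z.1 ∧ z.1 ≤ ((p+q:ℕ):ℤ))).card = q + c) :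
    ∃ l : ℤ × ℕ → ZMod (2*m*c), 
      (∀ x ∈ Cm (p+q) m, l (SS (p+q) m (gammaPQ p q) x) = l x +
        (if SS (p+q) m (gammaPQ p q) x ∈ D then 1 - (m : ZMod (2*m*c)) else 1)) ∧
      (∀ z ∈ Cm (p+q) m, l (epsN z) = l z + (m*c:ℕ)) ∧ l (1, 0) = 0 ∧ l ((p:ℤ)+1, 0) = ((m*k : ℕ) : ZMod (2*m*c)) := by
  set S := SS (p+q) m (gammaPQ p q) with hSdef
  let h : ℤ × ℕ → ZMod (2*m*c) := fun z => if z ∈ D then 1 - (m : ZMod (2*m*c)) else 1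
  have hh : ∀ z, h (epsN z) = h z := by
    intro z; show (if _ then _ else _) = (if _ then _ else _)
    simp only [hs]
  let P : ℕ → ZMod (2*m*c) := fun t => ∑ s ∈ Finset.range t, h (pt m s)
  have hP : ∀ t, P (t+1) = P t + h (pt m t) := fun t => Finset.sum_range_succ _ _
  have h2 : (((m*c:ℕ) : ZMod (2*m*c)) + ((m*c:ℕ) : ZMod (2*m*c))) = 0 := by
    have := ZMod.natCast_self (2*m*c)
    push_cast at this ⊢
    linear_combination this
  have hP1 : P (p*m) = ((m*c:ℕ) : ZMod (2*m*c)) := by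
    have h1 := sum_h (δ := 2*m*c) (a := 0) (b := p) (by omega) hm hD
    rw [zero_mul, ← Finset.range_eq_Ico] at h1
    have h3 : ((p:ℕ) : ZMod (2*m*c)) = ((D.filter (fun z => ((0:ℕ):ℤ) < z.1 ∧ z.1 ≤ (p:ℤ))).card : ZMod (2*m*c)) + c := by
      conv_lhs => rw [← ho]
      push_cast; rfl
    show ∑ s ∈ Finset.range (p*m), h (pt m s) = _
    refine h1.trans ?_
    push_cast at h3 ⊢
    rw [h3]; ring
  have hP2 : P ((p+q)*m) = P (p*m) + ((m*c:ℕ) : ZMod (2*m*c)) := by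
    have h1 := sum_h (δ := 2*m*c) (a := p) (b := p+q) (by omega) hm hD
    rw [hi] at h1
    have h3 : P (p*m) + ∑ s ∈ Finset.Ico (p*m) ((p+q)*m), h (pt m s) = P ((p+q)*m) :=
      Finset.sum_range_add_sum_Ico _ (Nat.mul_le_mul_right _ (by omega))
    rw [← h3]
    congr 1
    refine h1.trans ?_
    push_cast at h2 ⊢
    linear_combination - h2
  have hpt : ∀ (x : ℕ) (i : ℕ), 1 ≤ x → i < m → pt m ((x-1)*m+i) = ((x:ℤ), i) := by
    intro x i hx hi
    rw [pt_mk hi]; congr 1; omega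
  let g : ℕ → ℕ → ZMod (2*m*c) := fun x i => if x ≤ p then P ((x-1)*m+i+1) - P 1 else P ((x-1)*m+i+1) - P (p*m+1) + ((m*k:ℕ) : ZMod (2*m*c))
  let l : ℤ × ℕ → ZMod (2*m*c) := fun z => g z.1.natAbs z.2 + (if z.1 < 0 then ((m*c:ℕ) : ZMod (2*m*c)) else 0)
  have lpos : ∀ (x : ℕ) i, l ((x:ℤ), i) = g x i := by
    intro x i
    show g (x:ℤ).natAbs i + (if (x:ℤ) < 0 then _ else _) = _
    rw [if_neg (by omega), add_zero, Int.natAbs_natCast]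
  have hM : ∀ (x : ℕ), 1 ≤ x → x ≤ p + q → (x:ℤ) ∈ Xf (p+q) := by
    intro x h1 h2
    rw [mem_Xf]; exact ⟨by omega, by rw [abs_le]; push_cast; omega⟩
  have leps : ∀ z ∈ Cm (p+q) m, l (epsN z) = l z + (m*c:ℕ) := by
    rintro ⟨x, i⟩ hz
    have h3 := (mem_Xf.1 (mem_Cm.1 hz).1).1
    show g (-x).natAbs i + (if -x < 0 then ((m*c:ℕ) : ZMod (2*m*c)) else 0) = g x.natAbs i + (if x < 0 then ((m*c:ℕ) : ZMod (2*m*c)) else 0) + _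
    rw [Int.natAbs_neg]
    by_cases h4 : x < 0
    · rw [if_pos h4, if_neg (by omega), add_assoc, h2]
    · rw [if_neg h4, if_pos (by omega), add_zero]
  have l1 : l (1, 0) = 0 := by
    have := lpos 1 0
    rw [Nat.cast_one] at this
    rw [this]
    show (if 1 ≤ p then P ((1-1)*m+0+1) - P 1 else _) = _
    rw [if_pos hp]; simp
  have l2 : l ((p:ℤ)+1, 0) = ((m*k : ℕ) : ZMod (2*m*c)) := by
    have := lpos (p+1) 0
    rw [Nat.cast_add, Nat.cast_one] at this
    rw [this]
    show (if p + 1 ≤ p then _ else P ((p+1-1)*m+0+1) - P (p*m+1) + ((m*k:ℕ) : ZMod (2*m*c))) = _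
    rw [if_neg (by omega)]; simp
  have step : ∀ x i, 1 ≤ x → i + 1 < m → g x (i+1) = g x i + h ((x:ℤ), i+1) := by
    intro x i hx hi
    have e := hP ((x-1)*m+(i+1))
    rw [hpt x (i+1) hx hi] at e
    show (if x ≤ p then P ((x-1)*m+(i+1)+1) - P 1 else P ((x-1)*m+(i+1)+1) - P (p*m+1) + ((m*k:ℕ) : ZMod (2*m*c))) =
      (if x ≤ p then P ((x-1)*m+i+1) - P 1 else P ((x-1)*m+i+1) - P (p*m+1) + ((m*k:ℕ) : ZMod (2*m*c))) + _
    rw [e, show (x-1)*m+(i+1) = (x-1)*m+i+1 by ring]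
    split_ifs <;> ring
  have step2 : ∀ x i, 1 ≤ x → x ≠ p → i + 1 = m → g (x+1) 0 = g x i + h ((x:ℤ)+1, 0) := by
    intro x i hx hxp hi
    have e := hP ((x+1-1)*m+0)
    rw [hpt (x+1) 0 (by omega) (by omega)] at e
    have e2 : (x+1-1)*m+0 = (x-1)*m+i+1 := by
      obtain ⟨y, rfl⟩ : ∃ y, x = y + 1 := ⟨x-1, by omega⟩
      rw [Nat.add_sub_cancel, Nat.add_sub_cancel, add_mul]; omega
    show (if x + 1 ≤ p then P ((x+1-1)*m+0+1) - P 1 else P ((x+1-1)*m+0+1) - P (p*m+1) + ((m*k:ℕ) : ZMod (2*m*c))) =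
      (if x ≤ p then P ((x-1)*m+i+1) - P 1 else P ((x-1)*m+i+1) - P (p*m+1) + ((m*k:ℕ) : ZMod (2*m*c))) + _
    rw [e, e2]
    push_cast
    by_cases hx' : x ≤ p
    · rw [if_pos hx', if_pos (by omega)]; ring
    · rw [if_neg hx', if_neg (by omega)]; ring
  have posrec : ∀ (x : ℕ) i, 1 ≤ x → x ≤ p + q → i < m → l (S ((x:ℤ), i)) = l ((x:ℤ), i) + h (S ((x:ℤ), i)) := by
    intro x i hx hxn hi
    by_cases him : i + 1 = m
    · rw [hSdef, SS_end (hM x hx hxn) him]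
      by_cases hxp : x = p
      · subst hxp
        rw [gam_endo hx]
        have e := leps (1, 0) (mem_Cm.2 ⟨by simpa using hM 1 le_rfl (by omega), by omega⟩)
        have e2 := hh (1, 0)
        rw [eps_apply] at e e2
        rw [e, e2, l1, lpos]
        show _ = (if x ≤ x then P ((x-1)*m+i+1) - P 1 else _) + _
        rw [if_pos le_rfl, show (x-1)*m+i+1 = x*m by
          obtain ⟨y, rfl⟩ : ∃ y, x = y + 1 := ⟨x-1, by omega⟩
          rw [Nat.add_sub_cancel, add_mul]; omega, hP1]
        have e3 := hP 0
        have e4 := hpt 1 0 le_rfl (by omega)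
        have e5 : P 0 = 0 := Finset.sum_range_zero _
        simp only [Nat.sub_self, zero_mul, zero_add, Nat.cast_one] at e4 e3
        rw [e3, e4, e5]; ring
      by_cases hxq : x = p + q
      · subst hxq
        rw [show ((p+q:ℕ):ℤ) = (p:ℤ) + q by push_cast; rfl, gam_endi hq]
        have e := leps ((p:ℤ)+1, 0) (mem_Cm.2 ⟨by simpa using hM (p+1) (by omega) (by omega), by omega⟩)
        have e2 := hh ((p:ℤ)+1, 0)
        rw [eps_apply] at e e2
        rw [e, e2, l2]
        have e6 := lpos (p+q) i
        rw [Nat.cast_add] at e6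
        rw [e6]
        show _ = (if p + q ≤ p then _ else P ((p+q-1)*m+i+1) - P (p*m+1) + ((m*k:ℕ) : ZMod (2*m*c))) + _
        rw [if_neg (by omega), show (p+q-1)*m+i+1 = (p+q)*m by
          obtain ⟨y, hy⟩ : ∃ y, p + q = y + 1 := ⟨p+q-1, by omega⟩
          rw [hy, Nat.add_sub_cancel, add_mul]; omega, hP2]
        have e3 := hP (p*m)
        have e4 := hpt (p+1) 0 (by omega) (by omega)
        simp only [Nat.add_sub_cancel, add_zero, Nat.cast_add, Nat.cast_one] at e4
        rw [e3, e4]; ring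
      · rw [gam_step (by omega) (by omega) (by omega), lpos]
        have := lpos (x+1) 0
        rw [Nat.cast_add, Nat.cast_one] at this
        rw [this]
        exact step2 x i hx hxp him
    · rw [hSdef, SS_lt (hM x hx hxn) (by omega), lpos, lpos]
      exact step x i hx (by omega)
  refine ⟨l, ?_, leps, l1, l2⟩
  rintro ⟨x, i⟩ hz
  have hz1 := mem_Cm.1 hz
  have hz2 := mem_Xf.1 hz1.1
  have hz3 := hz2.2
  rw [abs_le] at hz3
  push_cast at hz3
  show l (S (x, i)) = l (x, i) + h (S (x, i))
  rcases lt_or_gt_of_ne hz2.1 with hx | hx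
  · obtain ⟨y, rfl⟩ : ∃ y : ℕ, x = -(y:ℤ) := ⟨(-x).toNat, by omega⟩
    have hy : ((y:ℤ), i) ∈ Cm (p+q) m := mem_Cm.2 ⟨hM y (by omega) (by omega), hz1.2⟩
    have hSy : S ((y:ℤ), i) ∈ Cm (p+q) m := (mem_of_fix (SS_ann hp hq hm).fix).2 hy
    rw [← eps_apply, hSdef, eps_S hm gam_inB, ← hSdef, leps _ hSy, leps _ hy, hh,
      posrec y i (by omega) (by omega) hz1.2]
    ring
  · obtain ⟨y, rfl⟩ : ∃ y : ℕ, x = (y:ℤ) := ⟨x.toNat, by omega⟩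
    exact posrec y i (by omega) (by omega) hz1.2

end

section
open Equiv Equiv.Perm
set_option linter.unusedSectionVars false
set_option linter.unusedVariables false

theorem const_o {α β : Type*} [DecidableEq α] {C : Finset α} {o : α → Bool} {S : Perm α} (hA : Ann C o S)
    {F : α → β} (hF : ∀ z ∈ C, F (S z) = F z) {z w : α} (hz : z ∈ C) (hw : w ∈ C) (h : o z = o w) : F z = F w := by
  refine sc_inv' (F := F) (fun x => ?_) (hA.tr z hz w hw h)
  by_cases hx : x ∈ C
  · exact hF x hx
  · rw [hA.fix x hx]

theorem const_all {α β : Type*} [DecidableEq α] {C : Finset α} {o : α → Bool} {S ν : Perm α} (hA : Ann C o S)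
    {F : α → β} (hF : ∀ z ∈ C, F (S z) = F z) (hν : ∀ z ∉ C, ν z = z) (hFν : ∀ z ∈ C, F (ν z) = F z)
    (hc : ∃ z, o (ν z) ≠ o z) {z w : α} (hz : z ∈ C) (hw : w ∈ C) : F z = F w := by
  obtain ⟨x, hx⟩ := hc
  have hxC : x ∈ C := by by_contra h; rw [hν x h] at hx; exact hx rfl
  have hνC : ν x ∈ C := (mem_of_fix hν).2 hxC
  have key : ∀ z ∈ C, F z = F x := by
    intro z hz
    by_cases h : o z = o x
    · exact const_o hA hF hz hxC h
    · have : o z = o (ν x) := by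
        cases h1 : o z <;> cases h2 : o x <;> cases h3 : o (ν x) <;> simp_all
      rw [const_o hA hF hz hνC this, hFν x hxC]
  rw [key z hz, key w hw]

/-- the relation between chains and indices -/
def Rl (p q m c : ℕ) (D : Finset (ℤ × ℕ)) (k : ℕ) (ν : Perm (ℤ × ℕ)) (l : ℤ × ℕ → ZMod (2*m*c)) : Prop :=
  Good (Cm (p+q) m) D (om p) (SS (p+q) m (gammaPQ p q)) ν ∧
  Wt (Cm (p+q) m) D (om p) (SS (p+q) m (gammaPQ p q)) (fun _ => m) (2*m*c) l ∧
  (∀ x, l (ν x) = l x) ∧ l (1, 0) = 0 ∧ l ((p:ℤ)+1, 0) = ((m*k : ℕ) : ZMod (2*m*c))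

theorem base_o {p q m : ℕ} (hp : 1 ≤ p) (hm : 1 ≤ m) : ((1:ℤ), 0) ∈ Cm (p+q) m ∧ om p (1, 0) = true := by
  refine ⟨mem_Cm.2 ⟨mem_Xf.2 ⟨by omega, by rw [abs_le]; push_cast; omega⟩, by omega⟩, ?_⟩
  rw [om_true, abs_le]; simp only; omega

theorem base_i {p q m : ℕ} (hq : 1 ≤ q) (hm : 1 ≤ m) : ((p:ℤ)+1, 0) ∈ Cm (p+q) m ∧ om p ((p:ℤ)+1, 0) = false := by
  refine ⟨mem_Cm.2 ⟨mem_Xf.2 ⟨by omega, by rw [abs_le]; push_cast; omega⟩, by omega⟩, ?_⟩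
  rw [← Bool.not_eq_true, om_true, abs_le]; simp only; omega

/-- colour function -/
noncomputable def colF (m c : ℕ) (l : ℤ × ℕ → ZMod (2*m*c)) (z : ℤ × ℕ) : ZMod m :=
  ZMod.castHom (show m ∣ 2*m*c from ⟨2*c, by ring⟩) (ZMod m) (l z) - (z.2 : ZMod m)

theorem colF_S {p q m c : ℕ} (hm : 1 ≤ m) {D : Finset (ℤ × ℕ)} {l : ℤ × ℕ → ZMod (2*m*c)}
    (hl : ∀ x ∈ Cm (p+q) m, l (SS (p+q) m (gammaPQ p q) x) = l x +
        (if SS (p+q) m (gammaPQ p q) x ∈ D then 1 - (m : ZMod (2*m*c)) else 1)) (z : ℤ × ℕ) (hz : z ∈ Cm (p+q) m) :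
    colF m c l (SS (p+q) m (gammaPQ p q) z) = colF m c l z := by
  unfold colF
  rw [hl z hz, map_add]
  have h1 : ZMod.castHom (show m ∣ 2*m*c from ⟨2*c, by ring⟩) (ZMod m)
    (if SS (p+q) m (gammaPQ p q) z ∈ D then 1 - (m : ZMod (2*m*c)) else 1) = 1 := by
    split_ifs
    · rw [map_sub, map_one, map_natCast, ZMod.natCast_self, sub_zero]
    · rw [map_one]
  rw [h1]
  obtain ⟨x, i⟩ := z
  rw [mem_Cm] at hz
  by_cases hi : i + 1 = m
  · rw [SS_end hz.1 hi]
    have h2 : ((i:ℕ) : ZMod m) + 1 = 0 := by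
      have h3 : ((i + 1 : ℕ) : ZMod m) = 0 := (congrArg (fun t : ℕ => (t : ZMod m)) hi).trans (ZMod.natCast_self m)
      push_cast at h3
      exact h3
    simp only [Nat.cast_zero]
    linear_combination h2
  · rw [SS_lt hz.1 (by omega)]
    push_cast; ring

theorem colF_eq {m c : ℕ} {l : ℤ × ℕ → ZMod (2*m*c)} {z w : ℤ × ℕ} (hz : z.2 < m) (hw : w.2 < m)
    (h : colF m c l z = colF m c l w) (hl : l z = l w) : z.2 = w.2 := by
  unfold colF at h
  rw [hl] at h
  have h1 : (z.2 : ZMod m) = (w.2 : ZMod m) := by linear_combination -h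
  rw [ZMod.natCast_eq_natCast_iff'] at h1
  rwa [Nat.mod_eq_of_lt hz, Nat.mod_eq_of_lt hw] at h1

theorem sz_conj {α : Type*} [DecidableEq α] {C : Finset α} {f e : Perm α} (he : ∀ z, e z ∈ C ↔ z ∈ C) (u : α) :
    sz C (e * f * e⁻¹) u = sz C f (e⁻¹ u) := by
  unfold sz
  classical
  refine Finset.card_bij (fun z _ => e⁻¹ z) ?_ ?_ ?_
  · intro z hz
    rw [Finset.mem_filter] at hz ⊢
    rw [sameCycle_conj] at hz
    exact ⟨by rw [← he, papply_inv]; exact hz.1, hz.2⟩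
  · intro z _ w _ h; exact (e⁻¹).injective h
  · intro z hz
    rw [Finset.mem_filter] at hz
    refine ⟨e z, ?_, pinv_apply e z⟩
    rw [Finset.mem_filter, sameCycle_conj, pinv_apply]
    exact ⟨(he z).2 hz.1, hz.2⟩

theorem sz_congr {α : Type*} [DecidableEq α] {C : Finset α} {f : Perm α} {u v : α} (h : f.SameCycle u v) :
    sz C f u = sz C f v := by
  unfold sz
  classical
  congr 1
  ext z
  rw [Finset.mem_filter, Finset.mem_filter]
  exact and_congr_right fun _ => ⟨fun h2 => h.symm.trans h2, fun h2 => h.trans h2⟩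

theorem rl_uniq_nu {p q m c k : ℕ} (hp : 1 ≤ p) (hq : 1 ≤ q) (hm : 1 ≤ m) {D : Finset (ℤ × ℕ)} {ν ν' : Perm (ℤ × ℕ)}
    {l l' : ℤ × ℕ → ZMod (2*m*c)} (h : Rl p q m c D k ν l) (h' : Rl p q m c D k ν' l')
    (hs : ∀ u ∈ D, sz (Cm (p+q) m) (SS (p+q) m (gammaPQ p q) * ν⁻¹) u = m)
    (hs' : ∀ u ∈ D, sz (Cm (p+q) m) (SS (p+q) m (gammaPQ p q) * ν'⁻¹) u = m) : ν = ν' := by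
  have hA := SS_ann hp hq hm (q := q)
  obtain ⟨g, w, n, b1, b2⟩ := h
  obtain ⟨g', w', n', b1', b2'⟩ := h'
  have hF : ∀ z ∈ Cm (p+q) m, l z = l' z := by
    have hFS : ∀ z ∈ Cm (p+q) m, (fun z => l z - l' z) (SS (p+q) m (gammaPQ p q) z) = (fun z => l z - l' z) z := by
      intro z hz
      simp only
      rw [w.lam z hz, w'.lam z hz]; ring
    intro z hz
    have : l z - l' z = 0 := by
      cases ho : om p z
      · rw [const_o (F := fun z => l z - l' z) hA hFS hz (base_i hq hm).1 (ho.trans (base_i (q := q) hq hm).2.symm)]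
        rw [b2, b2', sub_self]
      · rw [const_o (F := fun z => l z - l' z) hA hFS hz (base_o hp hm).1 (ho.trans (base_o (q := q) hp hm).2.symm)]
        rw [b1, b1', sub_self]
    exact sub_eq_zero.1 this
  refine T1u _ rfl hA w g hs n g' hs' (fun x => ?_)
  by_cases hx : x ∈ Cm (p+q) m
  · rw [hF _ ((mem_of_fix g'.fix).2 hx), hF _ hx, n']
  · rw [g'.fix x hx]

theorem rl_uniq_idx {p q m c k c' k' : ℕ} (hp : 1 ≤ p) (hq : 1 ≤ q) (hm : 1 ≤ m) {D D' : Finset (ℤ × ℕ)} {ν : Perm (ℤ × ℕ)}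
    {l : ℤ × ℕ → ZMod (2*m*c)} {l' : ℤ × ℕ → ZMod (2*m*c')} (h : Rl p q m c D k ν l) (h' : Rl p q m c' D' k' ν l')
    (hc : ∃ z, om p (ν z) ≠ om p z) (hk : k < 2*c) (hk' : k' < 2*c') : c = c' ∧ D = D' ∧ k = k' := by
  have hA := SS_ann hp hq hm (q := q)
  obtain ⟨g, w, n, b1, b2⟩ := h
  obtain ⟨g', w', n', b1', b2'⟩ := h'
  have hD : D = D' := T2 _ rfl hA hc g g'
  subst hD
  have hcc : c = c' := by
    have h1 := w.outer
    have h2 := w'.outer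
    have h3 : 2*m*c = 2*m*c' := by omega
    exact Nat.eq_of_mul_eq_mul_left (by omega) h3
  subst hcc
  refine ⟨rfl, rfl, ?_⟩
  have hFS : ∀ z ∈ Cm (p+q) m, (fun z => l z - l' z) (SS (p+q) m (gammaPQ p q) z) = (fun z => l z - l' z) z := by
    intro z hz
    simp only
    rw [w.lam z hz, w'.lam z hz]; ring
  have := const_all (F := fun z => l z - l' z) hA hFS g.fix (fun z _ => by rw [n, n']) hc (base_o (q := q) hp hm).1 (base_i hq hm).1
  rw [b1, b1', b2, b2', sub_zero] at this
  have h3 := sub_eq_zero.1 this.symm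
  rw [ZMod.natCast_eq_natCast_iff', Nat.mod_eq_of_lt (by nlinarith), Nat.mod_eq_of_lt (by nlinarith)] at h3
  exact Nat.eq_of_mul_eq_mul_left (by omega) h3

theorem Wt.congr {α : Type*} [DecidableEq α] {C D : Finset α} {o : α → Bool} {S : Perm α} {w w' : α → ℕ} {δ : ℕ} {l : α → ZMod δ}
    (h : Wt C D o S w δ l) (hw : ∀ u ∈ D, w u = w' u) : Wt C D o S w' δ l := by
  refine ⟨h.DC, fun u hu => by rw [← hw u hu]; exact h.pos u hu, h.dpos, ?_, ?_, ?_⟩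
  · rw [h.outer, Finset.sum_congr rfl (fun u hu => hw u (Finset.mem_filter.1 hu).1)]
  · rw [h.inner, Finset.sum_congr rfl (fun u hu => hw u (Finset.mem_filter.1 hu).1)]
  · intro x hx
    rw [h.lam x hx]
    split_ifs with h1
    · rw [hw _ h1]
    · rfl

/-- positive part counts -/
theorem card_pos {D : Finset (ℤ × ℕ)} (hs : ∀ z, epsN z ∈ D ↔ z ∈ D) (h0 : ∀ z ∈ D, z.1 ≠ 0) (P : ℤ × ℕ → Prop) [DecidablePred P]
    (hP : ∀ z, P (epsN z) ↔ P z) : (D.filter P).card = 2 * (D.filter (fun z => P z ∧ 0 < z.1)).card := by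
  have h1 : (D.filter (fun z => P z ∧ z.1 < 0)).card = (D.filter (fun z => P z ∧ 0 < z.1)).card := by
    refine Finset.card_bij (fun z _ => epsN z) ?_ ?_ ?_
    · rintro ⟨x, i⟩ hz
      rw [Finset.mem_filter] at hz ⊢
      refine ⟨(hs _).2 hz.1, (hP _).2 hz.2.1, ?_⟩
      have := hz.2.2
      rw [eps_apply]; simp only at this ⊢; omega
    · intro z _ w _ h; exact epsN.injective h
    · rintro ⟨x, i⟩ hz
      rw [Finset.mem_filter] at hz
      refine ⟨epsN (x, i), ?_, eps_eps _⟩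
      rw [Finset.mem_filter]
      refine ⟨(hs _).2 hz.1, (hP _).2 hz.2.1, ?_⟩
      have := hz.2.2
      rw [eps_apply]; simp only at this ⊢; omega
  have h2 : D.filter P = D.filter (fun z => P z ∧ z.1 < 0) ∪ D.filter (fun z => P z ∧ 0 < z.1) := by
    ext z
    rw [Finset.mem_union, Finset.mem_filter, Finset.mem_filter, Finset.mem_filter]
    constructor
    · rintro ⟨h3, h4⟩
      rcases lt_or_gt_of_ne (h0 z h3) with h5 | h5
      · exact Or.inl ⟨h3, h4, h5⟩
      · exact Or.inr ⟨h3, h4, h5⟩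
    · rintro (h | h) <;> exact ⟨h.1, h.2.1⟩
  rw [h2, Finset.card_union_of_disjoint, h1]
  · ring
  · rw [Finset.disjoint_left]
    intro z hz hz'
    have := (Finset.mem_filter.1 hz).2.2
    have := (Finset.mem_filter.1 hz').2.2
    omega

end

section
open Equiv Equiv.Perm
set_option linter.unusedSectionVars false
set_option linter.unusedVariables false

/-- admissible symmetric marked sets -/
structure VD (p q m c : ℕ) (D : Finset (ℤ × ℕ)) : Prop where
  DC : D ⊆ Cm (p+q) m
  sy : ∀ z, epsN z ∈ D ↔ z ∈ D
  ho : (D.filter (fun z => ((0:ℕ):ℤ) < z.1 ∧ z.1 ≤ (p:ℤ))).card + c = p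
  hi : (D.filter (fun z => (p:ℤ) < z.1 ∧ z.1 ≤ ((p+q:ℕ):ℤ))).card = q + c

theorem half_o {p q m : ℕ} {D : Finset (ℤ × ℕ)} (hDC : D ⊆ Cm (p+q) m) (hs : ∀ z, epsN z ∈ D ↔ z ∈ D) :
    (D.filter (fun z => om p z = true)).card = 2 * (D.filter (fun z => ((0:ℕ):ℤ) < z.1 ∧ z.1 ≤ (p:ℤ))).card := by
  rw [card_pos hs (fun z hz => (mem_Xf.1 (mem_Cm.1 (hDC hz)).1).1) (fun z => om p z = true) (fun z => by rw [eps_o])]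
  congr 2
  apply Finset.filter_congr
  intro z _
  rw [om_true, abs_le]
  push_cast; omega

theorem half_i {p q m : ℕ} {D : Finset (ℤ × ℕ)} (hDC : D ⊆ Cm (p+q) m) (hs : ∀ z, epsN z ∈ D ↔ z ∈ D) :
    (D.filter (fun z => om p z = false)).card = 2 * (D.filter (fun z => (p:ℤ) < z.1 ∧ z.1 ≤ ((p+q:ℕ):ℤ))).card := by
  rw [card_pos hs (fun z hz => (mem_Xf.1 (mem_Cm.1 (hDC hz)).1).1) (fun z => om p z = false) (fun z => by rw [eps_o])]
  congr 2
  apply Finset.filter_congr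
  intro z hz
  have := (mem_Xf.1 (mem_Cm.1 (hDC hz)).1).2
  rw [abs_le] at this
  rw [← Bool.not_eq_true, om_true, abs_le]
  omega

theorem C_o (p q m : ℕ) : ((Cm (p+q) m).filter (fun z => om p z = true)).card = 2 * p * m := by
  rw [← card_Cm]
  congr 1
  ext ⟨x, i⟩
  rw [Finset.mem_filter, mem_Cm, mem_Cm, om_true, mem_Xf, mem_Xf]
  constructor
  · rintro ⟨⟨h1, h2⟩, h3⟩; exact ⟨⟨h1.1, h3⟩, h2⟩
  · rintro ⟨h1, h2⟩
    refine ⟨⟨⟨h1.1, ?_⟩, h2⟩, h1.2⟩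
    have := h1.2
    push_cast; omega

theorem split_o (p : ℕ) (D : Finset (ℤ × ℕ)) : D.card = (D.filter (fun z => om p z = true)).card + (D.filter (fun z => om p z = false)).card := by
  rw [← Finset.card_filter_add_card_filter_not (s := D) (fun z => om p z = true)]
  congr 2
  apply Finset.filter_congr
  intro z _
  rw [Bool.not_eq_true]

theorem C_i (p q m : ℕ) : ((Cm (p+q) m).filter (fun z => om p z = false)).card = 2 * q * m := by
  have h1 := split_o p (Cm (p+q) m)
  rw [card_Cm, C_o] at h1
  have : 2 * (p+q) * m = 2 * p * m + 2 * q * m := by ring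
  omega

theorem exist_idx {p q m : ℕ} (hp : 1 ≤ p) (hq : 1 ≤ q) (hm : 1 ≤ m) {σ : ℕ → Perm ℤ}
    (h : Ch (p+q) m (gammaPQ p q) σ) (hc : Cn p σ) : ∃ c D k, ∃ l : ℤ × ℕ → ZMod (2*m*c),
    1 ≤ c ∧ c ≤ p ∧ VD p q m c D ∧ k < 2*c ∧ Rl p q m c D k (nu σ) l := by
  have hA := SS_ann hp hq hm (q := q)
  obtain ⟨D, hD⟩ := ch_good hp hq hm h hc
  have hs := good_symm hp hq hm (nu_eps h.B) hc hD
  have hsz : ∀ u ∈ D, sz (Cm (p+q) m) (SS (p+q) m (gammaPQ p q) * (nu σ)⁻¹) u = m :=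
    fun u hu => psi_sz hm gam_inB h.B h.z h.e (hD.DC hu)
  have h1 := outer_lt hA hc hD
  rw [Finset.sum_congr rfl (fun u hu => hsz u (Finset.mem_filter.1 hu).1), Finset.sum_const, smul_eq_mul, C_o,
    half_o hD.DC hs] at h1
  set a := (D.filter (fun z => ((0:ℕ):ℤ) < z.1 ∧ z.1 ≤ (p:ℤ))).card with ha
  have hap : a < p := by
    by_contra hcon
    have : 2 * p * m ≤ 2 * a * m := Nat.mul_le_mul_right _ (by omega)
    omega
  obtain ⟨c, hcp⟩ : ∃ c, a + c = p := ⟨p - a, by omega⟩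
  have hcard := psi_tr hm gam_inB h.B h.z h.e hD.trψ
  rw [split_o p, half_o hD.DC hs, half_i hD.DC hs, ← ha] at hcard
  have hVD : VD p q m c D := ⟨hD.DC, hs, hcp, by omega⟩
  have hδ : ((Cm (p+q) m).filter (fun x => om p x = true)).card = 2*m*c + ∑ u ∈ D.filter (fun x => om p x = true), 
      sz (Cm (p+q) m) (SS (p+q) m (gammaPQ p q) * (nu σ)⁻¹) u := by
    rw [Finset.sum_congr rfl (fun u hu => hsz u (Finset.mem_filter.1 hu).1), Finset.sum_const, smul_eq_mul, C_o,
      half_o hD.DC hs, ← ha, ← hcp]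
    ring
  obtain ⟨l, hl, hlν⟩ := LamW hA hc hD (by nlinarith : 1 ≤ 2*m*c) hδ
  have hl := hl.congr (w' := fun _ => m) hsz
  set l' : ℤ × ℕ → ZMod (2*m*c) := fun z => l z - l (1, 0) with hl'
  have hW : Wt (Cm (p+q) m) D (om p) (SS (p+q) m (gammaPQ p q)) (fun _ => m) (2*m*c) l' := by
    refine ⟨hl.DC, hl.pos, hl.dpos, hl.outer, hl.inner, fun x hx => ?_⟩
    rw [hl']; simp only
    rw [hl.lam x hx]; ring
  have hlν' : ∀ x, l' (nu σ x) = l' x := fun x => by rw [hl']; simp only; rw [hlν]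
  have hb1 : l' (1, 0) = 0 := by rw [hl']; simp only; rw [sub_self]
  have hcol := const_all (F := colF m c l') hA (colF_S hm hW.lam) hD.fix (fun z _ => by
    obtain ⟨x, i⟩ := z
    unfold colF
    rw [hlν']; rfl) hc (base_i hq hm).1 (base_o (q := q) hp hm).1
  unfold colF at hcol
  rw [hb1, map_zero] at hcol
  simp only [Nat.cast_zero, sub_zero] at hcol
  have : NeZero (2*m*c) := ⟨by have := hW.dpos; omega⟩
  have hval : ((l' ((p:ℤ)+1, 0)).val : ZMod m) = 0 := by
    rw [← hcol]
    rw [ZMod.castHom_apply, ZMod.cast_eq_val]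
  rw [ZMod.natCast_eq_zero_iff] at hval
  obtain ⟨k, hk⟩ := hval
  have hlt := ZMod.val_lt (l' ((p:ℤ)+1, 0))
  refine ⟨c, D, k, l', by omega, by omega, hVD, ?_, hD, hW, hlν', hb1, ?_⟩
  · rw [hk, show 2*m*c = m*(2*c) by ring] at hlt
    exact Nat.lt_of_mul_lt_mul_left hlt
  · rw [← hk, ZMod.natCast_zmod_val]

theorem exists_fib {n m : ℕ} {ν : Perm (ℤ × ℕ)} (hfix : ∀ z ∉ Cm n m, ν z = z) (hcol : ∀ z, (ν z).2 = z.2)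
    (hε : ∀ z, ν (epsN z) = epsN (ν z)) : ∃ g : ℕ → Perm ℤ, ν = fib g ∧ ∀ i, inB n (g i) := by
  have hcol' : ∀ z, (ν⁻¹ z).2 = z.2 := fun z => by rw [← hcol, papply_inv]
  let g : ℕ → Perm ℤ := fun i =>
    { toFun := fun x => (ν (x, i)).1
      invFun := fun x => (ν⁻¹ (x, i)).1
      left_inv := fun x => by
        show (ν⁻¹ ((ν (x, i)).1, i)).1 = x
        have : ((ν (x, i)).1, i) = ν (x, i) := Prod.ext rfl (hcol (x, i)).symm
        rw [this, pinv_apply]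
      right_inv := fun x => by
        show (ν ((ν⁻¹ (x, i)).1, i)).1 = x
        have : ((ν⁻¹ (x, i)).1, i) = ν⁻¹ (x, i) := Prod.ext rfl (hcol' (x, i)).symm
        rw [this, papply_inv] }
  refine ⟨g, ?_, fun i => ⟨fun x => ?_, fun x hx => ?_⟩⟩
  · ext1 ⟨x, i⟩
    exact Prod.ext rfl (hcol (x, i))
  · show (ν (-x, i)).1 = -(ν (x, i)).1
    have := hε (x, i)
    rw [eps_apply] at this
    rw [this]; rfl
  · show (ν (x, i)).1 = x
    rw [hfix (x, i) (fun h => hx (mem_Xf.1 (mem_Cm.1 h).1))]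

/-- partial products -/
def prodσ (g : ℕ → Perm ℤ) : ℕ → Perm ℤ
  | 0 => 1
  | i + 1 => prodσ g i * g i

theorem exist_sigma {p q m c k : ℕ} (hp : 1 ≤ p) (hq : 1 ≤ q) (hm : 1 ≤ m) (hc : 1 ≤ c) {D : Finset (ℤ × ℕ)} (hD : VD p q m c D) :
    ∃ σ, ∃ l : ℤ × ℕ → ZMod (2*m*c), Ch (p+q) m (gammaPQ p q) σ ∧ Cn p σ ∧ Rl p q m c D k (nu σ) l := by
  have hA := SS_ann hp hq hm (q := q)
  obtain ⟨l, hl, hle, hb1, hb2⟩ := lam_exists (k := k) hp hq hm (fun z hz => (mem_Cm.1 (hD.DC hz)).2) hD.sy hD.ho hD.hi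
  have hW : Wt (Cm (p+q) m) D (om p) (SS (p+q) m (gammaPQ p q)) (fun _ => m) (2*m*c) l := by
    refine ⟨hD.DC, fun _ _ => hm, by nlinarith, ?_, ?_, hl⟩
    · rw [C_o, Finset.sum_const, smul_eq_mul, half_o hD.DC hD.sy]
      have := hD.ho
      generalize (D.filter (fun z => ((0:ℕ):ℤ) < z.1 ∧ z.1 ≤ (p:ℤ))).card = a at this
      subst this; ring
    · rw [C_i, Finset.sum_const, smul_eq_mul, half_i hD.DC hD.sy, hD.hi]; ring
  obtain ⟨ν, hg, hsz, hlν, hcon⟩ := T1e _ rfl hA hW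
  -- equivariance
  have hε : ∀ z, ν (epsN z) = epsN (ν z) := by
    have himg : D.image epsN = D := by
      ext z
      rw [Finset.mem_image]
      exact ⟨fun ⟨w, hw, e⟩ => e ▸ (hD.sy w).2 hw, fun h => ⟨epsN z, (hD.sy z).2 h, eps_eps z⟩⟩
    have hSc := conj_eq (eps_S (n := p+q) hm (gam_inB (p := p) (q := q)))
    have hg' := good_conj (e := epsN) (fun z => eps_C) eps_o hSc hg
    rw [himg] at hg'
    have heq := T1u _ rfl hA hW hg hsz hlν hg' (fun u hu => ?_) (fun x => ?_)
    · intro z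
      conv_lhs => rw [heq]
      rw [Perm.mul_apply, Perm.mul_apply, pinv_apply]
    · have hψ : SS (p+q) m (gammaPQ p q) * (epsN * ν * epsN⁻¹)⁻¹ = epsN * (SS (p+q) m (gammaPQ p q) * ν⁻¹) * epsN⁻¹ := by
        conv_lhs => rw [← hSc]
        group
      rw [hψ, sz_conj (fun z => eps_C)]
      exact hsz _ ((hD.sy u).2 hu)
    · by_cases hx : x ∈ Cm (p+q) m
      · have hx' := eps_C.2 hx
        rw [Perm.mul_apply, Perm.mul_apply, eps_inv, hle _ ((mem_of_fix hg.fix).2 hx'), hlν, hle x hx, add_assoc]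
        have h2 := ZMod.natCast_self (2*m*c)
        push_cast at h2 ⊢
        linear_combination h2
      · rw [hg'.fix x hx]
  -- colours
  have hcol0 : ∀ z ∈ Cm (p+q) m, colF m c l z = 0 := by
    intro z hz
    have hS := colF_S (p := p) (q := q) hm hl
    cases ho : om p z
    · rw [const_o hA hS hz (base_i hq hm).1 (ho.trans (base_i (q := q) hq hm).2.symm)]
      unfold colF
      rw [hb2, map_natCast]
      push_cast
      rw [ZMod.natCast_self]; ring
    · rw [const_o hA hS hz (base_o hp hm).1 (ho.trans (base_o (q := q) hp hm).2.symm)]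
      unfold colF
      rw [hb1, map_zero]; simp
  have hcol : ∀ z, (ν z).2 = z.2 := by
    intro z
    by_cases hz : z ∈ Cm (p+q) m
    · have hz' := (mem_of_fix hg.fix).2 hz
      exact colF_eq (mem_Cm.1 hz').2 (mem_Cm.1 hz).2 ((hcol0 _ hz').trans (hcol0 _ hz).symm) (hlν z)
    · rw [hg.fix z hz]
  obtain ⟨g, hνg, hgB⟩ := exists_fib hg.fix hcol hε
  have hg1 : ∀ i, m ≤ i → g i = 1 := by
    intro i hi
    ext x
    have h1 := hg.fix (x, i) (fun h => by have := (mem_Cm.1 h).2; omega)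
    rw [hνg, fib_apply] at h1
    exact congrArg Prod.fst h1
  set σ := prodσ g with hσ
  have hz : σ 0 = 1 := rfl
  have hstep : ∀ i, σ (i+1) = σ i * g i := fun i => rfl
  have hB : ∀ i, inB (p+q) (σ i) := by
    intro i
    induction i with
    | zero => exact inB_one _
    | succ i ih => exact ih.mul (hgB i)
  have hinc : ∀ i, (σ i)⁻¹ * σ (i+1) = g i := fun i => by rw [hstep, inv_mul_cancel_left]
  have hnu : nu σ = ν := by
    rw [hνg]; unfold nu
    congr 1
    funext i; exact hinc i
  have hm' : σ m = gammaPQ p q := by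
    ext x
    by_cases hx : x ∈ signedSet (p+q)
    · have hx' : (σ m) x ∈ Xf (p+q) := mem_Xf.2 ((hB m).mem.2 hx)
      have h1 := psi_full (γ := gammaPQ p q) hm hB hz hx'
      rw [pinv_apply, hnu] at h1
      have hmem : (σ m x, 0) ∈ Cm (p+q) m := mem_Cm.2 ⟨hx', by omega⟩
      have hψfix : ∀ z ∉ Cm (p+q) m, (SS (p+q) m (gammaPQ p q) * ν⁻¹) z = z := by
        intro z hz
        rw [Perm.mul_apply, fix_inv hg.fix z hz, SS_out hm gam_inB hz]
      obtain ⟨u, ⟨hu, hxu⟩, -⟩ := hg.trψ.2 _ hmem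
      have h2 := (sz_spec hψfix hmem).1
      rw [sz_congr hxu, hsz u hu] at h2
      have h3 : ((SS (p+q) m (gammaPQ p q) * ν⁻¹) ^ m) (σ m x, 0) = (σ m x, 0) := by
        have h4 := Function.iterate_minimalPeriod (f := ⇑(SS (p+q) m (gammaPQ p q) * ν⁻¹)) (x := (σ m x, 0))
        rw [← h2] at h4
        rw [Perm.coe_pow]
        exact h4
      rw [h3] at h1
      exact congrArg Prod.fst h1
    · rw [(hB m).2 x hx, gam_inB.2 x hx]
  have he : ∀ i, m ≤ i → σ i = gammaPQ p q := by
    intro i hi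
    obtain ⟨j, rfl⟩ := Nat.exists_eq_add_of_le hi
    clear hi
    induction j with
    | zero => exact hm'
    | succ j ih => rw [← add_assoc, hstep, ih, hg1 _ (by omega), mul_one]
  have hdim : ∑ i ∈ Finset.range m, dm (p+q) ((σ i)⁻¹ * σ (i+1)) + (p+q) = m * (p+q) := by
    apply le_antisymm
    · have := tele (n := p+q) σ 0 m
      simp only [zero_add, hz, inv_one, one_mul] at this
      rwa [hm', dm_bot (gam_bot hp hq), zero_add] at this
    · have h1 : ∀ i ∈ Finset.range m, (slc (Cm (p+q) m \ D) i).card ≤ 2 * dm (p+q) ((σ i)⁻¹ * σ (i+1)) := by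
        intro i hi
        have hi := Finset.mem_range.1 hi
        have ht : Tr (Cm (p+q) m) (fib g) (Cm (p+q) m \ D) := by rw [← hνg]; exact hg.trν
        rw [hinc]
        refine (tr_dm (hgB i) (tr_slc ht hi)).2 (fun x hx hsc => ?_)
        apply good_noinv hε hg hD.sy (z := (x, i)) (mem_Cm.2 ⟨hx, hi⟩)
        rw [eps_apply, hνg, fib_sc]
        exact ⟨rfl, hsc⟩
      have h2 := Finset.sum_le_sum h1
      rw [← card_slc (fun z hz => (mem_Cm.1 (Finset.mem_sdiff.1 hz).1).2), ← Finset.mul_sum,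
        Finset.card_sdiff_of_subset hD.DC, card_Cm, split_o p D, half_o hD.DC hD.sy, half_i hD.DC hD.sy, hD.hi] at h2
      have h3 := hD.ho
      have h4 : 2 * (p+q) * m = 2 * (m * (p+q)) := by ring
      omega
  have hCh : Ch (p+q) m (gammaPQ p q) σ := ⟨hB, hz, he, hdim⟩
  refine ⟨σ, l, hCh, ?_, ?_⟩
  · unfold Cn; rw [hnu]; exact hcon
  · rw [hnu]; exact ⟨hg, hW, hlν, hb1, hb2⟩

theorem nu_inj {σ σ' : ℕ → Perm ℤ} (h0 : σ 0 = 1) (h0' : σ' 0 = 1) (h : nu σ = nu σ') : σ = σ' := by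
  funext i
  induction i with
  | zero => rw [h0, h0']
  | succ i ih =>
    ext x
    have h1 : nu σ (x, i) = nu σ' (x, i) := by rw [h]
    unfold nu at h1
    rw [fib_apply, fib_apply, ih] at h1
    have h2 : ((σ' i)⁻¹ * σ (i+1)) x = ((σ' i)⁻¹ * σ' (i+1)) x := congrArg Prod.fst h1
    rw [Perm.mul_apply, Perm.mul_apply] at h2
    exact (σ' i)⁻¹.injective h2

end

section
open Equiv Equiv.Perm
set_option linter.unusedSectionVars false
set_option linter.unusedVariables false

theorem rel_card {α β : Type*} (s : Finset α) (t : Set β) (R : α → β → Prop)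
    (h1 : ∀ a ∈ s, ∃ b ∈ t, R a b) (h2 : ∀ b ∈ t, ∃ a ∈ s, R a b)
    (h3 : ∀ a ∈ s, ∀ b ∈ t, ∀ b' ∈ t, R a b → R a b' → b = b')
    (h4 : ∀ a ∈ s, ∀ a' ∈ s, ∀ b ∈ t, R a b → R a' b → a = a') : t.ncard = s.card := by
  rw [← Set.ncard_coe_finset s]
  symm
  choose f hf using h1
  refine Set.ncard_congr (fun a ha => f a ha) (fun a ha => (hf a ha).1) (fun a a' ha ha' e => ?_) (fun b hb => ?_)
  · refine h4 a ha a' ha' _ (hf a ha).1 (hf a ha).2 ?_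
    have := (hf a' ha').2
    rwa [← e] at this
  · obtain ⟨a, ha, hr⟩ := h2 b hb
    exact ⟨a, ha, h3 a ha _ (hf a ha).1 _ hb (hf a ha).2 hr⟩

noncomputable def Ho (p m : ℕ) : Finset (ℤ × ℕ) := Finset.Icc (1:ℤ) p ×ˢ Finset.range m
noncomputable def Hi (p q m : ℕ) : Finset (ℤ × ℕ) := Finset.Icc ((p:ℤ)+1) (p+q) ×ˢ Finset.range m
noncomputable def symD (a b : Finset (ℤ × ℕ)) : Finset (ℤ × ℕ) := (a ∪ b) ∪ (a ∪ b).image epsN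

theorem mem_Ho {p m : ℕ} {z : ℤ × ℕ} : z ∈ Ho p m ↔ (1 ≤ z.1 ∧ z.1 ≤ (p:ℤ)) ∧ z.2 < m := by
  unfold Ho; rw [Finset.mem_product, Finset.mem_Icc, Finset.mem_range]
theorem mem_Hi {p q m : ℕ} {z : ℤ × ℕ} : z ∈ Hi p q m ↔ ((p:ℤ) + 1 ≤ z.1 ∧ z.1 ≤ (p:ℤ)+q) ∧ z.2 < m := by
  unfold Hi; rw [Finset.mem_product, Finset.mem_Icc, Finset.mem_range]
theorem card_Ho (p m : ℕ) : (Ho p m).card = m * p := by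
  unfold Ho; rw [Finset.card_product, Int.card_Icc, Finset.card_range, mul_comm]; congr 1; omega
theorem card_Hi (p q m : ℕ) : (Hi p q m).card = m * q := by
  unfold Hi; rw [Finset.card_product, Int.card_Icc, Finset.card_range, mul_comm]; congr 1; omega

theorem mem_symD {a b : Finset (ℤ × ℕ)} {z : ℤ × ℕ} : z ∈ symD a b ↔ (z ∈ a ∨ z ∈ b) ∨ (epsN z ∈ a ∨ epsN z ∈ b) := by
  unfold symD
  rw [Finset.mem_union, Finset.mem_union, Finset.mem_image]
  apply or_congr Iff.rfl
  constructor
  · rintro ⟨w, hw, rfl⟩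
    rw [eps_eps]; exact Finset.mem_union.1 hw
  · intro h
    exact ⟨epsN z, Finset.mem_union.2 h, eps_eps z⟩

theorem symD_o {p q m : ℕ} {a b : Finset (ℤ × ℕ)} (ha : a ⊆ Ho p m) (hb : b ⊆ Hi p q m) :
    (symD a b).filter (fun z => ((0:ℕ):ℤ) < z.1 ∧ z.1 ≤ (p:ℤ)) = a := by
  ext ⟨x, i⟩
  rw [Finset.mem_filter, mem_symD, eps_apply]
  constructor
  · rintro ⟨(h | h) | (h | h), h1, h2⟩
    · exact h
    · have := mem_Hi.1 (hb h); dsimp only at *; omega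
    · have := mem_Ho.1 (ha h); dsimp only at *; omega
    · have := mem_Hi.1 (hb h); dsimp only at *; omega
  · intro h
    have := mem_Ho.1 (ha h)
    exact ⟨Or.inl (Or.inl h), by dsimp only at *; omega⟩

theorem symD_i {p q m : ℕ} {a b : Finset (ℤ × ℕ)} (ha : a ⊆ Ho p m) (hb : b ⊆ Hi p q m) :
    (symD a b).filter (fun z => (p:ℤ) < z.1 ∧ z.1 ≤ ((p+q:ℕ):ℤ)) = b := by
  ext ⟨x, i⟩
  rw [Finset.mem_filter, mem_symD, eps_apply]
  constructor
  · rintro ⟨(h | h) | (h | h), h1, h2⟩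
    · have := mem_Ho.1 (ha h); dsimp only at *; omega
    · exact h
    · have := mem_Ho.1 (ha h); dsimp only at *; omega
    · have := mem_Hi.1 (hb h); dsimp only at *; omega
  · intro h
    have := mem_Hi.1 (hb h)
    exact ⟨Or.inl (Or.inr h), by dsimp only at *; push_cast; omega⟩

theorem symD_VD {p q m c : ℕ} {a b : Finset (ℤ × ℕ)} (ha : a ⊆ Ho p m) (hb : b ⊆ Hi p q m)
    (hca : a.card + c = p) (hcb : b.card = q + c) : VD p q m c (symD a b) := by
  refine ⟨?_, ?_, by rw [symD_o ha hb]; exact hca, by rw [symD_i ha hb]; exact hcb⟩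
  · have h0 : ∀ z, (z ∈ a ∨ z ∈ b) → z ∈ Cm (p+q) m := by
      rintro ⟨x, i⟩ (h | h)
      · have := mem_Ho.1 (ha h)
        refine mem_Cm.2 ⟨mem_Xf.2 ⟨?_, ?_⟩, this.2⟩
        · dsimp only at *; omega
        · rw [abs_le]; push_cast; dsimp only at *; omega
      · have := mem_Hi.1 (hb h)
        refine mem_Cm.2 ⟨mem_Xf.2 ⟨?_, ?_⟩, this.2⟩
        · dsimp only at *; omega
        · rw [abs_le]; push_cast; dsimp only at *; omega
    intro z hz
    rcases mem_symD.1 hz with h | h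
    · exact h0 z h
    · exact eps_C.1 (h0 _ h)
  · intro z
    rw [mem_symD, mem_symD, eps_eps, or_comm]

theorem VD_symD {p q m c : ℕ} {D : Finset (ℤ × ℕ)} (h : VD p q m c D) :
    ∃ a b, a ⊆ Ho p m ∧ b ⊆ Hi p q m ∧ a.card + c = p ∧ b.card = q + c ∧ symD a b = D := by
  refine ⟨_, _, ?_, ?_, h.ho, h.hi, ?_⟩
  · intro ⟨x, i⟩ hz
    rw [Finset.mem_filter] at hz
    have := (mem_Cm.1 (h.DC hz.1)).2
    rw [mem_Ho]; dsimp only at *; omega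
  · intro ⟨x, i⟩ hz
    rw [Finset.mem_filter] at hz
    have := (mem_Cm.1 (h.DC hz.1)).2
    rw [mem_Hi]; dsimp only at *; push_cast at hz; omega
  · ext ⟨x, i⟩
    rw [mem_symD]
    simp only [Finset.mem_filter, h.sy]
    rw [eps_apply]
    constructor
    · rintro ((h | h) | (h | h)) <;> exact h.1
    · intro hz
      have h1 := mem_Xf.1 (mem_Cm.1 (h.DC hz)).1
      obtain ⟨h1, h2⟩ := h1
      rw [abs_le] at h2
      simp only [hz, true_and]
      push_cast at *
      omega

theorem final {p q m : ℕ} (hp : 1 ≤ p) (hq : 1 ≤ q) (hm : 1 ≤ m) :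
    {σ | Ch (p+q) m (gammaPQ p q) σ ∧ Cn p σ}.ncard =
      ∑ c ∈ Finset.Icc 1 p, 2 * c * Nat.choose (m * p) (p - c) * Nat.choose (m * q) (q + c) := by
  rw [rel_card ((Finset.Icc 1 p).sigma (fun c => (Finset.powersetCard (p-c) (Ho p m) ×ˢ
    Finset.powersetCard (q+c) (Hi p q m)) ×ˢ Finset.range (2*c))) _
    (fun x σ => ∃ l : ℤ × ℕ → ZMod (2*m*x.1), Rl p q m x.1 (symD x.2.1.1 x.2.1.2) x.2.2 (nu σ) l)]
  · rw [Finset.card_sigma]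
    refine Finset.sum_congr rfl (fun c _ => ?_)
    rw [Finset.card_product, Finset.card_product, Finset.card_powersetCard, Finset.card_powersetCard,
      card_Ho, card_Hi, Finset.card_range]
    ring
  · rintro ⟨c, ⟨⟨a, b⟩, k⟩⟩ hx
    simp only [Finset.mem_sigma, Finset.mem_product, Finset.mem_powersetCard, Finset.mem_range, Finset.mem_Icc] at hx
    obtain ⟨⟨hc1, hc2⟩, ⟨⟨ha, hca⟩, hb, hcb⟩, hk⟩ := hx
    obtain ⟨σ, l, h1, h2, h3⟩ := exist_sigma (k := k) hp hq hm hc1 (symD_VD ha hb (by omega) hcb)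
    exact ⟨σ, ⟨h1, h2⟩, l, h3⟩
  · rintro σ ⟨h1, h2⟩
    obtain ⟨c, D, k, l, hc1, hc2, hD, hk, hR⟩ := exist_idx hp hq hm h1 h2
    obtain ⟨a, b, ha, hb, hca, hcb, rfl⟩ := VD_symD hD
    refine ⟨⟨c, ⟨⟨a, b⟩, k⟩⟩, ?_, l, hR⟩
    simp only [Finset.mem_sigma, Finset.mem_product, Finset.mem_powersetCard, Finset.mem_range, Finset.mem_Icc]
    exact ⟨⟨hc1, hc2⟩, ⟨⟨ha, by omega⟩, hb, hcb⟩, hk⟩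
  · rintro ⟨c, ⟨⟨a, b⟩, k⟩⟩ hx σ ⟨h1, h2⟩ σ' ⟨h1', h2'⟩ ⟨l, hl⟩ ⟨l', hl'⟩
    simp only [Finset.mem_sigma, Finset.mem_product, Finset.mem_powersetCard, Finset.mem_range, Finset.mem_Icc] at hx
    obtain ⟨⟨hc1, hc2⟩, ⟨⟨ha, hca⟩, hb, hcb⟩, hk⟩ := hx
    have hV := symD_VD (c := c) ha hb (by omega) hcb
    exact nu_inj h1.z h1'.z (rl_uniq_nu hp hq hm hl hl' (fun u hu => psi_sz hm gam_inB h1.B h1.z h1.e (hV.DC hu))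
      (fun u hu => psi_sz hm gam_inB h1'.B h1'.z h1'.e (hV.DC hu)))
  · rintro ⟨c, ⟨⟨a, b⟩, k⟩⟩ hx ⟨c', ⟨⟨a', b'⟩, k'⟩⟩ hx' σ ⟨h1, h2⟩ ⟨l, hl⟩ ⟨l', hl'⟩
    simp only [Finset.mem_sigma, Finset.mem_product, Finset.mem_powersetCard, Finset.mem_range, Finset.mem_Icc] at hx hx'
    obtain ⟨⟨hc1, hc2⟩, ⟨⟨ha, hca⟩, hb, hcb⟩, hk⟩ := hx
    obtain ⟨⟨hc1', hc2'⟩, ⟨⟨ha', hca'⟩, hb', hcb'⟩, hk'⟩ := hx'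
    obtain ⟨e1, e2, e3⟩ := rl_uniq_idx hp hq hm hl hl' h2 hk hk'
    dsimp only at e1 e2 e3
    have ea : a = a' := by rw [← symD_o ha hb, e2, symD_o ha' hb']
    have eb : b = b' := by rw [← symD_i ha hb, e2, symD_i ha' hb']
    subst e1 e3 ea eb
    rfl

end

/-- For `m ≥ 2`, the number of multichains `π_1 ≤ ⋯ ≤ π_{m-1}` in `NC^B(p,q)`
in which at least one `π_i` has positive connectivity equals
`Σ_{c ≥ 1} 2c·C(mp, p-c)·C(mq, q+c)` (the summands vanish for `c > p`). -/
theorem ncb_multichain_posconn_card (p q m : ℕ) (hp : 1 ≤ p) (hq : 1 ≤ q) (hm : 2 ≤ m) :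
    {f : Fin (m - 1) → Set (Set ℤ) |
        (∀ i, f i ∈ NCB p q) ∧
        (∀ i j : Fin (m - 1), i ≤ j → refines (f i) (f j)) ∧
        (∃ i, 0 < connectivity p q (f i))}.ncard =
      ∑ c ∈ Finset.Icc 1 p,
        2 * c * Nat.choose (m * p) (p - c) * Nat.choose (m * q) (q + c) := by
  rw [ncard_eq hp hq hm]
  exact final hp hq (by omega)
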